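/- arXiv:math/0601007 — 2 statements merged into one kernel-verified Lean document; each statement's English description precedes it below -/
import Mathlib

section
/- Let F be the centered Gaussian process with covariance E[F(s)F(t)] = (2π)^{-1/2}(√(t+s) − √|t−s|), let {h_j} and L satisfy the deterministic form of Assumption 3.1, and let B_n(t) = ∑_{j=1}^{⌊nt⌋} σ_j² h_j(σ_j^{-1} ΔF_j). Suppose there is a constant κ ≥ 0 such that lim_{n→∞} E|B_n(t) − B_n(s)|² = κ²(t − s) for all 0 ≤ s < t. Then for all times 0 ≤ r_1 < … < r_ℓ and 0 ≤ u_0 < u_1 < … < u_d, the law on ℝ^{ℓ+d} of the random vector (F(r_1), …, F(r_ℓ), B_n(u_1) − B_n(u_0), …, B_n(u_d) − B_n(u_{d−1})) converges weakly, as n → ∞, to μ ⊗ ν, where μ is the law of (F(r_1), …, F(r_ℓ)) and ν is the product of the centered Gaussian laws on ℝ with variances κ²(u_k − u_{k−1}), k = 1, …, d. (Finite-dimensional form of the invariance principle: B_n converges to κ times a Brownian motion independent of F.) -/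
open MeasureTheory ProbabilityTheory Filter

/-- The covariance function `K(s,t) = (2π)^{-1/2}(√(t+s) − √|t−s|)`. -/
noncomputable def covK (s t : ℝ) : ℝ :=
  (Real.sqrt (2 * Real.pi))⁻¹ * (Real.sqrt (t + s) - Real.sqrt |t - s|)

/-- `F` is the centered Gaussian process with covariance `covK`, on a probability
space `(Ω, P)`: every finite linear combination of values of `F` at nonnegative
times is centered Gaussian with the prescribed variance. -/
def IsHeatGaussian {Ω : Type*} [MeasurableSpace Ω] (P : Measure Ω)
    (F : ℝ → Ω → ℝ) : Prop :=
  IsProbabilityMeasure P ∧ (∀ t : ℝ, Measurable (F t)) ∧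
  ∀ (m : ℕ) (ts : Fin m → ℝ) (c : Fin m → ℝ), (∀ i, 0 ≤ ts i) →
    Measure.map (fun ω => ∑ i, c i * F (ts i) ω) P =
      gaussianReal 0 (Real.toNNReal (∑ i, ∑ j, c i * c j * covK (ts i) (ts j)))

/-- A measure on `ℝ × ℝ` is a centered jointly Gaussian pair if every linear
combination of the coordinates has a centered Gaussian law. -/
def JointlyGaussianPair (μ : Measure (ℝ × ℝ)) : Prop :=
  ∀ a b : ℝ, ∃ v : NNReal,
    Measure.map (fun p => a * p.1 + b * p.2) μ = gaussianReal 0 v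

/-- The deterministic form of Assumption 3.1: each `h j` is `C¹`, with
`h_j(0)² ≤ L`, `h_j'(0)² ≤ L`, `h_j'` Lipschitz with constant `L_j`, `L_j² ≤ L`;
`E[h_j(X)] = 0` for a standard Gaussian `X`; and `|E[h_i(X)h_j(Y)]| ≤ L|ρ|` for
`i ≠ j` whenever `(X,Y)` is centered jointly Gaussian with unit variances and
covariance `ρ`. -/
def Assumption31 {ι : Type*} (h : ι → ℝ → ℝ) (L : ℝ) : Prop :=
  (∀ j, ContDiff ℝ 1 (h j)) ∧
  (∀ j, (h j 0) ^ 2 ≤ L) ∧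
  (∀ j, (deriv (h j) 0) ^ 2 ≤ L) ∧
  (∀ j, ∃ Lj : ℝ, Lj ^ 2 ≤ L ∧
    ∀ x y : ℝ, |deriv (h j) x - deriv (h j) y| ≤ Lj * |x - y|) ∧
  (∀ j, ∫ x, h j x ∂(gaussianReal 0 1) = 0) ∧
  (∀ i j, i ≠ j → ∀ μ : Measure (ℝ × ℝ), IsProbabilityMeasure μ →
    JointlyGaussianPair μ → (∫ p, p.1 ^ 2 ∂μ) = 1 → (∫ p, p.2 ^ 2 ∂μ) = 1 →
    |∫ p, h i p.1 * h j p.2 ∂μ| ≤ L * |∫ p, p.1 * p.2 ∂μ|)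

/-- `B_n(t) = ∑_{j=1}^{⌊nt⌋} σ_j² h_j(σ_j^{-1} ΔF_j)`, where
`ΔF_j = F(j/n) − F((j−1)/n)` and `σ_j² = E[ΔF_j²]`. -/
noncomputable def Bproc {Ω : Type*} [MeasurableSpace Ω] (P : Measure Ω)
    (F : ℝ → Ω → ℝ) (h : ℕ → ℝ → ℝ) (n : ℕ) (t : ℝ) (ω : Ω) : ℝ :=
  ∑ j ∈ Finset.Icc 1 ⌊(n : ℝ) * t⌋₊,
    (∫ ω', (F ((j : ℝ) / n) ω' - F (((j : ℝ) - 1) / n) ω') ^ 2 ∂P) *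
      h j ((Real.sqrt
          (∫ ω', (F ((j : ℝ) / n) ω' - F (((j : ℝ) - 1) / n) ω') ^ 2 ∂P))⁻¹ *
        (F ((j : ℝ) / n) ω - F (((j : ℝ) - 1) / n) ω))

/-- A map between normed spaces is of polynomial growth if its norm is dominated by a polynomial
in the norm of the variable. -/
def PolyGrowth {E G : Type*} [Norm E] [Norm G] (f : E → G) : Prop :=
  ∃ (C : ℝ) (m : ℕ), ∀ x, ‖f x‖ ≤ C * (1 + ‖x‖) ^ m

namespace PolyGrowth

variable {E E' G G' : Type*} [NormedAddCommGroup E] [NormedAddCommGroup E']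
  [NormedAddCommGroup G] [NormedAddCommGroup G']

lemma exists_nonneg {f : E → G} (hf : PolyGrowth f) :
    ∃ (C : ℝ) (m : ℕ), 0 ≤ C ∧ ∀ x, ‖f x‖ ≤ C * (1 + ‖x‖) ^ m := by
  obtain ⟨C, m, h⟩ := hf
  refine ⟨C, m, ?_, h⟩
  simpa using (norm_nonneg _).trans (h 0)

lemma of_norm_le {f : E → G} {g : E → G'} (hf : PolyGrowth f) (h : ∀ x, ‖g x‖ ≤ ‖f x‖) :
    PolyGrowth g := by
  obtain ⟨C, m, hC⟩ := hf
  exact ⟨C, m, fun x => (h x).trans (hC x)⟩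

lemma of_bounded {f : E → G} (C : ℝ) (h : ∀ x, ‖f x‖ ≤ C) : PolyGrowth f :=
  ⟨C, 0, by simpa using h⟩

lemma clm [NormedSpace ℝ E] [NormedSpace ℝ G] (L : E →L[ℝ] G) : PolyGrowth L := by
  refine ⟨‖L‖, 1, fun x => (L.le_opNorm x).trans ?_⟩
  rw [pow_one]
  exact mul_le_mul_of_nonneg_left (by linarith) (norm_nonneg _)

lemma norm_mul {f : E → G} {g : E → G'} (hf : PolyGrowth f) (hg : PolyGrowth g) :
    PolyGrowth (fun x => ‖f x‖ * ‖g x‖) := by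
  obtain ⟨C, m, hC, h⟩ := hf.exists_nonneg
  obtain ⟨C', m', hC', h'⟩ := hg.exists_nonneg
  refine ⟨C * C', m + m', fun x => ?_⟩
  rw [_root_.norm_mul, norm_norm, norm_norm]
  calc ‖f x‖ * ‖g x‖ ≤ (C * (1 + ‖x‖) ^ m) * (C' * (1 + ‖x‖) ^ m') :=
        mul_le_mul (h x) (h' x) (norm_nonneg _) ((norm_nonneg _).trans (h x))
    _ = _ := by ring

lemma norm_add {f : E → G} {g : E → G'} (hf : PolyGrowth f) (hg : PolyGrowth g) :
    PolyGrowth (fun x => ‖f x‖ + ‖g x‖) := by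
  obtain ⟨C, m, hC, h⟩ := hf.exists_nonneg
  obtain ⟨C', m', hC', h'⟩ := hg.exists_nonneg
  refine ⟨C + C', m + m', fun x => ?_⟩
  have h1 : (1 : ℝ) ≤ 1 + ‖x‖ := by linarith [norm_nonneg x]
  rw [Real.norm_of_nonneg (by positivity), add_mul]
  refine add_le_add ((h x).trans ?_) ((h' x).trans ?_)
  · exact mul_le_mul_of_nonneg_left (pow_le_pow_right₀ h1 (by omega)) hC
  · exact mul_le_mul_of_nonneg_left (pow_le_pow_right₀ h1 (by omega)) hC'

lemma add {f g : E → G} (hf : PolyGrowth f) (hg : PolyGrowth g) :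
    PolyGrowth (fun x => f x + g x) :=
  (hf.norm_add hg).of_norm_le fun x => by
    rw [Real.norm_of_nonneg (by positivity)]; exact norm_add_le _ _

lemma finset_sum {ι : Type*} (s : Finset ι) {f : ι → E → G} (hf : ∀ i ∈ s, PolyGrowth (f i)) :
    PolyGrowth (fun x => ∑ i ∈ s, f i x) := by
  classical
  induction s using Finset.induction_on with
  | empty => exact of_bounded 0 (by simp)
  | insert a s ha ih =>
    simp only [Finset.sum_insert ha]
    exact (hf a (by simp)).add (ih fun i hi => hf i (by simp [hi]))

lemma mul {A : Type*} [NormedRing A] {f g : E → A} (hf : PolyGrowth f) (hg : PolyGrowth g) :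
    PolyGrowth (fun x => f x * g x) :=
  (hf.norm_mul hg).of_norm_le fun x => by
    rw [Real.norm_of_nonneg (by positivity)]; exact norm_mul_le _ _

lemma pow {f : E → ℝ} (hf : PolyGrowth f) (k : ℕ) : PolyGrowth (fun x => f x ^ k) := by
  induction k with
  | zero => exact of_bounded 1 (by simp)
  | succ k ih => simpa only [pow_succ] using ih.mul hf

lemma norm {f : E → G} (hf : PolyGrowth f) : PolyGrowth (fun x => ‖f x‖) :=
  hf.of_norm_le fun x => by simp

lemma comp {f : E → G} (hf : PolyGrowth f) {g : E' → E} (hg : PolyGrowth g) :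
    PolyGrowth (fun x => f (g x)) := by
  obtain ⟨C, m, hC, h⟩ := hf.exists_nonneg
  obtain ⟨C', m', hC', h'⟩ := hg.exists_nonneg
  refine ⟨C * (1 + C') ^ m, m' * m, fun x => (h _).trans ?_⟩
  rw [mul_assoc, pow_mul, ← mul_pow]
  refine mul_le_mul_of_nonneg_left (pow_le_pow_left₀ (by positivity) ?_ m) hC
  have h1 : (1 : ℝ) ≤ (1 + ‖x‖) ^ m' := one_le_pow₀ (by linarith [norm_nonneg x])
  nlinarith [h' x]

lemma comp_clm [NormedSpace ℝ E] [NormedSpace ℝ E'] {f : E → G} (hf : PolyGrowth f)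
    (L : E' →L[ℝ] E) : PolyGrowth (fun x => f (L x)) := hf.comp (clm L)

/-- A function of polynomial growth is integrable with respect to every Gaussian measure. -/
lemma integrable [NormedSpace ℝ E] [CompleteSpace E] [SecondCountableTopology E]
    [MeasurableSpace E] [BorelSpace E] {f : E → G} (hf : PolyGrowth f) (μ : Measure E) [IsGaussian μ]
    (hm : AEStronglyMeasurable f μ) : Integrable f μ := by
  obtain ⟨C, m, h⟩ := hf
  have h0 : MemLp (fun x : E => ‖x‖) m μ := (IsGaussian.memLp_id μ m (by simp)).norm
  have h1 : MemLp (fun x : E => 1 + ‖x‖) m μ := (memLp_const (1 : ℝ)).add h0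
  have h2 := h1.integrable_norm_pow'
  refine Integrable.mono' (g := fun x => C * (1 + ‖x‖) ^ m) ?_ hm (ae_of_all _ h)
  refine (h2.congr (ae_of_all _ fun x => ?_)).const_mul C
  exact congrArg (· ^ m) (Real.norm_of_nonneg (by positivity))

end PolyGrowth

/-- **Stein's identity** in dimension one. -/
lemma integral_mul_gaussianReal_eq_integral_deriv (v : NNReal) {φ φ' : ℝ → ℂ}
    (hφ : ∀ x, HasDerivAt φ (φ' x) x) (hφ' : Continuous φ') (h : PolyGrowth φ)
    (h' : PolyGrowth φ') :
    ∫ x, (x : ℂ) * φ x ∂(gaussianReal 0 v) = v * ∫ x, φ' x ∂(gaussianReal 0 v) := by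
  rcases eq_or_ne v 0 with rfl | hv
  · simp [gaussianReal_zero_var]
  have hc : Continuous φ := continuous_iff_continuousAt.2 fun x => (hφ x).continuousAt
  have hint : ∀ f : ℝ → ℂ, Continuous f → PolyGrowth f →
      Integrable (fun x => (gaussianPDFReal 0 v x : ℂ) * f x) := by
    intro f hf hg
    have h1 := hg.integrable (gaussianReal 0 v) hf.aestronglyMeasurable
    rw [gaussianReal_of_var_ne_zero _ hv,
      integrable_withDensity_iff_integrable_smul' (by fun_prop)
        (ae_of_all _ fun _ => gaussianPDF_lt_top)] at h1
    refine h1.congr (ae_of_all _ fun x => ?_)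
    simp only [toReal_gaussianPDF, Complex.real_smul]
  have hx : PolyGrowth (fun x : ℝ => (x : ℂ)) := ⟨1, 1, fun x => by simp⟩
  rw [integral_gaussianReal_eq_integral_smul hv, integral_gaussianReal_eq_integral_smul hv]
  have hv' : (v : ℂ) ≠ 0 := by exact_mod_cast hv
  have hpdf : ∀ x, HasDerivAt (fun x => -(v : ℂ) * (gaussianPDFReal 0 v x : ℂ))
      ((gaussianPDFReal 0 v x : ℂ) * x) x := by
    intro x
    have h1 : HasDerivAt (gaussianPDFReal 0 v)
        ((Real.sqrt (2 * Real.pi * v))⁻¹ *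
          (Real.exp (-(x - 0) ^ 2 / (2 * v)) * (-(2 * (x - 0)) / (2 * v)))) x := by
      unfold gaussianPDFReal
      refine HasDerivAt.const_mul _ (HasDerivAt.exp ?_)
      have := (((hasDerivAt_id x).sub_const 0).pow 2).neg.div_const (2 * (v : ℝ))
      simpa using this
    have h2 := (h1.ofReal_comp).const_mul (-(v : ℂ))
    refine h2.congr_deriv ?_
    rw [gaussianPDFReal_def]
    push_cast
    field_simp
    simp
  have key := integral_mul_deriv_eq_deriv_mul_of_integrable (u := φ) (u' := φ')
    (v := fun x => -(v : ℂ) * (gaussianPDFReal 0 v x : ℂ))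
    (v' := fun x => (gaussianPDFReal 0 v x : ℂ) * x)
    (fun x _ => hφ x) (fun x _ => hpdf x) ?_ ?_ ?_
  · simp only [Complex.real_smul]
    rw [← integral_const_mul]
    calc _ = ∫ x, φ x * ((gaussianPDFReal 0 v x : ℂ) * x) := by congr 1; ext x; ring
      _ = _ := by rw [key, ← integral_neg]; congr 1; ext x; ring
  · refine (hint _ (by fun_prop : Continuous fun x : ℝ => (x : ℂ) * φ x) (hx.mul h)).congr
      (ae_of_all _ fun x => ?_)
    simp only [Pi.mul_apply]; ring
  · refine ((hint _ hφ' h').const_mul (-(v : ℂ))).congr (ae_of_all _ fun x => ?_)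
    simp only [Pi.mul_apply]; ring
  · refine ((hint _ hc h).const_mul (-(v : ℂ))).congr (ae_of_all _ fun x => ?_)
    simp only [Pi.mul_apply]; ring

section GaussianIntegrationByParts

variable {E : Type*} [NormedAddCommGroup E] [NormedSpace ℝ E] [CompleteSpace E]
  [SecondCountableTopology E] [MeasurableSpace E] [BorelSpace E]

lemma IsGaussian.integrable_dual_mul (μ : Measure E) [IsGaussian μ] (L L' : StrongDual ℝ E) :
    Integrable (fun z => L z * L' z) μ :=
  ((PolyGrowth.clm L).mul (PolyGrowth.clm L')).integrable μ
    (by fun_prop : Continuous fun z => L z * L' z).aestronglyMeasurable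

/-- **Gaussian integration by parts**: if `c` is the image of `L` under the covariance operator of
the centered Gaussian measure `μ`, then `∫ L z f(z) dμ = ∫ f'(z) c dμ`. -/
lemma gaussian_integration_by_parts (μ : Measure E) [IsGaussian μ]
    (hμ : ∀ L : StrongDual ℝ E, μ[L] = 0) (L : StrongDual ℝ E) (c : E) (hc : ∀ L' : StrongDual ℝ E, L' c = ∫ z, L' z * L z ∂μ)
    {f : E → ℂ} (hf : ContDiff ℝ 1 f) (hg : PolyGrowth f) (hg' : PolyGrowth (fderiv ℝ f)) :
    ∫ z, (L z : ℂ) * f z ∂μ = ∫ z, fderiv ℝ f z c ∂μ := by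
  have hfd : Continuous (fderiv ℝ f) := hf.continuous_fderiv (by simp)
  have hdiff : ∀ z, HasFDerivAt f (fderiv ℝ f z) z := fun z =>
    (hf.differentiable (by simp) z).hasFDerivAt
  rcases eq_or_ne (L c) 0 with h0 | hv
  · have hL : ∀ᵐ z ∂μ, L z = 0 := by
      have h1 := hc L
      rw [h0, eq_comm, integral_eq_zero_iff_of_nonneg (fun z => mul_self_nonneg _)
        (IsGaussian.integrable_dual_mul μ L L)] at h1
      filter_upwards [h1] with z hz using by simpa using hz
    have hc0 : c = 0 := by
      refine (SeparatingDual.eq_zero_iff_forall_dual_eq_zero (R := ℝ) c).2 fun L' => ?_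
      rw [hc L']
      exact integral_eq_zero_of_ae (by filter_upwards [hL] with z hz using by simp [hz])
    rw [hc0]
    simp only [map_zero, integral_zero]
    exact integral_eq_zero_of_ae (by filter_upwards [hL] with z hz using by simp [hz])
  set v : ℝ := L c with hvdef
  have hvnn : 0 ≤ v := by
    rw [hvdef, hc L]; exact integral_nonneg fun z => mul_self_nonneg _
  set Y : E →L[ℝ] E := ContinuousLinearMap.id ℝ E - (v⁻¹ • L).smulRight c with hY
  have hYapp : ∀ z, Y z = z - (v⁻¹ * L z) • c := fun z => by simp [hY]
  have hind : IndepFun L Y μ := by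
    have hXY : HasGaussianLaw (fun z => (L z, Y z)) μ :=
      (IsGaussian.hasGaussianLaw_id (μ := μ)).map_fun (L.prod Y)
    refine hXY.indepFun_of_covariance_strongDual fun L₁ L₂ => ?_
    have e1 : (L₁ ∘ L) = (L₁.comp L : StrongDual ℝ E) := rfl
    have e2 : (L₂ ∘ Y) = (L₂.comp Y : StrongDual ℝ E) := rfl
    rw [e1, e2, covariance_eq_sub (IsGaussian.memLp_dual μ _ 2 (by simp))
      (IsGaussian.memLp_dual μ _ 2 (by simp)), hμ, hμ]
    have h3 : ∀ z, (L₁.comp L * L₂.comp Y : E → ℝ) z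
        = L₁ 1 * (L₂ z * L z - v⁻¹ * L₂ c * (L z * L z)) := by
      intro z
      have : L₁ (L z) = L z * L₁ 1 := by
        rw [← smul_eq_mul, ← map_smul, smul_eq_mul, mul_one]
      simp only [Pi.mul_apply, ContinuousLinearMap.comp_apply, hYapp, map_sub, map_smul, this,
        smul_eq_mul]
      ring
    simp only [h3]
    rw [integral_const_mul, integral_sub (IsGaussian.integrable_dual_mul μ _ _)
      ((IsGaussian.integrable_dual_mul μ _ _).const_mul _), integral_const_mul, ← hc, ← hc]
    rw [← hvdef]
    field_simp
    simp
  have hlaw : μ.map L = gaussianReal 0 v.toNNReal := by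
    rw [IsGaussian.map_eq_gaussianReal L, hμ, variance_of_integral_eq_zero (by fun_prop) (hμ L),
      hvdef, hc L]
    simp only [pow_two]
  have hmap : μ.map (fun z => (L z, Y z)) = (gaussianReal 0 v.toNNReal).prod (μ.map Y) := by
    rw [(indepFun_iff_map_prod_eq_prod_map_map (by fun_prop) (by fun_prop)).1 hind, hlaw]
  have hrec : ∀ z, Y z + (v⁻¹ * L z) • c = z := fun z => by rw [hYapp]; abel
  have hcomp : ∀ φ : E → ℂ, Continuous φ → PolyGrowth φ →
      Integrable (fun p : ℝ × E => φ (p.2 + (v⁻¹ * p.1) • c))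
        ((gaussianReal 0 v.toNNReal).prod (μ.map Y)) := by
    intro φ hφ hφg
    let A : ℝ × E →L[ℝ] E := ContinuousLinearMap.snd ℝ ℝ E +
      (v⁻¹ • ContinuousLinearMap.fst ℝ ℝ E).smulRight c
    refine ((hφg.comp_clm A).integrable _ (hφ.comp A.continuous).aestronglyMeasurable).congr
      (ae_of_all _ fun p => ?_)
    simp [A]
  have htrans : ∀ φ : E → ℂ, Continuous φ → PolyGrowth φ →
      ∫ z, φ z ∂μ = ∫ y, ∫ x, φ (y + (v⁻¹ * x) • c) ∂(gaussianReal 0 v.toNNReal) ∂(μ.map Y) := by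
    intro φ hφ hφg
    have : IsProbabilityMeasure (μ.map Y) := Measure.isProbabilityMeasure_map (by fun_prop)
    rw [← integral_prod_symm _ (hcomp φ hφ hφg), ← hmap, integral_map (by fun_prop)
      (by fun_prop)]
    simp only [hrec]
  have hLg : PolyGrowth fun z => (L z : ℂ) := (PolyGrowth.clm L).of_norm_le fun z => by simp
  have hcg : PolyGrowth fun z => fderiv ℝ f z c :=
    (hg'.norm_mul (PolyGrowth.of_bounded (f := fun _ : E => c) ‖c‖ (by simp))).of_norm_le fun z => by
      rw [Real.norm_of_nonneg (by positivity)]; exact ContinuousLinearMap.le_opNorm _ _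
  rw [htrans _ (by fun_prop) (hLg.mul hg), htrans _ (by fun_prop) hcg]
  refine integral_congr_ae ?_
  have hLY : ∀ᵐ y ∂(μ.map Y), L y = 0 := by
    rw [ae_map_iff (by fun_prop) (measurableSet_eq_fun (by fun_prop) (by fun_prop))]
    refine ae_of_all _ fun z => ?_
    rw [hYapp, map_sub, map_smul, ← hvdef, smul_eq_mul]
    field_simp
    simp
  filter_upwards [hLY] with y hy
  have hLx : ∀ x : ℝ, L (y + (v⁻¹ * x) • c) = x := fun x => by
    rw [map_add, hy, map_smul, ← hvdef, smul_eq_mul]; field_simp; simp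
  simp only [hLx]
  have hlin : ∀ x, HasDerivAt (fun x : ℝ => y + (v⁻¹ * x) • c) (v⁻¹ • c) x := fun x => by
    have := (((hasDerivAt_id x).const_mul v⁻¹).smul_const c).const_add y
    simpa using this
  have hling : PolyGrowth (fun x : ℝ => y + (v⁻¹ * x) • c) := by
    refine (PolyGrowth.of_bounded ‖y‖ (by simp)).add ?_
    exact PolyGrowth.clm ((v⁻¹ • ContinuousLinearMap.id ℝ ℝ).smulRight c)
  have key := integral_mul_gaussianReal_eq_integral_deriv v.toNNReal
    (φ := fun x => f (y + (v⁻¹ * x) • c))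
    (φ' := fun x => fderiv ℝ f (y + (v⁻¹ * x) • c) (v⁻¹ • c))
    (fun x => (hdiff _).comp_hasDerivAt x (hlin x)) (by fun_prop) (hg.comp hling) ?_
  · rw [key]
    simp only [map_smul]
    rw [integral_smul, Real.coe_toNNReal _ hvnn, Complex.real_smul, ← mul_assoc]
    push_cast
    rw [mul_inv_cancel₀ (by exact_mod_cast hv), one_mul]
  · have h1 := hcg.comp hling
    refine ((PolyGrowth.of_bounded (f := fun _ : ℝ => v⁻¹) ‖v⁻¹‖ (by simp)).norm_mul
      h1).of_norm_le fun x => ?_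
    rw [map_smul, norm_smul, Real.norm_of_nonneg (by positivity : 0 ≤ ‖v⁻¹‖ * _)]

end GaussianIntegrationByParts

lemma integral_mul_le_of_integral_sq_le {α : Type*} [MeasurableSpace α] {μ : Measure α}
    {u w : α → ℝ} (hu0 : ∀ x, 0 ≤ u x) (hw0 : ∀ x, 0 ≤ w x) (hu : MemLp u 2 μ) (hw : MemLp w 2 μ)
    {a b : ℝ} (ha : 0 ≤ a) (hb : 0 ≤ b) (hua : ∫ x, u x ^ 2 ∂μ ≤ a ^ 2)
    (hwb : ∫ x, w x ^ 2 ∂μ ≤ b ^ 2) : ∫ x, u x * w x ∂μ ≤ a * b := by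
  have h := integral_mul_le_Lp_mul_Lq_of_nonneg Real.HolderConjugate.two_two (ae_of_all μ hu0)
    (ae_of_all μ hw0) (by simpa using hu) (by simpa using hw)
  simp only [Real.rpow_two, ← Real.sqrt_eq_rpow] at h
  refine h.trans (mul_le_mul ?_ ?_ (Real.sqrt_nonneg _) ha)
  · exact (Real.sqrt_le_left ha).2 hua
  · exact (Real.sqrt_le_left hb).2 hwb

lemma PolyGrowth.memLp_two {E G : Type*} [NormedAddCommGroup E] [NormedSpace ℝ E] [CompleteSpace E]
    [SecondCountableTopology E] [MeasurableSpace E] [BorelSpace E] [NormedAddCommGroup G]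
    {f : E → G} (hf : PolyGrowth f) (μ : Measure E) [IsGaussian μ]
    (hm : AEStronglyMeasurable f μ) : MemLp f 2 μ := by
  rw [memLp_two_iff_integrable_sq_norm hm]
  refine (hf.norm.pow 2).integrable μ ?_
  exact hm.norm.pow 2

lemma norm_rotation_le {E : Type*} [NormedAddCommGroup E] [NormedSpace ℝ E] (θ : ℝ) (p : E × E) :
    ‖Real.cos θ • p.1 + Real.sin θ • p.2‖ ≤ 2 * ‖p‖ ∧
      ‖-Real.sin θ • p.1 + Real.cos θ • p.2‖ ≤ 2 * ‖p‖ := by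
  have h1 : ‖p.1‖ ≤ ‖p‖ := norm_fst_le p
  have h2 : ‖p.2‖ ≤ ‖p‖ := norm_snd_le p
  have hc := Real.abs_cos_le_one θ
  have hs := Real.abs_sin_le_one θ
  constructor <;> refine (norm_add_le _ _).trans ?_ <;>
    simp only [norm_smul, Real.norm_eq_abs, abs_neg] <;>
    nlinarith [norm_nonneg p.1, norm_nonneg p.2]

section Interpolation

variable {E : Type*} [NormedAddCommGroup E] [NormedSpace ℝ E] [CompleteSpace E]
  [SecondCountableTopology E] [MeasurableSpace E] [BorelSpace E]

lemma hasDerivAt_gaussian_interpolation (μ : Measure E) [IsGaussian μ]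
    {f g : E → ℂ} (hf : Continuous f) (hfg : PolyGrowth f)
    (hg : ContDiff ℝ 1 g) (hgg : PolyGrowth g) (hgg' : PolyGrowth (fderiv ℝ g)) (θ : ℝ) :
    HasDerivAt (fun θ : ℝ => ∫ p : E × E, f p.1 * g (Real.cos θ • p.1 + Real.sin θ • p.2) ∂(μ.prod μ))
      (∫ p : E × E, f p.1 * fderiv ℝ g (Real.cos θ • p.1 + Real.sin θ • p.2)
        (-Real.sin θ • p.1 + Real.cos θ • p.2) ∂(μ.prod μ)) θ := by
  have hgd : Continuous (fderiv ℝ g) := hg.continuous_fderiv (by simp)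
  have hgc : Continuous g := hg.continuous
  obtain ⟨C, m, hC, h⟩ := hgg'.exists_nonneg
  have hrot : ∀ θ : ℝ, PolyGrowth (fun p : E × E => Real.cos θ • p.1 + Real.sin θ • p.2) := fun θ =>
    PolyGrowth.clm (Real.cos θ • ContinuousLinearMap.fst ℝ E E +
      Real.sin θ • ContinuousLinearMap.snd ℝ E E)
  have hf1 : PolyGrowth (fun p : E × E => f p.1) :=
    hfg.comp_clm (ContinuousLinearMap.fst ℝ E E)
  have hb : PolyGrowth (fun p : E × E => ‖f p.1‖ * (C * (1 + 2 * ‖p‖) ^ m * (2 * ‖p‖))) := by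
    have hn : PolyGrowth (fun p : E × E => 2 * ‖p‖) :=
      ⟨2, 1, fun p => by rw [Real.norm_of_nonneg (by positivity), pow_one]; linarith⟩
    exact hf1.norm.mul (((PolyGrowth.of_bounded ‖C‖ (by simp)).mul
      (((PolyGrowth.of_bounded 1 (by simp)).add hn).pow m)).mul hn)
  refine (hasDerivAt_integral_of_dominated_loc_of_deriv_le (s := Set.univ)
    (bound := fun p : E × E => ‖f p.1‖ * (C * (1 + 2 * ‖p‖) ^ m * (2 * ‖p‖)))
    (F' := fun θ p => f p.1 * fderiv ℝ g (Real.cos θ • p.1 + Real.sin θ • p.2)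
        (-Real.sin θ • p.1 + Real.cos θ • p.2)) univ_mem ?_ ?_ ?_ ?_ ?_ ?_).2
  · exact Eventually.of_forall fun θ => Continuous.aestronglyMeasurable (by fun_prop)
  · exact (hf1.mul (hgg.comp (hrot θ))).integrable _ (Continuous.aestronglyMeasurable (by fun_prop))
  · exact Continuous.aestronglyMeasurable (by fun_prop)
  · refine ae_of_all _ fun p θ _ => ?_
    rw [norm_mul]
    refine mul_le_mul_of_nonneg_left ?_ (norm_nonneg _)
    obtain ⟨h1, h2⟩ := norm_rotation_le θ p
    refine (ContinuousLinearMap.le_opNorm _ _).trans (mul_le_mul ((h _).trans ?_) h2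
      (norm_nonneg _) (by positivity))
    exact mul_le_mul_of_nonneg_left (pow_le_pow_left₀ (by positivity) (by linarith) m) hC
  · exact hb.integrable _ (Continuous.aestronglyMeasurable (by fun_prop))
  · refine ae_of_all _ fun p θ _ => ?_
    have h1 : HasDerivAt (fun θ : ℝ => Real.cos θ • p.1 + Real.sin θ • p.2)
        (-Real.sin θ • p.1 + Real.cos θ • p.2) θ :=
      ((Real.hasDerivAt_cos θ).smul_const p.1).add ((Real.hasDerivAt_sin θ).smul_const p.2)
    exact (((hg.differentiable (by simp) _).hasFDerivAt).comp_hasDerivAt θ h1).const_mul (f p.1)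

lemma integral_rotation_fst (μ : Measure E) [IsGaussian μ] (hμ : ∀ L : StrongDual ℝ E, μ[L] = 0)
    {f g : E → ℂ} (hf : Continuous f) (hg : ContDiff ℝ 1 g) (θ : ℝ) :
    ∫ p : E × E, f p.1 * fderiv ℝ g (Real.cos θ • p.1 + Real.sin θ • p.2)
        (-Real.sin θ • p.1 + Real.cos θ • p.2) ∂(μ.prod μ)
      = ∫ p : E × E, f (Real.cos θ • p.1 - Real.sin θ • p.2) * fderiv ℝ g p.1 p.2 ∂(μ.prod μ) := by
  have hgd : Continuous (fderiv ℝ g) := hg.continuous_fderiv (by simp)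
  conv_rhs => rw [← IsGaussian.map_rotation_eq_self_of_forall_strongDual_eq_zero hμ θ]
  rw [integral_map (by fun_prop) (Continuous.aestronglyMeasurable (by fun_prop))]
  refine integral_congr_ae (ae_of_all _ fun p => ?_)
  have hrec : Real.cos θ • (Real.cos θ • p.1 + Real.sin θ • p.2)
      - Real.sin θ • (-Real.sin θ • p.1 + Real.cos θ • p.2) = p.1 := by
    have : p.1 = (Real.cos θ ^ 2 + Real.sin θ ^ 2) • p.1 := by rw [Real.cos_sq_add_sin_sq, one_smul]
    conv_rhs => rw [this]
    module
  simp only [ContinuousLinearMap.rotation_apply]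
  rw [hrec]

lemma map_rotation_fst (μ : Measure E) [IsGaussian μ] (hμ : ∀ L : StrongDual ℝ E, μ[L] = 0) (θ : ℝ) :
    (μ.prod μ).map (fun p : E × E => Real.cos θ • p.1 - Real.sin θ • p.2) = μ := by
  have h := IsGaussian.map_rotation_eq_self_of_forall_strongDual_eq_zero hμ (-θ)
  have h2 := congrArg (Measure.map Prod.fst) h
  rw [Measure.map_map (by fun_prop) (by fun_prop), Measure.map_fst_prod] at h2
  simp only [measure_univ, one_smul] at h2
  conv_rhs => rw [← h2]
  congr 1
  ext p
  simp [ContinuousLinearMap.rotation_apply, sub_eq_add_neg]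

end Interpolation

section GaussianCovariance

variable {ι : Type*} [Fintype ι]

lemma PolyGrowth.fderiv_apply {E : Type*} [NormedAddCommGroup E] [NormedSpace ℝ E] {f : E → ℂ}
    (hf : PolyGrowth (fderiv ℝ f)) (c : E) : PolyGrowth (fun z => fderiv ℝ f z c) :=
  (hf.norm_mul (PolyGrowth.of_bounded (f := fun _ : E => c) ‖c‖ (by simp))).of_norm_le fun z => by
    rw [Real.norm_of_nonneg (by positivity)]; exact ContinuousLinearMap.le_opNorm _ _

lemma ContinuousLinearMap.apply_eq_sum_single [DecidableEq ι] {G : Type*} [NormedAddCommGroup G]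
    [NormedSpace ℝ G] (L : (ι → ℝ) →L[ℝ] G) (c : ι → ℝ) :
    L c = ∑ i, c i • L (Pi.single i 1) := by
  conv_lhs => rw [pi_eq_sum_univ' c, map_sum]
  refine Finset.sum_congr rfl fun i _ => ?_
  rw [map_smul]

lemma integral_mul_eval_eq_apply [DecidableEq ι] (μ : Measure (ι → ℝ)) [IsGaussian μ] (j : ι)
    (L' : StrongDual ℝ (ι → ℝ)) :
    L' (fun i => ∫ z, z i * z j ∂μ) = ∫ z, L' z * z j ∂μ := by
  rw [L'.apply_eq_sum_single]
  have h : ∀ z : ι → ℝ, L' z * z j = ∑ i, L' (Pi.single i 1) * (z i * z j) := fun z => by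
    rw [L'.apply_eq_sum_single z, Finset.sum_mul]
    exact Finset.sum_congr rfl fun i _ => by simp only [smul_eq_mul]; ring
  simp only [h]
  rw [integral_finsetSum]
  · refine Finset.sum_congr rfl fun i _ => ?_
    rw [integral_const_mul, smul_eq_mul, mul_comm]
  · exact fun i _ => (IsGaussian.integrable_dual_mul μ (ContinuousLinearMap.proj i)
      (ContinuousLinearMap.proj j)).const_mul _

lemma gaussian_interpolation_deriv_eq [DecidableEq ι] (μ : Measure (ι → ℝ)) [IsGaussian μ]
    (hμ : ∀ L : StrongDual ℝ (ι → ℝ), μ[L] = 0) {f g : (ι → ℝ) → ℂ}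
    (hf : ContDiff ℝ 1 f) (hfg : PolyGrowth f) (hfg' : PolyGrowth (fderiv ℝ f))
    (hg : ContDiff ℝ 1 g) (hgg' : PolyGrowth (fderiv ℝ g)) (θ : ℝ) :
    ∫ p : (ι → ℝ) × (ι → ℝ), f (Real.cos θ • p.1 - Real.sin θ • p.2) * fderiv ℝ g p.1 p.2 ∂(μ.prod μ)
      = ∑ i, ∑ j, ((-Real.sin θ * ∫ z, z i * z j ∂μ : ℝ) : ℂ) *
        ∫ p : (ι → ℝ) × (ι → ℝ), fderiv ℝ f (Real.cos θ • p.1 - Real.sin θ • p.2) (Pi.single i 1) *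
          fderiv ℝ g p.1 (Pi.single j 1) ∂(μ.prod μ) := by
  have hgd : Continuous (fderiv ℝ g) := hg.continuous_fderiv (by simp)
  have hfd : Continuous (fderiv ℝ f) := hf.continuous_fderiv (by simp)
  have hfc : Continuous f := hf.continuous
  have hrot : PolyGrowth (fun p : (ι → ℝ) × (ι → ℝ) => Real.cos θ • p.1 - Real.sin θ • p.2) :=
    PolyGrowth.clm (Real.cos θ • ContinuousLinearMap.fst ℝ (ι → ℝ) (ι → ℝ) -
      Real.sin θ • ContinuousLinearMap.snd ℝ (ι → ℝ) (ι → ℝ))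
  have hg1 : ∀ c, PolyGrowth (fun p : (ι → ℝ) × (ι → ℝ) => fderiv ℝ g p.1 c) := fun c =>
    (hgg'.fderiv_apply c).comp_clm (ContinuousLinearMap.fst ℝ (ι → ℝ) (ι → ℝ))
  have hp2 : ∀ j, PolyGrowth (fun p : (ι → ℝ) × (ι → ℝ) => (p.2 j : ℂ)) := fun j =>
    (PolyGrowth.clm ((ContinuousLinearMap.proj (R := ℝ) (φ := fun _ : ι => ℝ) j).comp
      (ContinuousLinearMap.snd ℝ (ι → ℝ) (ι → ℝ)))).of_norm_le fun p => by simp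
  have hint : ∀ j, Integrable (fun p : (ι → ℝ) × (ι → ℝ) => fderiv ℝ g p.1 (Pi.single j 1) *
      ((p.2 j : ℂ) * f (Real.cos θ • p.1 - Real.sin θ • p.2))) (μ.prod μ) := fun j =>
    ((hg1 _).mul ((hp2 j).mul (hfg.comp hrot))).integrable _
      (Continuous.aestronglyMeasurable (by fun_prop))
  have hint' : ∀ c j, Integrable (fun p : (ι → ℝ) × (ι → ℝ) =>
      fderiv ℝ f (Real.cos θ • p.1 - Real.sin θ • p.2) c *
          fderiv ℝ g p.1 (Pi.single j 1)) (μ.prod μ) := fun c j =>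
    (((hfg'.fderiv_apply c).comp hrot).mul (hg1 _)).integrable _
      (Continuous.aestronglyMeasurable (by fun_prop))
  calc _ = ∑ j, ∫ p : (ι → ℝ) × (ι → ℝ), fderiv ℝ g p.1 (Pi.single j 1) *
      ((p.2 j : ℂ) * f (Real.cos θ • p.1 - Real.sin θ • p.2)) ∂(μ.prod μ) := by
        rw [← integral_finsetSum _ fun j _ => hint j]
        congr 1
        ext p
        rw [(fderiv ℝ g p.1).apply_eq_sum_single p.2, Finset.mul_sum]
        exact Finset.sum_congr rfl fun j _ => by rw [Complex.real_smul]; ring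
    _ = ∑ j, (-Real.sin θ : ℂ) * ∫ p : (ι → ℝ) × (ι → ℝ),
          fderiv ℝ f (Real.cos θ • p.1 - Real.sin θ • p.2) (fun i => ∫ z, z i * z j ∂μ) *
          fderiv ℝ g p.1 (Pi.single j 1) ∂(μ.prod μ) := by
        refine Finset.sum_congr rfl fun j _ => ?_
        rw [integral_prod _ (hint j), integral_prod _ (hint' _ j), ← integral_const_mul]
        congr 1
        ext x
        have hlin : PolyGrowth (fun y : ι → ℝ => Real.cos θ • x - Real.sin θ • y) := by
          simp only [sub_eq_add_neg, ← neg_smul]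
          exact (PolyGrowth.of_bounded ‖Real.cos θ • x‖ (by simp)).add
            (PolyGrowth.clm (-Real.sin θ • ContinuousLinearMap.id ℝ (ι → ℝ)))
        have hder : ∀ y, HasFDerivAt (fun y : ι → ℝ => f (Real.cos θ • x - Real.sin θ • y))
            (-Real.sin θ • fderiv ℝ f (Real.cos θ • x - Real.sin θ • y)) y := fun y => by
          have h1 : HasFDerivAt (fun y : ι → ℝ => Real.cos θ • x - Real.sin θ • y)
              (-(Real.sin θ • ContinuousLinearMap.id ℝ (ι → ℝ))) y :=
            ((hasFDerivAt_id y).const_smul (Real.sin θ)).const_sub _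
          refine ((hf.differentiable (by simp) _).hasFDerivAt.comp y h1).congr_fderiv ?_
          ext v
          simp
        have hfd' : fderiv ℝ (fun y : ι → ℝ => f (Real.cos θ • x - Real.sin θ • y)) =
            fun y => -Real.sin θ • fderiv ℝ f (Real.cos θ • x - Real.sin θ • y) :=
          funext fun y => (hder y).fderiv
        have ibp := gaussian_integration_by_parts μ hμ (ContinuousLinearMap.proj j)
          (fun i => ∫ z, z i * z j ∂μ) (integral_mul_eval_eq_apply μ j)
          (f := fun y : ι → ℝ => f (Real.cos θ • x - Real.sin θ • y))
          (hf.comp (by fun_prop)) (hfg.comp hlin) (by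
            rw [hfd']
            refine ((hfg'.comp hlin).norm_mul (PolyGrowth.of_bounded
              (f := fun _ : ι → ℝ => Real.sin θ) ‖Real.sin θ‖ (by simp))).of_norm_le fun y => ?_
            rw [Real.norm_of_nonneg (by positivity), norm_smul, norm_neg, mul_comm])
        simp only [ContinuousLinearMap.proj_apply] at ibp
        dsimp only
        rw [integral_const_mul, ibp, integral_mul_const, hfd']
        simp only [smul_apply]
        rw [integral_smul, Complex.real_smul]
        push_cast
        ring
    _ = ∑ j, ∑ i, ((-Real.sin θ * ∫ z, z i * z j ∂μ : ℝ) : ℂ) *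
        ∫ p : (ι → ℝ) × (ι → ℝ), fderiv ℝ f (Real.cos θ • p.1 - Real.sin θ • p.2) (Pi.single i 1) *
          fderiv ℝ g p.1 (Pi.single j 1) ∂(μ.prod μ) := by
        refine Finset.sum_congr rfl fun j _ => ?_
        simp only [(fderiv ℝ f _).apply_eq_sum_single (fun i => ∫ z, z i * z j ∂μ), Finset.sum_mul,
          smul_mul_assoc]
        rw [integral_finsetSum Finset.univ
          (f := fun i (p : (ι → ℝ) × (ι → ℝ)) => (∫ z, z i * z j ∂μ) •
            (fderiv ℝ f (Real.cos θ • p.1 - Real.sin θ • p.2) (Pi.single i 1) *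
              fderiv ℝ g p.1 (Pi.single j 1)))
          fun i _ => (hint' (Pi.single i 1) j).smul (∫ z, z i * z j ∂μ), Finset.mul_sum]
        refine Finset.sum_congr rfl fun i _ => ?_
        rw [integral_smul, Complex.real_smul]
        push_cast
        ring
    _ = _ := Finset.sum_comm

/-- **Gaussian covariance inequality** for complex-valued functions of polynomial growth, in terms
of the entries of the covariance matrix and the `L²` norms of the partial derivatives. -/
lemma norm_gaussian_covariance_le [DecidableEq ι] (μ : Measure (ι → ℝ)) [IsGaussian μ]
    (hμ : ∀ L : StrongDual ℝ (ι → ℝ), μ[L] = 0) {f g : (ι → ℝ) → ℂ}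
    (hf : ContDiff ℝ 1 f) (hfg : PolyGrowth f) (hfg' : PolyGrowth (fderiv ℝ f))
    (hg : ContDiff ℝ 1 g) (hgg : PolyGrowth g) (hgg' : PolyGrowth (fderiv ℝ g))
    {a b : ι → ℝ} (ha : ∀ i, 0 ≤ a i) (hb : ∀ i, 0 ≤ b i)
    (hfa : ∀ i, ∫ z, ‖fderiv ℝ f z (Pi.single i 1)‖ ^ 2 ∂μ ≤ a i ^ 2)
    (hgb : ∀ i, ∫ z, ‖fderiv ℝ g z (Pi.single i 1)‖ ^ 2 ∂μ ≤ b i ^ 2) :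
    ‖∫ z, f z * g z ∂μ - (∫ z, f z ∂μ) * ∫ z, g z ∂μ‖
      ≤ 2 * ∑ i, ∑ j, |∫ z, z i * z j ∂μ| * (a i * b j) := by
  have hgd : Continuous (fderiv ℝ g) := hg.continuous_fderiv (by simp)
  have hfd : Continuous (fderiv ℝ f) := hf.continuous_fderiv (by simp)
  set S := ∑ i, ∑ j, |∫ z, z i * z j ∂μ| * (a i * b j) with hS
  have hS0 : 0 ≤ S := Finset.sum_nonneg fun i _ => Finset.sum_nonneg fun j _ =>
    mul_nonneg (abs_nonneg _) (mul_nonneg (ha i) (hb j))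
  have hderiv : ∀ θ : ℝ, ‖∫ p : (ι → ℝ) × (ι → ℝ),
      f p.1 * fderiv ℝ g (Real.cos θ • p.1 + Real.sin θ • p.2)
        (-Real.sin θ • p.1 + Real.cos θ • p.2) ∂(μ.prod μ)‖ ≤ S := by
    intro θ
    rw [integral_rotation_fst μ hμ hf.continuous hg θ,
      gaussian_interpolation_deriv_eq μ hμ hf hfg hfg' hg hgg' θ]
    refine (norm_sum_le _ _).trans (Finset.sum_le_sum fun i _ => (norm_sum_le _ _).trans
      (Finset.sum_le_sum fun j _ => ?_))
    rw [norm_mul, Complex.norm_real, norm_mul, norm_neg, Real.norm_eq_abs, Real.norm_eq_abs]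
    refine mul_le_mul (mul_le_of_le_one_left (abs_nonneg _) (Real.abs_sin_le_one θ)) ?_
      (norm_nonneg _) (abs_nonneg _)
    refine (norm_integral_le_integral_norm _).trans ?_
    simp only [norm_mul]
    have hrot : PolyGrowth (fun p : (ι → ℝ) × (ι → ℝ) => Real.cos θ • p.1 - Real.sin θ • p.2) :=
      PolyGrowth.clm (Real.cos θ • ContinuousLinearMap.fst ℝ (ι → ℝ) (ι → ℝ) -
        Real.sin θ • ContinuousLinearMap.snd ℝ (ι → ℝ) (ι → ℝ))
    have m1 : PolyGrowth (fun p : (ι → ℝ) × (ι → ℝ) =>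
        ‖fderiv ℝ f (Real.cos θ • p.1 - Real.sin θ • p.2) (Pi.single i 1)‖) :=
      (hfg'.fderiv_apply (Pi.single i 1)).norm.comp hrot
    have m2 : PolyGrowth (fun p : (ι → ℝ) × (ι → ℝ) => ‖fderiv ℝ g p.1 (Pi.single j 1)‖) :=
      (hgg'.fderiv_apply (Pi.single j 1)).norm.comp_clm (ContinuousLinearMap.fst ℝ (ι → ℝ) (ι → ℝ))
    refine integral_mul_le_of_integral_sq_le (fun _ => norm_nonneg _) (fun _ => norm_nonneg _)
      (m1.memLp_two _ (Continuous.aestronglyMeasurable (by fun_prop)))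
      (m2.memLp_two _ (Continuous.aestronglyMeasurable (by fun_prop))) (ha i) (hb j) ?_ ?_
    · refine le_trans (le_of_eq ?_) (hfa i)
      conv_rhs => rw [← map_rotation_fst μ hμ θ]
      rw [integral_map (by fun_prop) (Continuous.aestronglyMeasurable (by fun_prop))]
    · refine le_trans (le_of_eq ?_) (hgb j)
      have h1 : μ = (μ.prod μ).map Prod.fst := by simp [Measure.map_fst_prod]
      conv_rhs => rw [h1]
      rw [integral_map (by fun_prop) (Continuous.aestronglyMeasurable (by fun_prop))]
  have key := norm_image_sub_le_of_norm_deriv_le_segment'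
    (f := fun θ : ℝ => ∫ p : (ι → ℝ) × (ι → ℝ), f p.1 * g (Real.cos θ • p.1 + Real.sin θ • p.2) ∂(μ.prod μ))
    (a := 0) (b := Real.pi / 2) (C := S)
    (fun θ _ => (hasDerivAt_gaussian_interpolation μ hf.continuous hfg hg hgg hgg' θ).hasDerivWithinAt)
    (fun θ _ => hderiv θ) (Real.pi / 2) ⟨by positivity, le_rfl⟩
  simp only [Real.cos_pi_div_two, Real.sin_pi_div_two, Real.cos_zero, Real.sin_zero, zero_smul,
    one_smul, zero_add, add_zero, sub_zero] at key
  rw [integral_prod_mul, integral_fun_fst (fun z => f z * g z)] at key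
  simp only [probReal_univ, one_smul] at key
  rw [norm_sub_rev]
  refine key.trans ?_
  nlinarith [Real.pi_le_four]

end GaussianCovariance

/-- A continuously differentiable function of polynomial growth, together with its derivative. -/
structure SmoothPolyGrowth {G : Type*} [NormedAddCommGroup G] [NormedSpace ℝ G] (ψ : ℝ → G) :
    Prop where
  contDiff : ContDiff ℝ 1 ψ
  growth : PolyGrowth ψ
  growth_deriv : PolyGrowth (deriv ψ)

namespace SmoothPolyGrowth

variable {ι : Type*} [Fintype ι] {ψ φ : ι → ℝ → ℝ}

lemma continuous_deriv {G : Type*} [NormedAddCommGroup G] [NormedSpace ℝ G] {ψ : ℝ → G}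
    (h : SmoothPolyGrowth ψ) : Continuous (deriv ψ) := h.contDiff.continuous_deriv (by simp)

lemma continuous {G : Type*} [NormedAddCommGroup G] [NormedSpace ℝ G] {ψ : ℝ → G}
    (h : SmoothPolyGrowth ψ) : Continuous ψ := h.contDiff.continuous

lemma sum_growth (h : ∀ a, SmoothPolyGrowth (ψ a)) :
    PolyGrowth (fun z : ι → ℝ => ∑ a, ψ a (z a)) :=
  PolyGrowth.finset_sum _ fun a _ =>
    (h a).growth.comp_clm (ContinuousLinearMap.proj (R := ℝ) (φ := fun _ : ι => ℝ) a)

lemma continuous_sum (h : ∀ a, SmoothPolyGrowth (ψ a)) :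
    Continuous (fun z : ι → ℝ => ∑ a, ψ a (z a)) :=
  continuous_finsetSum _ fun a _ => (h a).continuous.comp (continuous_apply a)

lemma hasFDerivAt_comp_sum (h : ∀ a, SmoothPolyGrowth (ψ a)) {Φ : ℝ → ℂ} (hΦ : SmoothPolyGrowth Φ)
    (z : ι → ℝ) :
    HasFDerivAt (fun z : ι → ℝ => Φ (∑ a, ψ a (z a)))
      ((∑ a, deriv (ψ a) (z a) • ContinuousLinearMap.proj (R := ℝ) (φ := fun _ : ι => ℝ) a).smulRight
        (deriv Φ (∑ a, ψ a (z a)))) z := by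
  have h1 : HasFDerivAt (fun z : ι → ℝ => ∑ a, ψ a (z a))
      (∑ a, deriv (ψ a) (z a) • ContinuousLinearMap.proj (R := ℝ) (φ := fun _ : ι => ℝ) a) z := by
    refine HasFDerivAt.fun_sum fun a _ => ?_
    exact (((h a).contDiff.differentiable (by simp) _).hasDerivAt).comp_hasFDerivAt z
      (hasFDerivAt_apply a z)
  exact (((hΦ.contDiff.differentiable (by simp) _).hasDerivAt).hasFDerivAt.comp z h1).congr_fderiv
    (by ext v; simp [Finset.sum_mul])

lemma contDiff_comp_sum (h : ∀ a, SmoothPolyGrowth (ψ a)) {Φ : ℝ → ℂ} (hΦ : SmoothPolyGrowth Φ) :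
    ContDiff ℝ 1 (fun z : ι → ℝ => Φ (∑ a, ψ a (z a))) :=
  hΦ.contDiff.comp (ContDiff.sum fun a _ => (h a).contDiff.comp (contDiff_apply ℝ ℝ a))

lemma fderiv_comp_sum_single [DecidableEq ι] (h : ∀ a, SmoothPolyGrowth (ψ a)) {Φ : ℝ → ℂ}
    (hΦ : SmoothPolyGrowth Φ) (z : ι → ℝ) (i : ι) :
    fderiv ℝ (fun z : ι → ℝ => Φ (∑ a, ψ a (z a))) z (Pi.single i 1) =
      deriv (ψ i) (z i) • deriv Φ (∑ a, ψ a (z a)) := by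
  rw [(hasFDerivAt_comp_sum h hΦ z).fderiv]
  simp [Pi.single_apply]

lemma growth_fderiv_comp_sum (h : ∀ a, SmoothPolyGrowth (ψ a)) {Φ : ℝ → ℂ}
    (hΦ : SmoothPolyGrowth Φ) :
    PolyGrowth (fderiv ℝ (fun z : ι → ℝ => Φ (∑ a, ψ a (z a)))) := by
  have h1 : PolyGrowth (fun z : ι → ℝ =>
      ∑ a, deriv (ψ a) (z a) • ContinuousLinearMap.proj (R := ℝ) (φ := fun _ : ι => ℝ) a) :=
    PolyGrowth.finset_sum _ fun a _ => by
      refine (((h a).growth_deriv.comp_clm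
        (ContinuousLinearMap.proj (R := ℝ) (φ := fun _ : ι => ℝ) a)).norm_mul
        (PolyGrowth.of_bounded
          (f := fun _ : ι → ℝ => ContinuousLinearMap.proj (R := ℝ) (φ := fun _ : ι => ℝ) a)
          _ fun _ => le_rfl)).of_norm_le fun z => ?_
      rw [Real.norm_of_nonneg (by positivity), norm_smul]
      rfl
  refine (h1.norm_mul (hΦ.growth_deriv.comp (sum_growth h))).of_norm_le fun z => ?_
  rw [(hasFDerivAt_comp_sum h hΦ z).fderiv, ContinuousLinearMap.norm_smulRight_apply,
    Real.norm_of_nonneg (by positivity)]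

lemma exp_mul_I : SmoothPolyGrowth (fun x : ℝ => Complex.exp (x * Complex.I)) where
  contDiff := (Complex.ofRealCLM.contDiff.mul contDiff_const).cexp
  growth := PolyGrowth.of_bounded 1 fun x => (Complex.norm_exp_ofReal_mul_I x).le
  growth_deriv := by
    refine PolyGrowth.of_bounded 1 fun x => ?_
    have : HasDerivAt (fun x : ℝ => Complex.exp (x * Complex.I))
        (Complex.exp (x * Complex.I) * (1 * Complex.I)) x :=
      (((hasDerivAt_id x).ofReal_comp).mul_const Complex.I).cexp
    rw [this.deriv, norm_mul, Complex.norm_exp_ofReal_mul_I]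
    simp

lemma norm_deriv_exp_mul_I (x : ℝ) : ‖deriv (fun x : ℝ => Complex.exp (x * Complex.I)) x‖ = 1 := by
  have : HasDerivAt (fun x : ℝ => Complex.exp (x * Complex.I))
      (Complex.exp (x * Complex.I) * (1 * Complex.I)) x :=
    (((hasDerivAt_id x).ofReal_comp).mul_const Complex.I).cexp
  rw [this.deriv, norm_mul, Complex.norm_exp_ofReal_mul_I]
  simp

lemma deriv_ofReal_sq (x : ℝ) : deriv (fun x : ℝ => (x : ℂ) ^ 2) x = 2 * x := by
  have : HasDerivAt (fun x : ℝ => (x : ℂ) ^ 2) (((2 : ℕ) : ℂ) * (x : ℂ) ^ (2 - 1) * 1) x :=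
    ((hasDerivAt_id x).ofReal_comp).pow 2
  rw [this.deriv]
  simp

lemma ofReal_sq : SmoothPolyGrowth (fun x : ℝ => (x : ℂ) ^ 2) where
  contDiff := Complex.ofRealCLM.contDiff.pow 2
  growth := ⟨1, 2, fun x => by
    rw [norm_pow, Complex.norm_real, one_mul]
    exact pow_le_pow_left₀ (norm_nonneg _) (by linarith) 2⟩
  growth_deriv := ⟨2, 1, fun x => by
    rw [deriv_ofReal_sq, norm_mul, Complex.norm_real, pow_one]
    simp⟩

end SmoothPolyGrowth

section Separable

variable {ι : Type*} [Fintype ι] {ψ φ : ι → ℝ → ℝ}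

lemma integral_sq_le_of_integral_pow_four_le {α : Type*} [MeasurableSpace α] {μ : Measure α}
    [IsProbabilityMeasure μ] {u : α → ℝ} (hu : MemLp (fun x => u x ^ 2) 2 μ) {M : ℝ}
    (h : ∫ x, u x ^ 4 ∂μ ≤ M ^ 4) : ∫ x, u x ^ 2 ∂μ ≤ M ^ 2 := by
  have := integral_mul_le_of_integral_sq_le (μ := μ) (u := fun x => u x ^ 2) (w := fun _ => 1)
    (a := M ^ 2) (b := 1) (fun x => by positivity) (by simp) hu (memLp_const 1) (by positivity)
    (by simp) (by simpa only [← pow_mul] using h) (by simp)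
  simpa using this

lemma norm_covariance_comp_sum_le [DecidableEq ι] (μ : Measure (ι → ℝ)) [IsGaussian μ]
    (hμ : ∀ L : StrongDual ℝ (ι → ℝ), μ[L] = 0) (hψ : ∀ a, SmoothPolyGrowth (ψ a))
    (hφ : ∀ a, SmoothPolyGrowth (φ a)) {Φ : ℝ → ℂ} (hΦ : SmoothPolyGrowth Φ)
    {a b : ι → ℝ} (ha : ∀ i, 0 ≤ a i) (hb : ∀ i, 0 ≤ b i)
    (hψa : ∀ i, ∫ z, ‖deriv (ψ i) (z i) • deriv Φ (∑ k, ψ k (z k))‖ ^ 2 ∂μ ≤ a i ^ 2)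
    (hφb : ∀ i, ∫ z, ‖deriv (φ i) (z i) • deriv Φ (∑ k, φ k (z k))‖ ^ 2 ∂μ ≤ b i ^ 2) :
    ‖∫ z, Φ (∑ k, ψ k (z k)) * Φ (∑ k, φ k (z k)) ∂μ
      - (∫ z, Φ (∑ k, ψ k (z k)) ∂μ) * ∫ z, Φ (∑ k, φ k (z k)) ∂μ‖
      ≤ 2 * ∑ i, ∑ j, |∫ z, z i * z j ∂μ| * (a i * b j) := by
  refine norm_gaussian_covariance_le μ hμ (f := fun z => Φ (∑ k, ψ k (z k)))
    (g := fun z => Φ (∑ k, φ k (z k))) (SmoothPolyGrowth.contDiff_comp_sum hψ hΦ)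
    (hΦ.growth.comp (SmoothPolyGrowth.sum_growth hψ)) (SmoothPolyGrowth.growth_fderiv_comp_sum hψ hΦ)
    (SmoothPolyGrowth.contDiff_comp_sum hφ hΦ)
    (hΦ.growth.comp (SmoothPolyGrowth.sum_growth hφ)) (SmoothPolyGrowth.growth_fderiv_comp_sum hφ hΦ)
    ha hb ?_ ?_
  · simpa only [SmoothPolyGrowth.fderiv_comp_sum_single hψ hΦ] using hψa
  · simpa only [SmoothPolyGrowth.fderiv_comp_sum_single hφ hΦ] using hφb

lemma norm_integral_exp_mul_sub_le (μ : Measure (ι → ℝ)) [IsGaussian μ]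
    (hμ : ∀ L : StrongDual ℝ (ι → ℝ), μ[L] = 0) (hψ : ∀ a, SmoothPolyGrowth (ψ a))
    (hφ : ∀ a, SmoothPolyGrowth (φ a)) {M M' : ι → ℝ} (hM0 : ∀ a, 0 ≤ M a) (hM0' : ∀ a, 0 ≤ M' a)
    (hM : ∀ a, ∫ z, deriv (ψ a) (z a) ^ 4 ∂μ ≤ M a ^ 4)
    (hM' : ∀ a, ∫ z, deriv (φ a) (z a) ^ 4 ∂μ ≤ M' a ^ 4) :
    ‖∫ z, Complex.exp ((∑ a, ψ a (z a) : ℝ) * Complex.I) *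
        Complex.exp ((∑ a, φ a (z a) : ℝ) * Complex.I) ∂μ
      - (∫ z, Complex.exp ((∑ a, ψ a (z a) : ℝ) * Complex.I) ∂μ) *
        ∫ z, Complex.exp ((∑ a, φ a (z a) : ℝ) * Complex.I) ∂μ‖
      ≤ 2 * ∑ a, ∑ b, |∫ z, z a * z b ∂μ| * (M a * M' b) := by
  classical
  have hE := SmoothPolyGrowth.exp_mul_I
  have hb : ∀ {ψ : ι → ℝ → ℝ} {M : ι → ℝ}, (∀ a, SmoothPolyGrowth (ψ a)) →
      (∀ a, ∫ z, deriv (ψ a) (z a) ^ 4 ∂μ ≤ M a ^ 4) → ∀ i,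
      ∫ z, ‖deriv (ψ i) (z i) • deriv (fun x : ℝ => Complex.exp (x * Complex.I))
        (∑ k, ψ k (z k))‖ ^ 2 ∂μ ≤ M i ^ 2 := by
    intro ψ M hψ hM i
    simp only [norm_smul, SmoothPolyGrowth.norm_deriv_exp_mul_I, mul_one, Real.norm_eq_abs, sq_abs]
    refine integral_sq_le_of_integral_pow_four_le (PolyGrowth.memLp_two ?_ μ ?_) (hM i)
    · exact (((hψ i).growth_deriv).comp_clm
        (ContinuousLinearMap.proj (R := ℝ) (φ := fun _ : ι => ℝ) i)).pow 2
    · exact (((hψ i).continuous_deriv.comp (continuous_apply i)).pow 2).aestronglyMeasurable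
  exact norm_covariance_comp_sum_le μ hμ hψ hφ hE hM0 hM0' (hb hψ hM) (hb hφ hM')

lemma integral_sum_pow_four_le (μ : Measure (ι → ℝ)) [IsGaussian μ]
    (hμ : ∀ L : StrongDual ℝ (ι → ℝ), μ[L] = 0) (hψ : ∀ a, SmoothPolyGrowth (ψ a))
    {M : ι → ℝ} (hM0 : ∀ a, 0 ≤ M a)
    (hM : ∀ a, ∫ z, deriv (ψ a) (z a) ^ 4 ∂μ ≤ M a ^ 4) :
    ∫ z, (∑ a, ψ a (z a)) ^ 4 ∂μ ≤ 2 * (∫ z, (∑ a, ψ a (z a)) ^ 2 ∂μ) ^ 2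
      + 64 * (∑ a, ∑ b, |∫ z, z a * z b ∂μ| * (M a * M b)) ^ 2 := by
  classical
  have hE := SmoothPolyGrowth.ofReal_sq
  set T := ∑ a, ∑ b, |∫ z, z a * z b ∂μ| * (M a * M b) with hT
  have h4 : 0 ≤ ∫ z, (∑ a, ψ a (z a)) ^ 4 ∂μ := integral_nonneg fun z => by positivity
  set Q := Real.sqrt (∫ z, (∑ a, ψ a (z a)) ^ 4 ∂μ) with hQ
  have hQ0 : 0 ≤ Q := Real.sqrt_nonneg _
  have hQ2 : Q ^ 2 = ∫ z, (∑ a, ψ a (z a)) ^ 4 ∂μ := Real.sq_sqrt h4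
  have hSg := SmoothPolyGrowth.sum_growth hψ
  have hSc := SmoothPolyGrowth.continuous_sum hψ
  have hb : ∀ i, ∫ z, ‖deriv (ψ i) (z i) • deriv (fun x : ℝ => (x : ℂ) ^ 2)
      (∑ a, ψ a (z a))‖ ^ 2 ∂μ ≤ (2 * Real.sqrt Q * M i) ^ 2 := by
    intro i
    have hdg : PolyGrowth fun z : ι → ℝ => deriv (ψ i) (z i) := ((hψ i).growth_deriv).comp_clm
        (ContinuousLinearMap.proj (R := ℝ) (φ := fun _ : ι => ℝ) i)
    have hdc : Continuous fun z : ι → ℝ => deriv (ψ i) (z i) :=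
      (hψ i).continuous_deriv.comp (continuous_apply (A := fun _ : ι => ℝ) i)
    have h1 : ∀ z : ι → ℝ, ‖deriv (ψ i) (z i) • deriv (fun x : ℝ => (x : ℂ) ^ 2)
        (∑ a, ψ a (z a))‖ ^ 2 = 4 * ((∑ a, ψ a (z a)) ^ 2 * deriv (ψ i) (z i) ^ 2) := fun z => by
      rw [SmoothPolyGrowth.deriv_ofReal_sq, norm_smul, norm_mul, Complex.norm_real,
        Real.norm_eq_abs, Real.norm_eq_abs, mul_pow, mul_pow, sq_abs, sq_abs, Complex.norm_ofNat]
      ring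
    simp only [h1]
    rw [integral_const_mul, mul_pow, mul_pow, Real.sq_sqrt hQ0, mul_assoc]
    have := integral_mul_le_of_integral_sq_le (μ := μ) (u := fun z => (∑ a, ψ a (z a)) ^ 2)
      (w := fun z => deriv (ψ i) (z i) ^ 2) (a := Q) (b := M i ^ 2) (fun x => by positivity)
      (fun x => by positivity)
      ((hSg.pow 2).memLp_two μ (hSc.pow 2).aestronglyMeasurable)
      ((hdg.pow 2).memLp_two μ (hdc.pow 2).aestronglyMeasurable) hQ0 (by positivity)
      (by rw [hQ2]; simp only [← pow_mul]; exact le_rfl)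
      (by simp only [← pow_mul]; exact hM i)
    linarith
  have key := norm_covariance_comp_sum_le μ hμ hψ hψ hE
    (fun i => mul_nonneg (mul_nonneg zero_le_two (Real.sqrt_nonneg Q)) (hM0 i))
    (fun i => mul_nonneg (mul_nonneg zero_le_two (Real.sqrt_nonneg Q)) (hM0 i)) hb hb
  have e1 : ∀ z : ι → ℝ, ((∑ a, ψ a (z a) : ℝ) : ℂ) ^ 2 * ((∑ a, ψ a (z a) : ℝ) : ℂ) ^ 2
      = (((∑ a, ψ a (z a)) ^ 4 : ℝ) : ℂ) := fun z => by push_cast; ring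
  have e2 : ∀ z : ι → ℝ, ((∑ a, ψ a (z a) : ℝ) : ℂ) ^ 2
      = (((∑ a, ψ a (z a)) ^ 2 : ℝ) : ℂ) := fun z => by push_cast; ring
  simp only [e1] at key
  simp only [e2] at key
  rw [integral_complex_ofReal, integral_complex_ofReal, ← Complex.ofReal_mul,
    ← Complex.ofReal_sub, Complex.norm_real, Real.norm_eq_abs] at key
  have e3 : ∑ i, ∑ j, |∫ z, z i * z j ∂μ| * (2 * Real.sqrt Q * M i * (2 * Real.sqrt Q * M j))
      = 4 * Q * T := by
    rw [hT, Finset.mul_sum]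
    refine Finset.sum_congr rfl fun i _ => ?_
    rw [Finset.mul_sum]
    refine Finset.sum_congr rfl fun j _ => ?_
    have : Real.sqrt Q * Real.sqrt Q = Q := Real.mul_self_sqrt hQ0
    linear_combination (4 * |∫ z, z i * z j ∂μ| * M i * M j) * this
  rw [e3, ← hQ2] at key
  rw [← hQ2]
  nlinarith [le_abs_self (Q ^ 2 - (∫ z, (∑ a, ψ a (z a)) ^ 2 ∂μ) * ∫ z, (∑ a, ψ a (z a)) ^ 2 ∂μ),
    sq_nonneg (Q - 8 * T)]

end Separable

lemma integral_sq_gaussianReal_zero (v : NNReal) : ∫ x, x ^ 2 ∂(gaussianReal 0 v) = v := by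
  have h := variance_fun_id_gaussianReal (μ := 0) (v := v)
  rwa [variance_of_integral_eq_zero (by fun_prop) integral_id_gaussianReal] at h

lemma covK_comm (s t : ℝ) : covK s t = covK t s := by
  unfold covK; rw [add_comm t s, abs_sub_comm]

lemma covK_nonneg {s t : ℝ} (hs : 0 ≤ s) (ht : 0 ≤ t) : 0 ≤ covK s t := by
  refine mul_nonneg (by positivity) (sub_nonneg.2 (Real.sqrt_le_sqrt ?_))
  exact abs_le.2 ⟨by linarith, by linarith⟩

lemma covK_zero_left {t : ℝ} (ht : 0 ≤ t) : covK 0 t = 0 := by simp [covK, abs_of_nonneg ht]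

namespace IsHeatGaussian

variable {Ω : Type*} [MeasurableSpace Ω] {P : Measure Ω} {F : ℝ → Ω → ℝ}

lemma measurable (hF : IsHeatGaussian P F) (t : ℝ) : Measurable (F t) := hF.2.1 t

lemma map_sum (hF : IsHeatGaussian P F) {ι : Type*} [Fintype ι] (t c : ι → ℝ) (ht : ∀ i, 0 ≤ t i) :
    P.map (fun ω => ∑ i, c i * F (t i) ω) =
      gaussianReal 0 (∑ i, ∑ j, c i * c j * covK (t i) (t j)).toNNReal := by
  let e := (Fintype.equivFin ι).symm
  have h := hF.2.2 _ (t ∘ e) (c ∘ e) fun i => ht _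
  simp only [Function.comp_apply] at h
  rw [Equiv.sum_comp e (fun i => ∑ j, c i * c (e j) * covK (t i) (t (e j)))] at h
  simp only [fun i => Equiv.sum_comp e (fun j => c i * c j * covK (t i) (t j))] at h
  simpa only [fun ω => Equiv.sum_comp e (fun i => c i * F (t i) ω)] using h

lemma map_eval (hF : IsHeatGaussian P F) {t : ℝ} (ht : 0 ≤ t) :
    P.map (F t) = gaussianReal 0 (covK t t).toNNReal := by
  simpa using hF.map_sum (fun _ : Unit => t) (fun _ => 1) fun _ => ht

lemma map_add (hF : IsHeatGaussian P F) {s t : ℝ} (hs : 0 ≤ s) (ht : 0 ≤ t) (a b : ℝ) :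
    P.map (fun ω => a * F s ω + b * F t ω) =
      gaussianReal 0 (a * a * covK s s + a * b * covK s t + (b * a * covK t s +
        b * b * covK t t)).toNNReal := by
  simpa using hF.map_sum ![s, t] ![a, b] (by simp [hs, ht])

lemma memLp (hF : IsHeatGaussian P F) {t : ℝ} (ht : 0 ≤ t) : MemLp (F t) 2 P := by
  have h := memLp_id_gaussianReal' (μ := 0) (v := (covK t t).toNNReal) 2 (by simp)
  rw [← hF.map_eval ht] at h
  exact h.comp_of_map (hF.measurable t).aemeasurable

lemma integrable_mul (hF : IsHeatGaussian P F) {s t : ℝ} (hs : 0 ≤ s) (ht : 0 ≤ t) :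
    Integrable (fun ω => F s ω * F t ω) P := (hF.memLp hs).integrable_mul (hF.memLp ht)

lemma integral_mul (hF : IsHeatGaussian P F) {s t : ℝ} (hs : 0 ≤ s) (ht : 0 ≤ t) :
    ∫ ω, F s ω * F t ω ∂P = covK s t := by
  have hsq : ∀ {t : ℝ}, 0 ≤ t → ∫ ω, F t ω * F t ω ∂P = covK t t := fun {t} ht => by
    have h := integral_map (μ := P) (hF.measurable t).aemeasurable
      (f := fun x : ℝ => x ^ 2) (by fun_prop)
    rw [hF.map_eval ht, integral_sq_gaussianReal_zero, Real.coe_toNNReal _ (covK_nonneg ht ht)] at h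
    simp only [h, pow_two]
  have h := integral_map (μ := P) (φ := fun ω => 1 * F s ω + 1 * F t ω)
    (((hF.measurable s).const_mul 1).add ((hF.measurable t).const_mul 1)).aemeasurable
    (f := fun x : ℝ => x ^ 2) (by fun_prop)
  have h1 := covK_nonneg hs hs
  have h2 := covK_nonneg hs ht
  have h3 := covK_nonneg ht ht
  rw [hF.map_add hs ht, integral_sq_gaussianReal_zero, covK_comm t s,
    Real.coe_toNNReal _ (by linarith)] at h
  have h4 : ∀ ω, (1 * F s ω + 1 * F t ω) ^ 2 =
      F s ω * F s ω + (2 * (F s ω * F t ω) + F t ω * F t ω) := fun ω => by ring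
  simp only [h4] at h
  have h5 : Integrable (fun ω => 2 * (F s ω * F t ω) + F t ω * F t ω) P :=
    ((hF.integrable_mul hs ht).const_mul 2).add (hF.integrable_mul ht ht)
  rw [integral_add (hF.integrable_mul hs hs) h5,
    integral_add ((hF.integrable_mul hs ht).const_mul 2) (hF.integrable_mul ht ht),
    integral_const_mul, hsq hs, hsq ht] at h
  linarith

lemma integral_lincomb_mul (hF : IsHeatGaussian P F) {s t s' t' : ℝ} (hs : 0 ≤ s) (ht : 0 ≤ t)
    (hs' : 0 ≤ s') (ht' : 0 ≤ t') (a b a' b' : ℝ) :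
    ∫ ω, (a * F s ω + b * F t ω) * (a' * F s' ω + b' * F t' ω) ∂P =
      a * a' * covK s s' + a * b' * covK s t' + (b * a' * covK t s' + b * b' * covK t t') := by
  have h : ∀ ω, (a * F s ω + b * F t ω) * (a' * F s' ω + b' * F t' ω) =
      a * a' * (F s ω * F s' ω) + a * b' * (F s ω * F t' ω) +
      (b * a' * (F t ω * F s' ω) + b * b' * (F t ω * F t' ω)) := fun ω => by ring
  have h1 := (hF.integrable_mul hs hs').const_mul (a * a')
  have h2 := (hF.integrable_mul hs ht').const_mul (a * b')
  have h3 := (hF.integrable_mul ht hs').const_mul (b * a')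
  have h4 := (hF.integrable_mul ht ht').const_mul (b * b')
  have h12 : Integrable (fun ω => a * a' * (F s ω * F s' ω) + a * b' * (F s ω * F t' ω)) P :=
    h1.add h2
  have h34 : Integrable (fun ω => b * a' * (F t ω * F s' ω) + b * b' * (F t ω * F t' ω)) P :=
    h3.add h4
  simp only [h]
  rw [integral_add h12 h34, integral_add h1 h2, integral_add h3 h4,
    integral_const_mul, integral_const_mul, integral_const_mul, integral_const_mul,
    hF.integral_mul hs hs', hF.integral_mul hs ht', hF.integral_mul ht hs', hF.integral_mul ht ht']

variable {ι : Type*} [Fintype ι]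

lemma map_dual_map_lincomb (hF : IsHeatGaussian P F) (p q a b : ι → ℝ) (hp : ∀ i, 0 ≤ p i)
    (hq : ∀ i, 0 ≤ q i) (L : StrongDual ℝ (ι → ℝ)) :
    ∃ v : NNReal, (P.map (fun ω i => a i * F (p i) ω + b i * F (q i) ω)).map L =
      gaussianReal 0 v := by
  classical
  have hm := hF.measurable
  refine ⟨_, Eq.trans ?_ (hF.map_sum (Sum.elim p q)
    (Sum.elim (fun i => a i * L (Pi.single i 1)) (fun i => b i * L (Pi.single i 1)))
    (by rintro (i | i) <;> simp [hp, hq]))⟩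
  rw [Measure.map_map (by fun_prop) (by fun_prop)]
  congr 1
  ext ω
  rw [Function.comp_apply, L.apply_eq_sum_single, Fintype.sum_sum_type, ← Finset.sum_add_distrib]
  refine Finset.sum_congr rfl fun i _ => ?_
  simp only [Sum.elim_inl, Sum.elim_inr, smul_eq_mul]
  ring

lemma isGaussian_map_lincomb (hF : IsHeatGaussian P F) (p q a b : ι → ℝ) (hp : ∀ i, 0 ≤ p i)
    (hq : ∀ i, 0 ≤ q i) :
    IsGaussian (P.map (fun ω i => a i * F (p i) ω + b i * F (q i) ω)) :=
  isGaussian_of_map_eq_gaussianReal fun L => ⟨0, hF.map_dual_map_lincomb p q a b hp hq L⟩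

lemma integral_dual_map_lincomb (hF : IsHeatGaussian P F) (p q a b : ι → ℝ) (hp : ∀ i, 0 ≤ p i)
    (hq : ∀ i, 0 ≤ q i) (L : StrongDual ℝ (ι → ℝ)) :
    (P.map (fun ω i => a i * F (p i) ω + b i * F (q i) ω))[L] = 0 := by
  obtain ⟨v, hv⟩ := hF.map_dual_map_lincomb p q a b hp hq L
  have h := integral_map (μ := P.map (fun ω i => a i * F (p i) ω + b i * F (q i) ω)) (φ := L)
    (by fun_prop) (f := fun x : ℝ => x) (by fun_prop)
  rw [hv, integral_id_gaussianReal] at h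
  exact h.symm

end IsHeatGaussian

lemma sqrt_add_sqrt_le {x y δ : ℝ} (hx : 0 ≤ x) (hxy : x ≤ y) (hδ : 0 ≤ δ) :
    Real.sqrt (y + δ) + Real.sqrt x ≤ Real.sqrt (x + δ) + Real.sqrt y := by
  have hmul : Real.sqrt (y + δ) * Real.sqrt x ≤ Real.sqrt (x + δ) * Real.sqrt y := by
    rw [← Real.sqrt_mul (by linarith), ← Real.sqrt_mul (by linarith)]
    exact Real.sqrt_le_sqrt (by nlinarith)
  refine le_of_sq_le_sq ?_ (by positivity)
  nlinarith [Real.sq_sqrt hx, Real.sq_sqrt (hx.trans hxy),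
    Real.sq_sqrt (by linarith : 0 ≤ y + δ), Real.sq_sqrt (by linarith : 0 ≤ x + δ)]

lemma inv_sqrt_two_pi_le : (Real.sqrt (2 * Real.pi))⁻¹ ≤ 1 / 2 := by
  rw [one_div]
  refine inv_anti₀ (by norm_num) (Real.le_sqrt_of_sq_le ?_)
  nlinarith [Real.pi_gt_three]

lemma covK_self_le (t : ℝ) : covK t t ≤ Real.sqrt t := by
  have h2 : Real.sqrt 2 ≤ 2 := Real.sqrt_le_iff.2 (by norm_num)
  have h : Real.sqrt (t + t) ≤ 2 * Real.sqrt t := by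
    rw [← two_mul, Real.sqrt_mul zero_le_two]
    exact mul_le_mul_of_nonneg_right h2 (Real.sqrt_nonneg _)
  have := mul_le_mul_of_nonneg_right inv_sqrt_two_pi_le (Real.sqrt_nonneg (t + t))
  simp only [covK, sub_self, abs_zero, Real.sqrt_zero, sub_zero]
  linarith

lemma covK_increment_nonneg {s t : ℝ} (hs : 0 ≤ s) (hst : s ≤ t) :
    0 ≤ covK t t - covK t s - covK s t + covK s s := by
  have h1 : Real.sqrt (t + s) ≤ Real.sqrt (s + s) + Real.sqrt (t - s) :=
    Real.sqrt_le_iff.2 ⟨by positivity, by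
      nlinarith [Real.sq_sqrt (by linarith : 0 ≤ s + s), Real.sq_sqrt (sub_nonneg.2 hst),
        mul_nonneg (Real.sqrt_nonneg (s + s)) (Real.sqrt_nonneg (t - s))]⟩
  have h2 : Real.sqrt (t + s) ≤ Real.sqrt (t + t) := Real.sqrt_le_sqrt (by linarith)
  rw [covK_comm s t]
  simp only [covK, sub_self, abs_zero, Real.sqrt_zero, abs_sub_comm s t,
    abs_of_nonneg (sub_nonneg.2 hst), add_comm s t]
  have := mul_nonneg (inv_nonneg.2 (Real.sqrt_nonneg (2 * Real.pi)))
    (by linarith [Real.sqrt_nonneg (t - s)] : 0 ≤ Real.sqrt (t + t) - 2 * Real.sqrt (t + s) +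
      2 * Real.sqrt (t - s) + Real.sqrt (s + s))
  linarith

lemma covK_increment_le {s t : ℝ} (hs : 0 ≤ s) (hst : s ≤ t) :
    covK t t - covK t s - covK s t + covK s s ≤ Real.sqrt (t - s) := by
  have h1 := sqrt_add_sqrt_le (x := s + s) (y := t + s) (δ := t - s) (by linarith) (by linarith)
    (by linarith)
  rw [show t + s + (t - s) = t + t by ring, show s + s + (t - s) = t + s by ring] at h1
  have h2 := mul_le_mul_of_nonneg_left
    (by linarith : Real.sqrt (t + t) - 2 * Real.sqrt (t + s) +
      2 * Real.sqrt (t - s) + Real.sqrt (s + s) ≤ 2 * Real.sqrt (t - s))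
    (inv_nonneg.2 (Real.sqrt_nonneg (2 * Real.pi)))
  have h3 := mul_le_mul_of_nonneg_right inv_sqrt_two_pi_le (Real.sqrt_nonneg (t - s))
  rw [covK_comm s t]
  simp only [covK, sub_self, abs_zero, Real.sqrt_zero,
    abs_sub_comm s t, abs_of_nonneg (sub_nonneg.2 hst), add_comm s t]
  linarith

lemma covK_rectangle_nonpos {a b δ : ℝ} (ha : 0 ≤ a) (hδ : 0 ≤ δ) (hab : a + δ ≤ b) :
    covK (a + δ) (b + δ) - covK (a + δ) b - covK a (b + δ) + covK a b ≤ 0 := by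
  have h1 := sqrt_add_sqrt_le (x := a + b) (y := a + b + δ) (δ := δ) (by linarith) (by linarith) hδ
  have h2 := sqrt_add_sqrt_le (x := b - a - δ) (y := b - a) (δ := δ) (by linarith) (by linarith) hδ
  rw [show b - a - δ + δ = b - a by ring] at h2
  have e1 : |b + δ - (a + δ)| = b - a := by rw [abs_of_nonneg] <;> linarith
  have e2 : |b - (a + δ)| = b - a - δ := by rw [abs_of_nonneg] <;> linarith
  have e3 : |b + δ - a| = b - a + δ := by rw [abs_of_nonneg] <;> linarith
  have e4 : |b - a| = b - a := by rw [abs_of_nonneg]; linarith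
  simp only [covK, e1, e2, e3, e4]
  rw [show b + δ + (a + δ) = a + b + δ + δ by ring, show b + (a + δ) = a + b + δ by ring,
    show b + δ + a = a + b + δ by ring, show b + a = a + b by ring]
  have := mul_nonneg (inv_nonneg.2 (Real.sqrt_nonneg (2 * Real.pi))) (sub_nonneg.2 h1)
  have := mul_nonneg (inv_nonneg.2 (Real.sqrt_nonneg (2 * Real.pi))) (sub_nonneg.2 h2)
  linarith

lemma abs_covK_sub_le {a b r : ℝ} (hab : a ≤ b) :
    |covK b r - covK a r| ≤
      (Real.sqrt (b + r) + Real.sqrt (b - r) - Real.sqrt (r - b)) -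
      (Real.sqrt (a + r) + Real.sqrt (a - r) - Real.sqrt (r - a)) := by
  have hs : ∀ x : ℝ, Real.sqrt |r - x| = Real.sqrt (r - x) + Real.sqrt (x - r) := fun x => by
    rcases le_total x r with h | h
    · rw [abs_of_nonneg (by linarith), Real.sqrt_eq_zero_of_nonpos (by linarith : x - r ≤ 0),
        add_zero]
    · rw [abs_of_nonpos (by linarith), Real.sqrt_eq_zero_of_nonpos (by linarith : r - x ≤ 0),
        zero_add, neg_sub]
  have h1 : Real.sqrt (a + r) ≤ Real.sqrt (b + r) := Real.sqrt_le_sqrt (by linarith)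
  have h2 : Real.sqrt (a - r) ≤ Real.sqrt (b - r) := Real.sqrt_le_sqrt (by linarith)
  have h3 : Real.sqrt (r - b) ≤ Real.sqrt (r - a) := Real.sqrt_le_sqrt (by linarith)
  have hc := inv_sqrt_two_pi_le
  have hc0 : 0 ≤ (Real.sqrt (2 * Real.pi))⁻¹ := by positivity
  unfold covK
  rw [hs, hs, ← mul_sub, abs_mul, abs_of_nonneg hc0]
  refine (mul_le_of_le_one_left (abs_nonneg _) (by linarith)).trans (abs_le.2 ⟨?_, ?_⟩)
  · rw [add_comm r b, add_comm r a]; linarith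
  · rw [add_comm r b, add_comm r a]; linarith

/-- The covariance of the `i`-th and `j`-th increments of the process over the grid of mesh `1/n`. -/
noncomputable def gridCov (n i j : ℕ) : ℝ :=
  covK ((i + 1 : ℕ) / n) ((j + 1 : ℕ) / n) - covK ((i + 1 : ℕ) / n) (j / n)
    - covK (i / n) ((j + 1 : ℕ) / n) + covK (i / n) (j / n)

lemma gridCov_comm (n i j : ℕ) : gridCov n i j = gridCov n j i := by
  unfold gridCov
  rw [covK_comm ((i + 1 : ℕ) / n), covK_comm ((i + 1 : ℕ) / n), covK_comm (i / n),
    covK_comm (i / n)]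
  ring

lemma grid_succ (n i : ℕ) : ((i + 1 : ℕ) : ℝ) / n = i / n + 1 / n := by push_cast; ring

lemma gridCov_self_nonneg (n i : ℕ) : 0 ≤ gridCov n i i :=
  covK_increment_nonneg (by positivity) (by rw [grid_succ]; linarith [(by positivity : (0:ℝ) ≤ 1 / n)])

lemma gridCov_self_le (n i : ℕ) : gridCov n i i ≤ Real.sqrt (1 / n) := by
  refine (covK_increment_le (by positivity)
    (by rw [grid_succ]; linarith [(by positivity : (0:ℝ) ≤ 1 / n)])).trans (le_of_eq ?_)
  rw [grid_succ, add_sub_cancel_left]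

lemma gridCov_nonpos_of_lt {n i j : ℕ} (hij : i < j) : gridCov n i j ≤ 0 := by
  unfold gridCov
  rw [grid_succ, grid_succ]
  refine covK_rectangle_nonpos (by positivity) (by positivity) ?_
  rw [← grid_succ]
  exact div_le_div_of_nonneg_right (by exact_mod_cast hij) (by positivity)

lemma gridCov_nonpos_of_ne {n i j : ℕ} (hij : i ≠ j) : gridCov n i j ≤ 0 := by
  rcases hij.lt_or_gt with h | h
  · exact gridCov_nonpos_of_lt h
  · rw [gridCov_comm]; exact gridCov_nonpos_of_lt h

lemma sum_gridCov (n : ℕ) {a b c d : ℕ} (hab : a ≤ b) (hcd : c ≤ d) :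
    ∑ i ∈ Finset.Ico a b, ∑ j ∈ Finset.Ico c d, gridCov n i j =
      covK (b / n) (d / n) - covK (b / n) (c / n) - covK (a / n) (d / n) + covK (a / n) (c / n) := by
  have h : ∀ i, ∑ j ∈ Finset.Ico c d, gridCov n i j =
      (covK ((i + 1 : ℕ) / n) (d / n) - covK ((i + 1 : ℕ) / n) (c / n)) -
        (covK (i / n) (d / n) - covK (i / n) (c / n)) := fun i => by
    rw [← Finset.sum_Ico_sub (fun j : ℕ => covK ((i + 1 : ℕ) / n) (j / n)) hcd,
      ← Finset.sum_Ico_sub (fun j : ℕ => covK (i / n) (j / n)) hcd, ← Finset.sum_sub_distrib]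
    exact Finset.sum_congr rfl fun j _ => by unfold gridCov; ring
  simp only [h]
  rw [Finset.sum_Ico_sub (fun i : ℕ => covK (i / n) (d / n) - covK (i / n) (c / n)) hab]
  ring

lemma sum_abs_gridCov_cross_le (n : ℕ) {N N' : ℕ} (h : N ≤ N') :
    ∑ i ∈ Finset.Ico 0 N, ∑ j ∈ Finset.Ico N N', |gridCov n i j| ≤ Real.sqrt (N' / n) := by
  have h1 : ∑ i ∈ Finset.Ico 0 N, ∑ j ∈ Finset.Ico N N', |gridCov n i j| =
      -∑ i ∈ Finset.Ico 0 N, ∑ j ∈ Finset.Ico N N', gridCov n i j := by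
    simp only [← Finset.sum_neg_distrib]
    refine Finset.sum_congr rfl fun i hi => Finset.sum_congr rfl fun j hj => ?_
    rw [Finset.mem_Ico] at hi hj
    exact abs_of_nonpos (gridCov_nonpos_of_lt (hi.2.trans_le hj.1))
  rw [h1, sum_gridCov n (Nat.zero_le _) h, Nat.cast_zero, zero_div, covK_zero_left (by positivity),
    covK_zero_left (by positivity)]
  have h2 := covK_nonneg (s := N / n) (t := N' / n) (by positivity) (by positivity)
  have h3 := covK_self_le (N / n)
  have h4 : Real.sqrt (N / n) ≤ Real.sqrt (N' / n) := Real.sqrt_le_sqrt (by gcongr)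
  linarith

lemma sum_abs_gridCov_block_le (n : ℕ) {N N' : ℕ} (h : N ≤ N') :
    ∑ i ∈ Finset.Ico N N', ∑ j ∈ Finset.Ico N N', |gridCov n i j| ≤
      2 * ((N' - N : ℕ) : ℝ) * Real.sqrt (1 / n) := by
  have h1 : ∑ i ∈ Finset.Ico N N', ∑ j ∈ Finset.Ico N N', |gridCov n i j| =
      2 * ∑ i ∈ Finset.Ico N N', gridCov n i i -
        ∑ i ∈ Finset.Ico N N', ∑ j ∈ Finset.Ico N N', gridCov n i j := by
    rw [Finset.mul_sum, ← Finset.sum_sub_distrib]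
    refine Finset.sum_congr rfl fun i hi => ?_
    have h2 : 2 * gridCov n i i =
        ∑ j ∈ Finset.Ico N N', if i = j then 2 * gridCov n i j else 0 := by
      rw [Finset.sum_ite_eq, if_pos hi]
    rw [h2, ← Finset.sum_sub_distrib]
    refine Finset.sum_congr rfl fun j _ => ?_
    split_ifs with hij
    · rw [← hij, abs_of_nonneg (gridCov_self_nonneg n i)]; ring
    · rw [abs_of_nonpos (gridCov_nonpos_of_ne hij)]; ring
  have h2 : 0 ≤ ∑ i ∈ Finset.Ico N N', ∑ j ∈ Finset.Ico N N', gridCov n i j := by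
    rw [sum_gridCov n h h]
    exact covK_increment_nonneg (by positivity) (by gcongr)
  have h3 : ∑ i ∈ Finset.Ico N N', gridCov n i i ≤ ((N' - N : ℕ) : ℝ) * Real.sqrt (1 / n) := by
    refine (Finset.sum_le_card_nsmul _ _ _ fun i _ => gridCov_self_le n i).trans (le_of_eq ?_)
    rw [Nat.card_Ico, nsmul_eq_mul]
  rw [h1]
  linarith

lemma sum_abs_covK_sub_le (n : ℕ) {r : ℝ} (hr : 0 ≤ r) {N N' : ℕ} (h : N ≤ N') :
    ∑ k ∈ Finset.Ico N N', |covK ((k + 1 : ℕ) / n) r - covK (k / n) r| ≤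
      2 * Real.sqrt (N' / n + r) := by
  set Φ : ℕ → ℝ := fun k =>
    Real.sqrt (k / n + r) + Real.sqrt (k / n - r) - Real.sqrt (r - k / n) with hΦ
  have hsum : ∑ k ∈ Finset.Ico N N', |covK ((k + 1 : ℕ) / n) r - covK (k / n) r| ≤ Φ N' - Φ N := by
    rw [← Finset.sum_Ico_sub Φ h]
    refine Finset.sum_le_sum fun k _ => abs_covK_sub_le ?_
    gcongr
    omega
  have h1 : Real.sqrt (N' / n - r) ≤ Real.sqrt (N' / n + r) := Real.sqrt_le_sqrt (by linarith)
  have h2 : Real.sqrt (r - N / n) ≤ Real.sqrt (N / n + r) :=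
    Real.sqrt_le_sqrt (by linarith [(by positivity : (0 : ℝ) ≤ N / n)])
  have h3 := Real.sqrt_nonneg (r - N' / n)
  have h4 := Real.sqrt_nonneg ((N : ℝ) / n - r)
  simp only [hΦ] at hsum
  linarith

lemma SmoothPolyGrowth.const_mul_comp_mul {ψ : ℝ → ℝ} (h : SmoothPolyGrowth ψ) (c b : ℝ) :
    SmoothPolyGrowth (fun x => c * ψ (b * x)) ∧
      deriv (fun x => c * ψ (b * x)) = fun x => c * b * deriv ψ (b * x) := by
  have hd : deriv (fun x => c * ψ (b * x)) = fun x => c * b * deriv ψ (b * x) := by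
    ext x
    have := ((h.contDiff.differentiable (by simp) (b * x)).hasDerivAt.comp x
      ((hasDerivAt_id x).const_mul b)).const_mul c
    rw [HasDerivAt.deriv (f := fun x => c * ψ (b * x)) this]
    simp; ring
  have hb : PolyGrowth (fun x : ℝ => b * x) := PolyGrowth.clm (b • ContinuousLinearMap.id ℝ ℝ)
  have hc : ∀ a : ℝ, PolyGrowth (fun _ : ℝ => a) := fun a => PolyGrowth.of_bounded ‖a‖ (by simp)
  refine ⟨⟨contDiff_const.mul (h.contDiff.comp (by fun_prop)), (hc c).mul (h.growth.comp hb), ?_⟩, hd⟩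
  rw [hd]
  exact (hc _).mul (h.growth_deriv.comp hb)

/-- The rescaled summand `x ↦ w v h(x / √v)`. -/
noncomputable def scaledSummand (h : ℝ → ℝ) (w v x : ℝ) : ℝ := w * v * h ((Real.sqrt v)⁻¹ * x)

lemma smoothPolyGrowth_scaledSummand {h : ℝ → ℝ} (hh : SmoothPolyGrowth h) (w v : ℝ) :
    SmoothPolyGrowth (scaledSummand h w v) := (hh.const_mul_comp_mul (w * v) _).1

lemma map_inv_sqrt_mul_gaussianReal {v : ℝ} (hv : 0 < v) :
    (gaussianReal 0 v.toNNReal).map (fun x => (Real.sqrt v)⁻¹ * x) = gaussianReal 0 1 := by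
  rw [gaussianReal_map_const_mul, mul_zero]
  congr 1
  ext
  simp only [inv_pow, NNReal.coe_mul, NNReal.coe_mk, Real.coe_toNNReal _ hv.le, Real.sq_sqrt hv.le,
    NNReal.coe_one]
  exact inv_mul_cancel₀ hv.ne'

lemma integral_deriv_scaledSummand_le {h : ℝ → ℝ} (hh : SmoothPolyGrowth h) {c : ℝ}
    (hhc : ∫ x, deriv h x ^ 4 ∂(gaussianReal 0 1) ≤ c ^ 4) (w : ℝ) {v s : ℝ}
    (hv : 0 ≤ v) (hvs : Real.sqrt v ≤ s) :
    ∫ x, deriv (scaledSummand h w v) x ^ 4 ∂(gaussianReal 0 v.toNNReal) ≤ (|w| * s * c) ^ 4 := by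
  have hd : deriv (scaledSummand h w v) =
      fun x => w * Real.sqrt v * deriv h ((Real.sqrt v)⁻¹ * x) := by
    refine (hh.const_mul_comp_mul (w * v) _).2.trans ?_
    ext x
    congr 1
    rw [mul_assoc, ← div_eq_mul_inv, Real.div_sqrt]
  rw [hd]
  rcases hv.eq_or_lt with rfl | hv
  · simp; positivity
  have hint := integral_map (μ := gaussianReal 0 v.toNNReal) (φ := fun x => (Real.sqrt v)⁻¹ * x)
    (by fun_prop) (f := fun x => deriv h x ^ 4) (hh.continuous_deriv.pow 4).aestronglyMeasurable
  rw [map_inv_sqrt_mul_gaussianReal hv] at hint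
  simp only [mul_pow]
  rw [integral_const_mul, ← hint]
  have h1 : (Real.sqrt v) ^ 4 ≤ s ^ 4 := pow_le_pow_left₀ (Real.sqrt_nonneg _) hvs 4
  have h2 : |w| ^ 4 = w ^ 4 := by rw [← abs_pow, abs_of_nonneg (by positivity)]
  rw [h2]
  gcongr

/-- The `k`-th summand of `Bproc`, with indices starting at zero. -/
noncomputable def summand {Ω : Type*} (F : ℝ → Ω → ℝ) (h : ℕ → ℝ → ℝ) (n k : ℕ) (ω : Ω) : ℝ :=
  scaledSummand (h (k + 1)) 1 (gridCov n k k) (F ((k + 1 : ℕ) / n) ω - F (k / n) ω)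

section Summands

variable {Ω : Type*} [MeasurableSpace Ω] {P : Measure Ω} {F : ℝ → Ω → ℝ}

lemma IsHeatGaussian.integral_increment_sq (hF : IsHeatGaussian P F) (n k : ℕ) :
    ∫ ω, (F ((k + 1 : ℕ) / n) ω - F (k / n) ω) ^ 2 ∂P = gridCov n k k := by
  have h := hF.integral_lincomb_mul (s := (k + 1 : ℕ) / n) (t := k / n) (s' := (k + 1 : ℕ) / n)
    (t' := k / n) (by positivity) (by positivity) (by positivity) (by positivity) 1 (-1) 1 (-1)
  unfold gridCov
  refine (Eq.trans ?_ h).trans (by ring)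
  congr 1
  ext ω
  ring

lemma IsHeatGaussian.map_increment (hF : IsHeatGaussian P F) (n k : ℕ) :
    P.map (fun ω => F ((k + 1 : ℕ) / n) ω - F (k / n) ω) =
      gaussianReal 0 (gridCov n k k).toNNReal := by
  have h := hF.map_add (s := (k + 1 : ℕ) / n) (t := k / n) (by positivity) (by positivity) 1 (-1)
  rw [show gridCov n k k = _ from (by unfold gridCov; ring :
    gridCov n k k = 1 * 1 * covK ((k + 1 : ℕ) / n) ((k + 1 : ℕ) / n) +
      1 * -1 * covK ((k + 1 : ℕ) / n) (k / n) + (-1 * 1 * covK (k / n) ((k + 1 : ℕ) / n) +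
      -1 * -1 * covK (k / n) (k / n))), ← h]
  congr 1
  ext ω
  ring

lemma Bproc_eq_sum_summand (hF : IsHeatGaussian P F) (h : ℕ → ℝ → ℝ) (n : ℕ) (t : ℝ) (ω : Ω) :
    Bproc P F h n t ω = ∑ k ∈ Finset.range ⌊(n : ℝ) * t⌋₊, summand F h n k ω := by
  unfold Bproc
  refine (Finset.sum_bij (fun k _ => k + 1) ?_ (fun _ _ _ _ h => Nat.succ_injective h) ?_ ?_).symm
  · intro k hk
    rw [Finset.mem_range] at hk
    rw [Finset.mem_Icc]
    lia
  · intro j hj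
    rw [Finset.mem_Icc] at hj
    exact ⟨j - 1, by rw [Finset.mem_range]; lia, by lia⟩
  · intro k _
    have hk : ((k + 1 : ℕ) : ℝ) - 1 = k := by push_cast; ring
    rw [hk, hF.integral_increment_sq, summand, scaledSummand, one_mul]

end Summands

section Transfer

variable {Ω ι : Type*} [MeasurableSpace Ω] {P : Measure Ω} [Fintype ι] {X : ι → Ω → ℝ}
  {ψ φ : ι → ℝ → ℝ} {M M' : ι → ℝ}

lemma norm_integral_exp_mul_sub_le_of_map (hX : ∀ a, Measurable (X a))
    (hG : IsGaussian (P.map fun ω a => X a ω))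
    (h0 : ∀ L : StrongDual ℝ (ι → ℝ), (P.map fun ω a => X a ω)[L] = 0)
    (hψ : ∀ a, SmoothPolyGrowth (ψ a)) (hφ : ∀ a, SmoothPolyGrowth (φ a))
    (hM0 : ∀ a, 0 ≤ M a) (hM0' : ∀ a, 0 ≤ M' a)
    (hM : ∀ a, ∫ ω, deriv (ψ a) (X a ω) ^ 4 ∂P ≤ M a ^ 4)
    (hM' : ∀ a, ∫ ω, deriv (φ a) (X a ω) ^ 4 ∂P ≤ M' a ^ 4) :
    ‖∫ ω, Complex.exp ((∑ a, ψ a (X a ω) : ℝ) * Complex.I) *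
        Complex.exp ((∑ a, φ a (X a ω) : ℝ) * Complex.I) ∂P
      - (∫ ω, Complex.exp ((∑ a, ψ a (X a ω) : ℝ) * Complex.I) ∂P) *
        ∫ ω, Complex.exp ((∑ a, φ a (X a ω) : ℝ) * Complex.I) ∂P‖
      ≤ 2 * ∑ a, ∑ b, |∫ ω, X a ω * X b ω ∂P| * (M a * M' b) := by
  have hmap {E : Type} [NormedAddCommGroup E] [NormedSpace ℝ E] {f : (ι → ℝ) → E}
      (hf : Continuous f) [SecondCountableTopologyEither (ι → ℝ) E] :
      ∫ z, f z ∂(P.map fun ω a => X a ω) = ∫ ω, f (fun a => X a ω) ∂P :=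
    integral_map (measurable_pi_iff.2 hX).aemeasurable hf.aestronglyMeasurable
  have hψc := SmoothPolyGrowth.continuous_sum hψ
  have hφc := SmoothPolyGrowth.continuous_sum hφ
  have hd {ψ : ι → ℝ → ℝ} (hψ : ∀ a, SmoothPolyGrowth (ψ a)) (a : ι) :
      Continuous fun z : ι → ℝ => deriv (ψ a) (z a) ^ 4 :=
    ((hψ a).continuous_deriv.comp (continuous_apply a)).pow 4
  have := norm_integral_exp_mul_sub_le (P.map fun ω a => X a ω) h0 hψ hφ hM0 hM0'
    (fun a => by rw [hmap (hd hψ a)]; exact hM a) (fun a => by rw [hmap (hd hφ a)]; exact hM' a)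
  rw [hmap (by fun_prop), hmap (by fun_prop), hmap (by fun_prop)] at this
  refine this.trans_eq ?_
  congr! 5 with a _ b _
  exact hmap (by fun_prop)

lemma integral_sum_pow_four_le_of_map (hX : ∀ a, Measurable (X a))
    (hG : IsGaussian (P.map fun ω a => X a ω))
    (h0 : ∀ L : StrongDual ℝ (ι → ℝ), (P.map fun ω a => X a ω)[L] = 0)
    (hψ : ∀ a, SmoothPolyGrowth (ψ a)) (hM0 : ∀ a, 0 ≤ M a)
    (hM : ∀ a, ∫ ω, deriv (ψ a) (X a ω) ^ 4 ∂P ≤ M a ^ 4) :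
    ∫ ω, (∑ a, ψ a (X a ω)) ^ 4 ∂P ≤ 2 * (∫ ω, (∑ a, ψ a (X a ω)) ^ 2 ∂P) ^ 2
      + 64 * (∑ a, ∑ b, |∫ ω, X a ω * X b ω ∂P| * (M a * M b)) ^ 2 := by
  have hmap {f : (ι → ℝ) → ℝ} (hf : Continuous f) :
      ∫ z, f z ∂(P.map fun ω a => X a ω) = ∫ ω, f (fun a => X a ω) ∂P :=
    integral_map (measurable_pi_iff.2 hX).aemeasurable hf.aestronglyMeasurable
  have hψc := SmoothPolyGrowth.continuous_sum hψ
  have hd (a : ι) : Continuous fun z : ι → ℝ => deriv (ψ a) (z a) ^ 4 :=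
    ((hψ a).continuous_deriv.comp (continuous_apply a)).pow 4
  have := integral_sum_pow_four_le (P.map fun ω a => X a ω) h0 hψ hM0
    (fun a => by rw [hmap (hd a)]; exact hM a)
  rw [hmap (by fun_prop), hmap (by fun_prop)] at this
  refine this.trans_eq ?_
  congr! 7 with a _ b _
  exact hmap (by fun_prop)

end Transfer

lemma scaledSummand_eq_mul_summand {Ω : Type*} (F : ℝ → Ω → ℝ) (h : ℕ → ℝ → ℝ) (w : ℝ) (n k : ℕ)
    (ω : Ω) : scaledSummand (h (k + 1)) w (gridCov n k k) (F ((k + 1 : ℕ) / n) ω - F (k / n) ω) =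
      w * summand F h n k ω := by
  rw [summand, scaledSummand, scaledSummand]
  ring

section Increments

variable {Ω : Type*} [MeasurableSpace Ω] {P : Measure Ω} {F : ℝ → Ω → ℝ} {h : ℕ → ℝ → ℝ} {c : ℝ}

namespace IsHeatGaussian

lemma integral_increment_mul (hF : IsHeatGaussian P F) (n i j : ℕ) :
    ∫ ω, (F ((i + 1 : ℕ) / n) ω - F (i / n) ω) * (F ((j + 1 : ℕ) / n) ω - F (j / n) ω) ∂P =
      gridCov n i j := by
  have h := hF.integral_lincomb_mul (s := (i + 1 : ℕ) / n) (t := i / n) (s' := (j + 1 : ℕ) / n)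
    (t' := j / n) (by positivity) (by positivity) (by positivity) (by positivity) 1 (-1) 1 (-1)
  unfold gridCov
  refine (Eq.trans ?_ h).trans (by ring)
  congr 1
  ext ω
  ring

lemma integral_mul_increment (hF : IsHeatGaussian P F) {r : ℝ} (hr : 0 ≤ r) (n k : ℕ) :
    ∫ ω, F r ω * (F ((k + 1 : ℕ) / n) ω - F (k / n) ω) ∂P =
      covK ((k + 1 : ℕ) / n) r - covK (k / n) r := by
  have h := hF.integral_lincomb_mul (s := r) (t := 0) (s' := (k + 1 : ℕ) / n)
    (t' := k / n) hr le_rfl (by positivity) (by positivity) 1 0 1 (-1)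
  rw [covK_comm r, covK_comm r] at h
  refine (Eq.trans ?_ h).trans (by ring)
  congr 1
  ext ω
  ring

lemma integral_deriv_scaledSummand_le (hF : IsHeatGaussian P F) (hh : ∀ j, SmoothPolyGrowth (h j))
    (hhc : ∀ j, ∫ x, deriv (h j) x ^ 4 ∂(gaussianReal 0 1) ≤ c ^ 4) (w : ℝ) (n k : ℕ) :
    ∫ ω, deriv (scaledSummand (h (k + 1)) w (gridCov n k k))
      (F ((k + 1 : ℕ) / n) ω - F (k / n) ω) ^ 4 ∂P ≤ (|w| * √√(1 / n) * c) ^ 4 := by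
  have hm := hF.measurable
  have h1 := integral_map (μ := P) (φ := fun ω => F ((k + 1 : ℕ) / n) ω - F (k / n) ω)
    (by fun_prop) (f := fun x => deriv (scaledSummand (h (k + 1)) w (gridCov n k k)) x ^ 4)
    (((smoothPolyGrowth_scaledSummand (hh (k + 1)) _ _).continuous_deriv).pow 4).aestronglyMeasurable
  rw [← h1, hF.map_increment]
  exact _root_.integral_deriv_scaledSummand_le (hh _) (hhc _) w (gridCov_self_nonneg n k)
    (Real.sqrt_le_sqrt (gridCov_self_le n k))

variable {ℓ : ℕ} {r : Fin ℓ → ℝ}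

lemma isGaussian_map_values_increments (hF : IsHeatGaussian P F) (hr : ∀ i, 0 ≤ r i) (n N : ℕ) :
    IsGaussian (P.map fun ω (a : Fin ℓ ⊕ Fin N) => Sum.elim (fun i => F (r i))
      (fun (k : Fin N) ω => F ((k + 1 : ℕ) / n) ω - F ((k : ℕ) / n) ω) a ω) ∧
    ∀ L : StrongDual ℝ (Fin ℓ ⊕ Fin N → ℝ), (P.map fun ω (a : Fin ℓ ⊕ Fin N) =>
      Sum.elim (fun i => F (r i))
        (fun (k : Fin N) ω => F ((k + 1 : ℕ) / n) ω - F ((k : ℕ) / n) ω) a ω)[L] = 0 := by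
  have hp : ∀ a, 0 ≤ (Sum.elim r fun k : Fin N => ((k + 1 : ℕ) : ℝ) / n) a := by
    rintro (i | k)
    · exact hr i
    · exact div_nonneg (Nat.cast_nonneg _) (Nat.cast_nonneg _)
  have hq : ∀ a, 0 ≤ (Sum.elim (fun _ : Fin ℓ => (0 : ℝ)) fun k : Fin N => ((k : ℕ) : ℝ) / n) a := by
    rintro (i | k)
    · exact le_rfl
    · exact div_nonneg (Nat.cast_nonneg _) (Nat.cast_nonneg _)
  have h1 := hF.isGaussian_map_lincomb _ _ (fun _ => 1) (Sum.elim 0 fun _ => -1) hp hq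
  have h2 := hF.integral_dual_map_lincomb _ _ (fun _ => 1) (Sum.elim 0 fun _ => -1) hp hq
  have h3 : (fun ω (a : Fin ℓ ⊕ Fin N) => Sum.elim (fun i => F (r i))
      (fun (k : Fin N) ω => F ((k + 1 : ℕ) / n) ω - F ((k : ℕ) / n) ω) a ω) = fun ω a =>
      1 * F ((Sum.elim r fun k : Fin N => ((k + 1 : ℕ) : ℝ) / n) a) ω +
      (Sum.elim (0 : Fin ℓ → ℝ) (fun _ : Fin N => (-1 : ℝ)) a) *
        F ((Sum.elim (fun _ : Fin ℓ => (0 : ℝ)) fun k : Fin N => ((k : ℕ) : ℝ) / n) a) ω := by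
    ext ω a
    rcases a with i | k
    · simp
    · simp only [Sum.elim_inr]; ring
  rw [h3]
  exact ⟨h1, h2⟩

/-- Approximate factorization of the joint characteristic function of values of the process and of
two weighted sums of summands. -/
lemma norm_integral_exp_mul_sub_le (hF : IsHeatGaussian P F) (hh : ∀ j, SmoothPolyGrowth (h j))
    (hc : 0 ≤ c) (hhc : ∀ j, ∫ x, deriv (h j) x ^ 4 ∂(gaussianReal 0 1) ≤ c ^ 4)
    (hr : ∀ i, 0 ≤ r i) (m : Fin ℓ → ℝ) (w w' : ℕ → ℝ) (n N : ℕ) :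
    ‖∫ ω, Complex.exp ((∑ i, m i * F (r i) ω + ∑ k ∈ Finset.range N, w k * summand F h n k ω : ℝ)
          * Complex.I) *
        Complex.exp ((∑ k ∈ Finset.range N, w' k * summand F h n k ω : ℝ) * Complex.I) ∂P
      - (∫ ω, Complex.exp ((∑ i, m i * F (r i) ω +
          ∑ k ∈ Finset.range N, w k * summand F h n k ω : ℝ) * Complex.I) ∂P) *
        ∫ ω, Complex.exp ((∑ k ∈ Finset.range N, w' k * summand F h n k ω : ℝ) * Complex.I) ∂P‖
      ≤ 2 * (∑ i, ∑ k ∈ Finset.range N, |covK ((k + 1 : ℕ) / n) (r i) - covK (k / n) (r i)| *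
            (|m i| * (|w' k| * √√(1 / n) * c)) +
          ∑ k ∈ Finset.range N, ∑ k' ∈ Finset.range N, |gridCov n k k'| *
            ((|w k| * √√(1 / n) * c) * (|w' k'| * √√(1 / n) * c))) := by
  have hm := hF.measurable
  have := hF.1
  obtain ⟨hG, h0⟩ := hF.isGaussian_map_values_increments hr n N
  set X : Fin ℓ ⊕ Fin N → Ω → ℝ := Sum.elim (fun i => F (r i))
    (fun (k : Fin N) ω => F ((k + 1 : ℕ) / n) ω - F ((k : ℕ) / n) ω) with hX
  have hlin (a : ℝ) : SmoothPolyGrowth fun x : ℝ => a * x :=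
    ⟨by fun_prop, PolyGrowth.clm (a • ContinuousLinearMap.id ℝ ℝ),
      PolyGrowth.of_bounded |a| fun x => by simp⟩
  have hs (w : ℕ → ℝ) (m : Fin ℓ → ℝ) : ∀ a, SmoothPolyGrowth ((Sum.elim (fun i x => m i * x)
      (fun k : Fin N => scaledSummand (h (k + 1)) (w k) (gridCov n k k)) :
      Fin ℓ ⊕ Fin N → ℝ → ℝ) a) := by
    rintro (i | k)
    · exact hlin _
    · exact smoothPolyGrowth_scaledSummand (hh _) _ _
  have hM0 (w : ℕ → ℝ) (m : Fin ℓ → ℝ) : ∀ a, 0 ≤ (Sum.elim (fun i => |m i|)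
      (fun k : Fin N => |w k| * √√(1 / n) * c) : Fin ℓ ⊕ Fin N → ℝ) a := by
    rintro (i | k)
    · exact abs_nonneg _
    · rw [Sum.elim_inr]; positivity
  have hM (w : ℕ → ℝ) (m : Fin ℓ → ℝ) : ∀ a, ∫ ω, deriv ((Sum.elim (fun i x => m i * x)
      (fun k : Fin N => scaledSummand (h (k + 1)) (w k) (gridCov n k k)) :
      Fin ℓ ⊕ Fin N → ℝ → ℝ) a) (X a ω) ^ 4 ∂P ≤ (Sum.elim (fun i => |m i|)
      (fun k : Fin N => |w k| * √√(1 / n) * c) : Fin ℓ ⊕ Fin N → ℝ) a ^ 4 := by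
    rintro (i | k)
    · simp only [Sum.elim_inl, deriv_const_mul_id', integral_const, probReal_univ, one_smul]
      rw [Even.pow_abs (by decide)]
    · exact hF.integral_deriv_scaledSummand_le hh hhc (w k) n k
  have key := norm_integral_exp_mul_sub_le_of_map (X := X)
    (by rintro (i | k) <;> simp only [hX, Sum.elim_inl, Sum.elim_inr] <;> fun_prop) hG h0
    (hs w m) (hs w' 0) (hM0 w m) (hM0 w' 0) (hM w m) (hM w' 0)
  have hsum (w : ℕ → ℝ) (ω : Ω) : ∑ k : Fin N, w k * summand F h n k ω =
      ∑ k ∈ Finset.range N, w k * summand F h n k ω :=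
    Fin.sum_univ_eq_sum_range (fun k => w k * summand F h n k ω) N
  simp only [Fintype.sum_sum_type, hX, Sum.elim_inl, Sum.elim_inr, scaledSummand_eq_mul_summand,
    hsum, Pi.zero_apply, zero_mul, Finset.sum_const_zero, zero_add, abs_zero, mul_zero,
    hF.integral_increment_mul, hF.integral_mul_increment (hr _)] at key
  refine key.trans_eq ?_
  congr 2
  · refine Finset.sum_congr rfl fun i _ => ?_
    exact Fin.sum_univ_eq_sum_range (fun k => |covK ((k + 1 : ℕ) / n) (r i) - covK (k / n) (r i)| *
            (|m i| * (|w' k| * √√(1 / n) * c))) N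
  · rw [← Fin.sum_univ_eq_sum_range (fun k => ∑ k' ∈ Finset.range N, |gridCov n k k'| *
            ((|w k| * √√(1 / n) * c) * (|w' k'| * √√(1 / n) * c)))]
    refine Finset.sum_congr rfl fun i _ => ?_
    exact Fin.sum_univ_eq_sum_range (fun k' => |gridCov n i k'| *
            ((|w i| * √√(1 / n) * c) * (|w' k'| * √√(1 / n) * c))) N

lemma integral_sum_pow_four_le (hF : IsHeatGaussian P F) (hh : ∀ j, SmoothPolyGrowth (h j))
    (hc : 0 ≤ c) (hhc : ∀ j, ∫ x, deriv (h j) x ^ 4 ∂(gaussianReal 0 1) ≤ c ^ 4)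
    (w : ℕ → ℝ) (n N : ℕ) :
    ∫ ω, (∑ k ∈ Finset.range N, w k * summand F h n k ω) ^ 4 ∂P ≤
      2 * (∫ ω, (∑ k ∈ Finset.range N, w k * summand F h n k ω) ^ 2 ∂P) ^ 2
      + 64 * (∑ k ∈ Finset.range N, ∑ k' ∈ Finset.range N, |gridCov n k k'| *
            ((|w k| * √√(1 / n) * c) * (|w k'| * √√(1 / n) * c))) ^ 2 := by
  have hm := hF.measurable
  obtain ⟨hG, h0⟩ := hF.isGaussian_map_values_increments (r := Fin.elim0) (fun i => i.elim0) n N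
  set X : Fin 0 ⊕ Fin N → Ω → ℝ := Sum.elim (fun i => F (Fin.elim0 i))
    (fun (k : Fin N) ω => F ((k + 1 : ℕ) / n) ω - F ((k : ℕ) / n) ω) with hX
  have hs : ∀ a, SmoothPolyGrowth ((Sum.elim (fun i => i.elim0)
      (fun k : Fin N => scaledSummand (h (k + 1)) (w k) (gridCov n k k)) :
      Fin 0 ⊕ Fin N → ℝ → ℝ) a) := by
    rintro (i | k)
    · exact i.elim0
    · exact smoothPolyGrowth_scaledSummand (hh _) _ _
  have hM0 : ∀ a, 0 ≤ (Sum.elim (fun i => i.elim0)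
      (fun k : Fin N => |w k| * √√(1 / n) * c) : Fin 0 ⊕ Fin N → ℝ) a := by
    rintro (i | k)
    · exact i.elim0
    · rw [Sum.elim_inr]; positivity
  have hM : ∀ a, ∫ ω, deriv ((Sum.elim (fun i => i.elim0)
      (fun k : Fin N => scaledSummand (h (k + 1)) (w k) (gridCov n k k)) :
      Fin 0 ⊕ Fin N → ℝ → ℝ) a) (X a ω) ^ 4 ∂P ≤ (Sum.elim (fun i => i.elim0)
      (fun k : Fin N => |w k| * √√(1 / n) * c) : Fin 0 ⊕ Fin N → ℝ) a ^ 4 := by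
    rintro (i | k)
    · exact i.elim0
    · exact hF.integral_deriv_scaledSummand_le hh hhc (w k) n k
  have key := integral_sum_pow_four_le_of_map (X := X)
    (by rintro (i | k) <;> simp only [hX, Sum.elim_inl, Sum.elim_inr] <;> fun_prop) hG h0
    hs hM0 hM
  have hsum (ω : Ω) : ∑ k : Fin N, w k * summand F h n k ω =
      ∑ k ∈ Finset.range N, w k * summand F h n k ω :=
    Fin.sum_univ_eq_sum_range (fun k => w k * summand F h n k ω) N
  simp only [Fintype.sum_sum_type, hX, Sum.elim_inr, scaledSummand_eq_mul_summand,
    hsum, Finset.univ_eq_empty, Finset.sum_empty, zero_add, hF.integral_increment_mul] at key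
  refine key.trans_eq ?_
  congr 3
  rw [← Fin.sum_univ_eq_sum_range (fun k => ∑ k' ∈ Finset.range N, |gridCov n k k'| *
          ((|w k| * √√(1 / n) * c) * (|w k'| * √√(1 / n) * c)))]
  refine Finset.sum_congr rfl fun i _ => ?_
  exact Fin.sum_univ_eq_sum_range (fun k' => |gridCov n i k'| *
          ((|w i| * √√(1 / n) * c) * (|w k'| * √√(1 / n) * c))) N

end IsHeatGaussian

end Increments

lemma sum_range_ite_lt {N N' : ℕ} (hN : N ≤ N') (a : ℕ → ℝ) :
    ∑ k ∈ Finset.range N', (if k < N then a k else 0) = ∑ k ∈ Finset.range N, a k := by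
  rw [← Finset.sum_filter]
  congr 1
  ext k
  simp only [Finset.mem_filter, Finset.mem_range]
  lia

lemma sum_range_ite_le {N N' : ℕ} (a : ℕ → ℝ) :
    ∑ k ∈ Finset.range N', (if N ≤ k then a k else 0) = ∑ k ∈ Finset.Ico N N', a k := by
  rw [← Finset.sum_filter]
  congr 1
  ext k
  simp only [Finset.mem_filter, Finset.mem_range, Finset.mem_Ico]
  lia

namespace IsHeatGaussian

variable {Ω : Type*} [MeasurableSpace Ω] {P : Measure Ω} {F : ℝ → Ω → ℝ} {h : ℕ → ℝ → ℝ} {c : ℝ}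
  {ℓ : ℕ} {r : Fin ℓ → ℝ}

lemma norm_integral_exp_mul_sub_block_le (hF : IsHeatGaussian P F)
    (hh : ∀ j, SmoothPolyGrowth (h j)) (hc : 0 ≤ c)
    (hhc : ∀ j, ∫ x, deriv (h j) x ^ 4 ∂(gaussianReal 0 1) ≤ c ^ 4)
    (hr : ∀ i, 0 ≤ r i) (m : Fin ℓ → ℝ) {w : ℕ → ℝ} {W : ℝ} (hW : ∀ k, |w k| ≤ W) (l : ℝ)
    (n : ℕ) {N N' : ℕ} (hN : N ≤ N') :
    ‖∫ ω, Complex.exp ((∑ i, m i * F (r i) ω + ∑ k ∈ Finset.range N, w k * summand F h n k ω : ℝ)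
          * Complex.I) *
        Complex.exp ((l * ∑ k ∈ Finset.Ico N N', summand F h n k ω : ℝ) * Complex.I) ∂P
      - (∫ ω, Complex.exp ((∑ i, m i * F (r i) ω +
          ∑ k ∈ Finset.range N, w k * summand F h n k ω : ℝ) * Complex.I) ∂P) *
        ∫ ω, Complex.exp ((l * ∑ k ∈ Finset.Ico N N', summand F h n k ω : ℝ) * Complex.I) ∂P‖
      ≤ 2 * (√√(1 / n) * (2 * c * |l| * ∑ i, |m i| * √(N' / n + r i)) +
          √(1 / n) * (W * |l| * c ^ 2 * √(N' / n))) := by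
  have key := hF.norm_integral_exp_mul_sub_le hh hc hhc hr m (fun k => if k < N then w k else 0)
    (fun k => if N ≤ k then l else 0) n N'
  simp only [ite_mul, zero_mul, sum_range_ite_lt hN, sum_range_ite_le, ← Finset.mul_sum] at key
  refine key.trans ?_
  have hs : √√(1 / n) * √√(1 / n) = √(1 / (n : ℝ)) := Real.mul_self_sqrt (Real.sqrt_nonneg _)
  have hW0 : 0 ≤ W := (abs_nonneg _).trans (hW 0)
  gcongr 2 * (?_ + ?_)
  · rw [Finset.mul_sum, Finset.mul_sum]
    refine Finset.sum_le_sum fun i _ => ?_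
    simp only [apply_ite abs, abs_zero, ite_mul, mul_ite, zero_mul, mul_zero, sum_range_ite_le]
    rw [← Finset.sum_mul]
    refine (mul_le_mul_of_nonneg_right (sum_abs_covK_sub_le n (hr i) hN) (by positivity)).trans_eq ?_
    ring
  · simp only [apply_ite abs, abs_zero, ite_mul, mul_ite, zero_mul, mul_zero, sum_range_ite_le]
    calc _ = ∑ k ∈ Finset.range N', if k < N then ∑ k' ∈ Finset.Ico N N',
            |gridCov n k k'| * (|w k| * √√(1 / n) * c * (|l| * √√(1 / n) * c)) else 0 := by
          refine Finset.sum_congr rfl fun k _ => ?_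
          split_ifs <;> simp
      _ ≤ ∑ k ∈ Finset.Ico 0 N, ∑ k' ∈ Finset.Ico N N',
            |gridCov n k k'| * (W * √√(1 / n) * c * (|l| * √√(1 / n) * c)) := by
          rw [sum_range_ite_lt hN, Finset.range_eq_Ico]
          gcongr with k _ k' _
          exact hW k
      _ = (∑ k ∈ Finset.Ico 0 N, ∑ k' ∈ Finset.Ico N N', |gridCov n k k'|) *
            (√(1 / n) * (W * |l| * c ^ 2)) := by
          simp only [← Finset.sum_mul]
          rw [show W * √√(1 / (n : ℝ)) * c * (|l| * √√(1 / (n : ℝ)) * c) =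
            √√(1 / (n : ℝ)) * √√(1 / (n : ℝ)) * (W * |l| * c ^ 2) by ring, hs]
      _ ≤ √(N' / n) * (√(1 / n) * (W * |l| * c ^ 2)) := by
          gcongr
          exact sum_abs_gridCov_cross_le n hN
      _ = _ := by ring

lemma integral_sum_Ico_pow_four_le (hF : IsHeatGaussian P F)
    (hh : ∀ j, SmoothPolyGrowth (h j)) (hc : 0 ≤ c)
    (hhc : ∀ j, ∫ x, deriv (h j) x ^ 4 ∂(gaussianReal 0 1) ≤ c ^ 4)
    (n : ℕ) {N N' : ℕ} (hN : N ≤ N') :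
    ∫ ω, (∑ k ∈ Finset.Ico N N', summand F h n k ω) ^ 4 ∂P ≤
      2 * (∫ ω, (∑ k ∈ Finset.Ico N N', summand F h n k ω) ^ 2 ∂P) ^ 2
      + 256 * (c ^ 2 * ((N' - N : ℕ) / n)) ^ 2 := by
  have key := hF.integral_sum_pow_four_le hh hc hhc (fun k => if N ≤ k then 1 else 0) n N'
  simp only [ite_mul, zero_mul, sum_range_ite_le, one_mul] at key
  refine key.trans (add_le_add_right ?_ _)
  have hs : √√(1 / n) * √√(1 / n) = √(1 / (n : ℝ)) := Real.mul_self_sqrt (Real.sqrt_nonneg _)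
  have hs' : √(1 / (n : ℝ)) * √(1 / n) = 1 / n := Real.mul_self_sqrt (by positivity)
  have h1 : ∑ k ∈ Finset.range N', ∑ k' ∈ Finset.range N', |gridCov n k k'| *
      ((|if N ≤ k then (1 : ℝ) else 0| * √√(1 / n) * c) *
        (|if N ≤ k' then (1 : ℝ) else 0| * √√(1 / n) * c)) ≤
      2 * (c ^ 2 * ((N' - N : ℕ) / n)) := by
    simp only [apply_ite abs, abs_zero, abs_one, ite_mul, mul_ite, zero_mul, mul_zero, one_mul,
      sum_range_ite_le]
    calc _ = (∑ k ∈ Finset.Ico N N', ∑ k' ∈ Finset.Ico N N', |gridCov n k k'|) *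
            (√(1 / n) * c ^ 2) := by
          simp only [Finset.sum_mul]
          rw [← sum_range_ite_le]
          refine Finset.sum_congr rfl fun k _ => ?_
          split_ifs
          · exact Finset.sum_congr rfl fun k' _ => by rw [← mul_mul_mul_comm, hs]; ring
          · simp
      _ ≤ (2 * ((N' - N : ℕ) : ℝ) * √(1 / n)) * (√(1 / n) * c ^ 2) := by
          gcongr
          exact sum_abs_gridCov_block_le n hN
      _ = 2 * ((N' - N : ℕ) : ℝ) * (√(1 / n) * √(1 / n)) * c ^ 2 := by ring
      _ = _ := by rw [hs']; ring
  calc _ ≤ 64 * (2 * (c ^ 2 * (((N' - N : ℕ) : ℝ) / n))) ^ 2 := by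
        refine mul_le_mul_of_nonneg_left (pow_le_pow_left₀ ?_ h1 2) (by norm_num)
        exact Finset.sum_nonneg fun k _ => Finset.sum_nonneg fun k' _ => by positivity
    _ = _ := by ring

lemma measurable_summand (hF : IsHeatGaussian P F) (hh : ∀ j, SmoothPolyGrowth (h j)) (n k : ℕ) :
    Measurable (summand F h n k) := by
  have hm := hF.measurable
  exact (smoothPolyGrowth_scaledSummand (hh (k + 1)) 1 (gridCov n k k)).continuous.measurable.comp
    (f := fun ω => F ((k + 1 : ℕ) / n) ω - F (k / n) ω) (by fun_prop)

lemma memLp_summand (hF : IsHeatGaussian P F) (hh : ∀ j, SmoothPolyGrowth (h j)) (n k : ℕ) :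
    MemLp (summand F h n k) 4 P := by
  have hm := hF.measurable
  have hs := smoothPolyGrowth_scaledSummand (hh (k + 1)) 1 (gridCov n k k)
  have h1 : Integrable (fun x => ‖scaledSummand (h (k + 1)) 1 (gridCov n k k) x‖ ^ 4)
      (P.map fun ω => F ((k + 1 : ℕ) / n) ω - F (k / n) ω) := by
    rw [hF.map_increment]
    exact (hs.growth.norm.pow 4).integrable _ (hs.continuous.norm.pow 4).aestronglyMeasurable
  refine (integrable_norm_rpow_iff (hF.measurable_summand hh n k).aestronglyMeasurable
    (by norm_num) (by norm_num)).1 ?_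
  have h2 := h1.comp_measurable
    (show Measurable fun ω => F ((k + 1 : ℕ) / n) ω - F (k / n) ω by fun_prop)
  refine h2.congr (ae_of_all _ fun ω => ?_)
  norm_num [summand]

lemma integral_summand (hF : IsHeatGaussian P F) (hh : ∀ j, SmoothPolyGrowth (h j))
    (h0 : ∀ j, ∫ x, h j x ∂(gaussianReal 0 1) = 0) (n k : ℕ) :
    ∫ ω, summand F h n k ω ∂P = 0 := by
  have hm := hF.measurable
  have h1 := integral_map (μ := P) (φ := fun ω => F ((k + 1 : ℕ) / n) ω - F (k / n) ω)
    (by fun_prop) (f := scaledSummand (h (k + 1)) 1 (gridCov n k k))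
    (smoothPolyGrowth_scaledSummand (hh (k + 1)) _ _).continuous.aestronglyMeasurable
  refine h1.symm.trans ?_
  rw [hF.map_increment]
  rcases (gridCov_self_nonneg n k).eq_or_lt with hv | hv
  · simp [scaledSummand, ← hv]
  · have h2 := integral_map (μ := gaussianReal 0 (gridCov n k k).toNNReal)
      (φ := fun x => (√(gridCov n k k))⁻¹ * x) (by fun_prop) (f := h (k + 1))
      (hh (k + 1)).continuous.aestronglyMeasurable
    rw [map_inv_sqrt_mul_gaussianReal hv, h0] at h2
    unfold scaledSummand
    rw [integral_const_mul, ← h2, mul_zero]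

end IsHeatGaussian

/-- The properties of the functions `h j` that enter the invariance principle. -/
lemma Assumption31.exists_deriv_bound {ι : Type*} {h : ι → ℝ → ℝ} {L : ℝ} (hA : Assumption31 h L) :
    (∀ j, SmoothPolyGrowth (h j)) ∧
      ∃ c, 0 ≤ c ∧ ∀ j, ∫ x, deriv (h j) x ^ 4 ∂(gaussianReal 0 1) ≤ c ^ 4 := by
  obtain ⟨hd, h0, h0', hlip, -, -⟩ := hA
  have hder : ∀ j x, |deriv (h j) x| ≤ √L * (1 + |x|) := by
    intro j x
    obtain ⟨l, hl, hlx⟩ := hlip j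
    have h1 := hlx x 0
    have h2 : |deriv (h j) 0| ≤ √L := Real.abs_le_sqrt (h0' j)
    have h3 : l ≤ √L := (le_abs_self l).trans (Real.abs_le_sqrt hl)
    have h4 := abs_sub_abs_le_abs_sub (deriv (h j) x) (deriv (h j) 0)
    rw [sub_zero] at h1
    nlinarith [mul_le_mul_of_nonneg_right h3 (abs_nonneg x)]
  have hs : ∀ j, SmoothPolyGrowth (h j) := by
    intro j
    refine ⟨hd j, ⟨|h j 0| + √L, 2, fun x => ?_⟩, ⟨√L, 1, fun x => ?_⟩⟩
    · have h1 : ‖h j x - h j 0‖ ≤ (√L * (1 + |x|)) * ‖x - 0‖ := by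
        refine Convex.norm_image_sub_le_of_norm_deriv_le (𝕜 := ℝ) (s := Metric.closedBall 0 |x|)
          (fun y _ => (hd j).differentiable (by simp) y) (fun y hy => ?_)
          (convex_closedBall _ _) (by simp) (by simp)
        refine (hder j y).trans ?_
        rw [mem_closedBall_zero_iff, Real.norm_eq_abs] at hy
        gcongr
      have h2 := norm_sub_norm_le (h j x) (h j 0)
      rw [sub_zero] at h1
      simp only [Real.norm_eq_abs] at h1 h2 ⊢
      nlinarith [abs_nonneg x, abs_nonneg (h j 0), Real.sqrt_nonneg L,
        mul_nonneg (abs_nonneg x) (abs_nonneg (h j 0)),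
        mul_nonneg (mul_nonneg (abs_nonneg x) (abs_nonneg x)) (abs_nonneg (h j 0)),
        mul_nonneg (abs_nonneg x) (Real.sqrt_nonneg L)]
    · simpa using hder j x
  refine ⟨hs, ?_⟩
  set A := ∫ x, (√L * (1 + |x|)) ^ 4 ∂(gaussianReal 0 1) with hAdef
  have hA0 : 0 ≤ A := integral_nonneg fun x => by positivity
  refine ⟨1 + A, by positivity, fun j => ?_⟩
  have hint : Integrable (fun x : ℝ => (√L * (1 + |x|)) ^ 4) (gaussianReal 0 1) := by
    have : PolyGrowth fun x : ℝ => (√L * (1 + |x|)) := ⟨√L, 1, fun x => by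
      rw [norm_mul, Real.norm_eq_abs, Real.norm_eq_abs, abs_of_nonneg (Real.sqrt_nonneg _),
        abs_of_nonneg (by positivity : 0 ≤ 1 + |x|), pow_one, Real.norm_eq_abs]⟩
    exact (this.pow 4).integrable _ (by fun_prop)
  calc _ ≤ A := by
        refine integral_mono (((hs j).growth_deriv.pow 4).integrable _
          ((hs j).continuous_deriv.pow 4).aestronglyMeasurable) hint fun x => ?_
        simp only
        rw [← Even.pow_abs (by decide) (deriv (h j) x)]
        exact pow_le_pow_left₀ (abs_nonneg _) (hder j x) 4
    _ ≤ (1 + A) ^ 4 := by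
        nlinarith [pow_nonneg hA0 2, pow_nonneg hA0 3, pow_nonneg hA0 4]

/-- A product of numbers of norm at most one depends on its factors in a `1`-Lipschitz way. -/
lemma norm_prod_sub_prod_le_sum {ι : Type*} (s : Finset ι) {a b : ι → ℂ} (ha : ∀ i, ‖a i‖ ≤ 1)
    (hb : ∀ i, ‖b i‖ ≤ 1) : ‖∏ i ∈ s, a i - ∏ i ∈ s, b i‖ ≤ ∑ i ∈ s, ‖a i - b i‖ := by
  classical
  induction s using Finset.induction_on with
  | empty => simp
  | insert j s hj ih =>
    rw [Finset.prod_insert hj, Finset.prod_insert hj, Finset.sum_insert hj]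
    have h1 : a j * ∏ i ∈ s, a i - b j * ∏ i ∈ s, b i =
        (a j - b j) * ∏ i ∈ s, a i + b j * (∏ i ∈ s, a i - ∏ i ∈ s, b i) := by ring
    have h2 : ‖∏ i ∈ s, a i‖ ≤ 1 := by
      rw [norm_prod]
      exact Finset.prod_le_one (fun i _ => norm_nonneg _) fun i _ => ha i
    rw [h1]
    refine (norm_add_le _ _).trans (add_le_add ?_ ?_)
    · rw [norm_mul]
      exact mul_le_of_le_one_right (norm_nonneg _) h2
    · rw [norm_mul]
      exact (mul_le_of_le_one_left (norm_nonneg _) (hb j)).trans ih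

lemma norm_exp_mul_I_sub_taylor_le (x : ℝ) :
    ‖Complex.exp (x * Complex.I) - (1 + x * Complex.I - x ^ 2 / 2)‖ ≤ 4 * |x| ^ 3 := by
  have hx : ‖(x : ℂ) * Complex.I‖ = |x| := by simp
  rcases le_or_gt |x| 1 with h | h
  · have h1 := Complex.exp_bound (x := x * Complex.I) (by rwa [hx]) (n := 3) (by norm_num)
    rw [hx] at h1
    have h2 : ∑ m ∈ Finset.range 3, ((x : ℂ) * Complex.I) ^ m / (m.factorial : ℂ) =
        1 + x * Complex.I - x ^ 2 / 2 := by
      simp [Finset.sum_range_succ, mul_pow]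
      ring
    rw [h2] at h1
    refine h1.trans ?_
    norm_num [Nat.factorial]
    nlinarith [pow_nonneg (abs_nonneg x) 3]
  · have h1 : ‖(1 : ℂ) + x * Complex.I - x ^ 2 / 2‖ ≤ 1 + |x| + |x| ^ 2 / 2 := by
      refine (norm_sub_le _ _).trans (add_le_add ((norm_add_le _ _).trans ?_) ?_)
      · rw [hx, norm_one]
      · simp
    refine (norm_sub_le _ _).trans ?_
    rw [Complex.norm_exp_ofReal_mul_I]
    nlinarith [mul_pos (sub_pos.2 h) (sub_pos.2 h), pow_pos (sub_pos.2 h) 3]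

lemma abs_exp_neg_sub_le {x : ℝ} (hx : 0 ≤ x) : |Real.exp (-x) - (1 - x)| ≤ x ^ 2 := by
  rcases le_or_gt x 1 with h | h
  · have := Real.abs_exp_sub_one_sub_id_le (x := -x) (by rwa [abs_neg, abs_of_nonneg hx])
    rw [neg_sq] at this
    convert this using 2
    ring
  · have h1 := Real.one_sub_le_exp_neg x
    have h2 : Real.exp (-x) ≤ 1 := Real.exp_le_one_iff.2 (by linarith)
    rw [abs_of_nonneg (by linarith)]
    nlinarith

section CharFun

variable {Ω : Type*} [MeasurableSpace Ω] {P : Measure Ω} [IsProbabilityMeasure P]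

lemma norm_integral_exp_mul_I_le (f : Ω → ℝ) :
    ‖∫ ω, Complex.exp (f ω * Complex.I) ∂P‖ ≤ 1 :=
  (norm_integral_le_of_norm_le_const (C := 1) (ae_of_all _ fun ω => by
    rw [Complex.norm_exp_ofReal_mul_I])).trans (by simp)

lemma integrable_exp_mul_I {f : Ω → ℝ} (hf : AEStronglyMeasurable f P) :
    Integrable (fun ω => Complex.exp (f ω * Complex.I)) P :=
  .of_bound (Complex.continuous_exp.comp_aestronglyMeasurable
    ((Complex.continuous_ofReal.comp_aestronglyMeasurable hf).mul_const _)) 1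
    (ae_of_all _ fun ω => by rw [Complex.norm_exp_ofReal_mul_I])

lemma norm_integral_exp_sub_exp_le {D : Ω → ℝ} (hD : MemLp D 4 P) (h0 : ∫ ω, D ω ∂P = 0)
    {B : ℝ} (hB : ∫ ω, D ω ^ 4 ∂P ≤ B) (l : ℝ) {x : ℝ} (hx : 0 ≤ x) :
    ‖∫ ω, Complex.exp ((l * D ω : ℝ) * Complex.I) ∂P - (Real.exp (-x) : ℝ)‖ ≤
      4 * |l| ^ 3 * (√(∫ ω, D ω ^ 2 ∂P) * √B) +
        (|l ^ 2 * (∫ ω, D ω ^ 2 ∂P) / 2 - x| + x ^ 2) := by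
  have hD2 : MemLp D 2 P := hD.mono_exponent (by norm_num)
  have hi1 : Integrable D P := hD.integrable (by norm_num)
  have hi2 : Integrable (fun ω => D ω ^ 2) P := hD2.integrable_sq
  have hD4 : MemLp (fun ω => D ω ^ 2) 2 P := by
    refine (memLp_two_iff_integrable_sq_norm (hD.1.pow 2)).2 ?_
    have := hD.integrable_norm_pow (p := 4) (by norm_num)
    refine this.congr (ae_of_all _ fun ω => ?_)
    simp only [Pi.pow_apply, norm_pow]
    ring
  have hnn : 0 ≤ ∫ ω, D ω ^ 2 ∂P := integral_nonneg fun ω => sq_nonneg _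
  have hB0 : 0 ≤ B := (integral_nonneg fun ω => by positivity).trans hB
  have h3 : ∫ ω, |D ω| * D ω ^ 2 ∂P ≤ √(∫ ω, D ω ^ 2 ∂P) * √B := by
    refine integral_mul_le_of_integral_sq_le (fun ω => abs_nonneg _) (fun ω => sq_nonneg _)
      hD2.abs hD4 (Real.sqrt_nonneg _) (Real.sqrt_nonneg _) ?_ ?_
    · rw [Real.sq_sqrt hnn]
      simp
    · rw [Real.sq_sqrt hB0]
      simpa only [← pow_mul] using hB
  have hi3 : Integrable (fun ω => |D ω| * D ω ^ 2) P := hD2.abs.integrable_mul hD4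
  have hiT : Integrable (fun ω => (1 : ℂ) + (l * D ω : ℝ) * Complex.I - (l * D ω : ℝ) ^ 2 / 2) P := by
    have h4 : Integrable (fun ω => (1 : ℂ) + (l * D ω : ℝ) * Complex.I) P :=
      (integrable_const _).add ((hi1.const_mul l).ofReal.mul_const _)
    have h5 : Integrable (fun ω => ((l * D ω : ℝ) : ℂ) ^ 2 / 2) P := by
      have := (hi2.const_mul (l ^ 2 / 2)).ofReal (𝕜 := ℂ)
      refine this.congr (ae_of_all _ fun ω => ?_)
      simp only [Complex.coe_algebraMap, Complex.ofReal_mul, Complex.ofReal_div,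
        Complex.ofReal_pow, Complex.ofReal_ofNat, mul_pow]
      ring
    exact h4.sub h5
  have hT : ∫ ω, ((1 : ℂ) + (l * D ω : ℝ) * Complex.I - (l * D ω : ℝ) ^ 2 / 2) ∂P =
      ((1 - l ^ 2 * (∫ ω, D ω ^ 2 ∂P) / 2 : ℝ) : ℂ) := by
    have h4 : ∀ ω, ((1 : ℂ) + (l * D ω : ℝ) * Complex.I - (l * D ω : ℝ) ^ 2 / 2) =
        ((1 - l ^ 2 / 2 * D ω ^ 2 : ℝ) : ℂ) + (l * D ω : ℝ) * Complex.I := fun ω => by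
      push_cast
      ring
    have h5 : Integrable (fun ω => ((1 - l ^ 2 / 2 * D ω ^ 2 : ℝ) : ℂ)) P :=
      ((integrable_const (1 : ℝ)).sub (hi2.const_mul _)).ofReal
    have h6 : Integrable (fun ω => ((l * D ω : ℝ) : ℂ) * Complex.I) P :=
      (hi1.const_mul l).ofReal.mul_const _
    simp only [h4]
    rw [integral_add h5 h6, integral_mul_const, integral_complex_ofReal, integral_complex_ofReal,
      integral_const_mul, h0, integral_sub (integrable_const _) (hi2.const_mul _),
      integral_const_mul, integral_const, probReal_univ]
    simp
    ring
  have h4 : ‖∫ ω, Complex.exp ((l * D ω : ℝ) * Complex.I) ∂P -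
      ((1 - l ^ 2 * (∫ ω, D ω ^ 2 ∂P) / 2 : ℝ) : ℂ)‖ ≤
      4 * |l| ^ 3 * (√(∫ ω, D ω ^ 2 ∂P) * √B) := by
    rw [← hT, ← integral_sub (integrable_exp_mul_I (hD.1.const_mul l)) hiT]
    refine (norm_integral_le_integral_norm _).trans ?_
    refine (integral_mono_of_nonneg (ae_of_all _ fun ω => norm_nonneg _)
      (hi3.const_mul (4 * |l| ^ 3)) (ae_of_all _ fun ω => ?_)).trans ?_
    · refine (norm_exp_mul_I_sub_taylor_le (l * D ω)).trans_eq ?_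
      simp only
      rw [abs_mul, mul_pow, ← sq_abs (D ω)]
      ring
    · rw [integral_const_mul]
      gcongr
  have h5 : ‖((1 - l ^ 2 * (∫ ω, D ω ^ 2 ∂P) / 2 : ℝ) : ℂ) - (Real.exp (-x) : ℝ)‖ ≤
      |l ^ 2 * (∫ ω, D ω ^ 2 ∂P) / 2 - x| + x ^ 2 := by
    rw [← Complex.ofReal_sub, Complex.norm_real, Real.norm_eq_abs]
    have h6 := abs_exp_neg_sub_le hx
    rw [abs_le] at h6 ⊢
    constructor <;> cases abs_cases (l ^ 2 * (∫ ω, D ω ^ 2 ∂P) / 2 - x) <;> linarith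
  exact (norm_sub_le_norm_sub_add_norm_sub _ _ _).trans (add_le_add h4 h5)

end CharFun

/-- The sum of the summands of `Bproc` over the grid points between times `s` and `t`. -/
noncomputable def blockSum {Ω : Type*} (F : ℝ → Ω → ℝ) (h : ℕ → ℝ → ℝ) (n : ℕ) (s t : ℝ) (ω : Ω) : ℝ :=
  ∑ k ∈ Finset.Ico ⌊(n : ℝ) * s⌋₊ ⌊(n : ℝ) * t⌋₊, summand F h n k ω

lemma floor_mul_mono (n : ℕ) {s t : ℝ} (hst : s ≤ t) : ⌊(n : ℝ) * s⌋₊ ≤ ⌊(n : ℝ) * t⌋₊ :=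
  Nat.floor_mono (by gcongr)

lemma floor_mul_div_le (n : ℕ) {t : ℝ} (ht : 0 ≤ t) : (⌊(n : ℝ) * t⌋₊ : ℝ) / n ≤ t :=
  div_le_of_le_mul₀ (by positivity) ht (by
    rw [mul_comm t]
    exact Nat.floor_le (by positivity))

lemma tendsto_floor_mul_sub_div {s t : ℝ} (hs : 0 ≤ s) (hst : s ≤ t) :
    Tendsto (fun n : ℕ => ((⌊(n : ℝ) * t⌋₊ - ⌊(n : ℝ) * s⌋₊ : ℕ) : ℝ) / n) atTop (nhds (t - s)) := by
  have h1 := ((tendsto_nat_floor_mul_div_atTop (hs.trans hst)).sub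
    (tendsto_nat_floor_mul_div_atTop hs)).comp tendsto_natCast_atTop_atTop
  refine h1.congr fun n => ?_
  simp only [Function.comp_apply]
  rw [Nat.cast_sub (floor_mul_mono n hst), sub_div, mul_comm t, mul_comm s]

lemma blockSum_add {Ω : Type*} (F : ℝ → Ω → ℝ) (h : ℕ → ℝ → ℝ) (n : ℕ) {s t t' : ℝ} (hst : s ≤ t)
    (htt' : t ≤ t') (ω : Ω) :
    blockSum F h n s t ω + blockSum F h n t t' ω = blockSum F h n s t' ω :=
  Finset.sum_Ico_consecutive _ (floor_mul_mono n hst) (floor_mul_mono n htt')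

lemma sum_blockSum {Ω : Type*} (F : ℝ → Ω → ℝ) (h : ℕ → ℝ → ℝ) (n : ℕ) {v : ℕ → ℝ} (hv : Monotone v)
    (M : ℕ) (ω : Ω) :
    ∑ k ∈ Finset.range M, blockSum F h n (v k) (v (k + 1)) ω = blockSum F h n (v 0) (v M) ω := by
  induction M with
  | zero => simp [blockSum]
  | succ M ih =>
    rw [Finset.sum_range_succ, ih, blockSum_add _ _ _ (hv M.zero_le) (hv M.le_succ)]

/-- A linear combination of sums over consecutive blocks is a weighted sum of summands with bounded
weights. -/
lemma sum_mul_blockSum_eq {Ω : Type*} (F : ℝ → Ω → ℝ) (h : ℕ → ℝ → ℝ) (n : ℕ) {v : ℕ → ℝ}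
    (hv : Monotone v) (l : ℕ → ℝ) (M : ℕ) : ∃ w : ℕ → ℝ, (∀ k, |w k| ≤ ∑ j ∈ Finset.range M, |l j|) ∧
      ∀ ω, ∑ j ∈ Finset.range M, l j * blockSum F h n (v j) (v (j + 1)) ω =
        ∑ k ∈ Finset.range ⌊(n : ℝ) * v M⌋₊, w k * summand F h n k ω := by
  set N : ℕ → ℕ := fun j => ⌊(n : ℝ) * v j⌋₊ with hN
  refine ⟨fun k => ∑ j ∈ Finset.range M, if k ∈ Finset.Ico (N j) (N (j + 1)) then l j else 0,
    fun k => ?_, fun ω => ?_⟩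
  · refine (Finset.abs_sum_le_sum_abs _ _).trans (Finset.sum_le_sum fun j _ => ?_)
    split_ifs
    · exact le_rfl
    · simp
  · simp only [Finset.sum_mul]
    rw [Finset.sum_comm]
    refine Finset.sum_congr rfl fun j hj => ?_
    simp only [ite_mul, zero_mul]
    rw [← Finset.sum_filter, blockSum, Finset.mul_sum]
    congr 1
    ext k
    have h1 : N (j + 1) ≤ N M := floor_mul_mono n (hv (Finset.mem_range.1 hj))
    simp only [Finset.mem_filter, Finset.mem_range, Finset.mem_Ico]
    change _ ↔ k < N M ∧ _
    constructor
    · exact fun h2 => ⟨h2.2.trans_le h1, h2⟩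
    · exact fun h2 => h2.2

namespace IsHeatGaussian

variable {Ω : Type*} [MeasurableSpace Ω] {P : Measure Ω} {F : ℝ → Ω → ℝ} {h : ℕ → ℝ → ℝ} {c κ : ℝ}
  {ℓ : ℕ} {r : Fin ℓ → ℝ}

lemma Bproc_sub_eq_blockSum (hF : IsHeatGaussian P F) (h : ℕ → ℝ → ℝ) (n : ℕ) {s t : ℝ}
    (hst : s ≤ t) (ω : Ω) : Bproc P F h n t ω - Bproc P F h n s ω = blockSum F h n s t ω := by
  rw [Bproc_eq_sum_summand hF, Bproc_eq_sum_summand hF, blockSum,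
    Finset.sum_Ico_eq_sub _ (floor_mul_mono n hst)]

lemma measurable_blockSum (hF : IsHeatGaussian P F) (hh : ∀ j, SmoothPolyGrowth (h j)) (n : ℕ)
    (s t : ℝ) : Measurable (blockSum F h n s t) :=
  Finset.measurable_fun_sum _ fun k _ => hF.measurable_summand hh n k

lemma memLp_blockSum (hF : IsHeatGaussian P F) (hh : ∀ j, SmoothPolyGrowth (h j)) (n : ℕ)
    (s t : ℝ) : MemLp (blockSum F h n s t) 4 P :=
  memLp_finsetSum _ fun k _ => hF.memLp_summand hh n k

lemma integral_blockSum (hF : IsHeatGaussian P F) (hh : ∀ j, SmoothPolyGrowth (h j))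
    (h0 : ∀ j, ∫ x, h j x ∂(gaussianReal 0 1) = 0) (n : ℕ) (s t : ℝ) :
    ∫ ω, blockSum F h n s t ω ∂P = 0 := by
  have := hF.1
  unfold blockSum
  rw [integral_finsetSum _ fun k _ => (hF.memLp_summand hh n k).integrable (by norm_num)]
  exact Finset.sum_eq_zero fun k _ => hF.integral_summand hh h0 n k

/-- Asymptotic independence of the values of the process and of the increments of `Bproc` over
consecutive blocks. -/
lemma tendsto_integral_exp_sub_prod (hF : IsHeatGaussian P F) (hh : ∀ j, SmoothPolyGrowth (h j))
    (hc : 0 ≤ c) (hhc : ∀ j, ∫ x, deriv (h j) x ^ 4 ∂(gaussianReal 0 1) ≤ c ^ 4)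
    (hr : ∀ i, 0 ≤ r i) (m : Fin ℓ → ℝ) {v : ℕ → ℝ} (hv : Monotone v) (hv0 : 0 ≤ v 0)
    (l : ℕ → ℝ) (M : ℕ) :
    Tendsto (fun n : ℕ => ∫ ω, Complex.exp ((∑ i, m i * F (r i) ω +
        ∑ j ∈ Finset.range M, l j * blockSum F h n (v j) (v (j + 1)) ω : ℝ) * Complex.I) ∂P -
      (∫ ω, Complex.exp ((∑ i, m i * F (r i) ω : ℝ) * Complex.I) ∂P) *
        ∏ j ∈ Finset.range M,
          ∫ ω, Complex.exp ((l j * blockSum F h n (v j) (v (j + 1)) ω : ℝ) * Complex.I) ∂P)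
      atTop (nhds 0) := by
  have := hF.1
  induction M with
  | zero => simp
  | succ M ih =>
    set W := ∑ j ∈ Finset.range M, |l j|
    set χ : ℕ → ℂ := fun n =>
      ∫ ω, Complex.exp ((l M * blockSum F h n (v M) (v (M + 1)) ω : ℝ) * Complex.I) ∂P with hχ
    set A : ℕ → Ω → ℝ := fun n ω => ∑ i, m i * F (r i) ω +
        ∑ j ∈ Finset.range M, l j * blockSum F h n (v j) (v (j + 1)) ω with hA
    have hvM : 0 ≤ v (M + 1) := hv0.trans (hv (Nat.zero_le _))
    have h1 : Tendsto (fun n : ℕ => ∫ ω, Complex.exp ((A n ω : ℝ) * Complex.I) *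
        Complex.exp ((l M * blockSum F h n (v M) (v (M + 1)) ω : ℝ) * Complex.I) ∂P -
        (∫ ω, Complex.exp ((A n ω : ℝ) * Complex.I) ∂P) * χ n) atTop (nhds 0) := by
      refine squeeze_zero_norm (a := fun n : ℕ => 2 * (√√(1 / n) *
          (2 * c * |l M| * ∑ i, |m i| * √(v (M + 1) + r i)) +
          √(1 / n) * (W * |l M| * c ^ 2 * √(v (M + 1))))) (fun n => ?_) ?_
      · obtain ⟨w, hw, hw'⟩ := sum_mul_blockSum_eq F h n hv l M
        simp only [hA, hχ, hw']
        refine (hF.norm_integral_exp_mul_sub_block_le hh hc hhc hr m hw (l M) n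
          (floor_mul_mono n (hv M.le_succ))).trans ?_
        have hle := floor_mul_div_le n hvM
        have hW : 0 ≤ W := Finset.sum_nonneg fun _ _ => abs_nonneg _
        gcongr
      · have h2 : Tendsto (fun n : ℕ => √(1 / (n : ℝ))) atTop (nhds 0) := by
          simpa using tendsto_one_div_atTop_nhds_zero_nat.sqrt
        have h3 : Tendsto (fun n : ℕ => √√(1 / (n : ℝ))) atTop (nhds 0) := by
          simpa using h2.sqrt
        simpa using ((h3.mul_const (2 * c * |l M| * ∑ i, |m i| * √(v (M + 1) + r i))).add
          (h2.mul_const (W * |l M| * c ^ 2 * √(v (M + 1))))).const_mul 2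
    have h2 := ih.zero_mul_isBoundedUnder_le (g := χ)
      (isBoundedUnder_of ⟨1, fun n => norm_integral_exp_mul_I_le _⟩)
    refine ((h1.add h2).congr fun n => ?_).trans (by rw [add_zero])
    have h3 : ∀ ω, Complex.exp ((A n ω : ℝ) * Complex.I) *
        Complex.exp ((l M * blockSum F h n (v M) (v (M + 1)) ω : ℝ) * Complex.I) =
        Complex.exp ((∑ i, m i * F (r i) ω +
        ∑ j ∈ Finset.range (M + 1), l j * blockSum F h n (v j) (v (j + 1)) ω : ℝ) * Complex.I) := by
      intro ω
      rw [← Complex.exp_add, ← add_mul, ← Complex.ofReal_add, Finset.sum_range_succ, hA, add_assoc]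
    simp only [h3]
    rw [Finset.prod_range_succ]
    ring

/-- One-dimensional central limit theorem for the increments of `Bproc`. -/
lemma tendsto_integral_exp_blockSum (hF : IsHeatGaussian P F) (hh : ∀ j, SmoothPolyGrowth (h j))
    (h0 : ∀ j, ∫ x, h j x ∂(gaussianReal 0 1) = 0) (hc : 0 ≤ c)
    (hhc : ∀ j, ∫ x, deriv (h j) x ^ 4 ∂(gaussianReal 0 1) ≤ c ^ 4)
    (hvar : ∀ s t : ℝ, 0 ≤ s → s < t →
      Tendsto (fun n : ℕ => ∫ ω, blockSum F h n s t ω ^ 2 ∂P) atTop (nhds (κ ^ 2 * (t - s))))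
    (l : ℝ) {s t : ℝ} (hs : 0 ≤ s) (hst : s < t) :
    Tendsto (fun n : ℕ => ∫ ω, Complex.exp ((l * blockSum F h n s t ω : ℝ) * Complex.I) ∂P)
      atTop (nhds ((Real.exp (-(l ^ 2 * (κ ^ 2 * (t - s)) / 2)) : ℝ) : ℂ)) := by
  have := hF.1
  set χ : ℕ → ℝ → ℝ → ℂ := fun n s t =>
    ∫ ω, Complex.exp ((l * blockSum F h n s t ω : ℝ) * Complex.I) ∂P with hχ
  set b : ℕ → ℝ → ℝ → ℝ := fun n s t =>
    4 * |l| ^ 3 * (√(∫ ω, blockSum F h n s t ω ^ 2 ∂P) *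
      √(2 * (∫ ω, blockSum F h n s t ω ^ 2 ∂P) ^ 2 +
        256 * (c ^ 2 * ((⌊(n : ℝ) * t⌋₊ - ⌊(n : ℝ) * s⌋₊ : ℕ) / n)) ^ 2)) +
      (|l ^ 2 * (∫ ω, blockSum F h n s t ω ^ 2 ∂P) / 2 - l ^ 2 * (κ ^ 2 * (t - s)) / 2| +
        (l ^ 2 * (κ ^ 2 * (t - s)) / 2) ^ 2) with hb
  set G : ℝ → ℝ := fun δ => 4 * |l| ^ 3 * (√(κ ^ 2 * δ) *
      √(2 * (κ ^ 2 * δ) ^ 2 + 256 * (c ^ 2 * δ) ^ 2)) + (l ^ 2 * (κ ^ 2 * δ) / 2) ^ 2 with hG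
  have hχb (n : ℕ) {s t : ℝ} (hst : s ≤ t) :
      ‖χ n s t - (Real.exp (-(l ^ 2 * (κ ^ 2 * (t - s)) / 2)) : ℝ)‖ ≤ b n s t :=
    norm_integral_exp_sub_exp_le (hF.memLp_blockSum hh n s t) (hF.integral_blockSum hh h0 n s t)
      (hF.integral_sum_Ico_pow_four_le hh hc hhc n (floor_mul_mono n hst)) l
      (by have := sub_nonneg.2 hst; positivity)
  have hbG {s t : ℝ} (hs : 0 ≤ s) (hst : s < t) :
      Tendsto (fun n => b n s t) atTop (nhds (G (t - s))) := by
    have h1 := hvar s t hs hst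
    have h2 := tendsto_floor_mul_sub_div hs hst.le
    have h3 := (((h1.pow 2).const_mul 2).add (((h2.const_mul (c ^ 2)).pow 2).const_mul 256)).sqrt
    have h4 := (h1.sqrt.mul h3).const_mul (4 * |l| ^ 3)
    have h5 := (((h1.const_mul (l ^ 2)).div_const 2).sub_const
      (l ^ 2 * (κ ^ 2 * (t - s)) / 2)).abs.add_const ((l ^ 2 * (κ ^ 2 * (t - s)) / 2) ^ 2)
    rw [sub_self, abs_zero, zero_add] at h5
    exact h4.add h5
  set T := t - s with hT
  have hT0 : 0 < T := sub_pos.2 hst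
  have hKG : Tendsto (fun K : ℕ => (K : ℝ) * G (T / K)) atTop (nhds 0) := by
    have h1 : Tendsto (fun K : ℕ => T / (K : ℝ)) atTop (nhds 0) :=
      tendsto_const_div_atTop_nhds_zero_nat T
    have h2 : Tendsto (fun K : ℕ => T * (4 * |l| ^ 3 * (√(κ ^ 2 * (T / K)) *
        √(2 * κ ^ 4 + 256 * c ^ 4)) + (l ^ 2 * κ ^ 2 / 2) ^ 2 * (T / K))) atTop (nhds 0) := by
      have h3 := (((h1.const_mul (κ ^ 2)).sqrt.mul_const (√(2 * κ ^ 4 + 256 * c ^ 4))).const_mul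
        (4 * |l| ^ 3)).add (h1.const_mul ((l ^ 2 * κ ^ 2 / 2) ^ 2))
      simpa using h3.const_mul T
    refine h2.congr' ?_
    filter_upwards [eventually_gt_atTop 0] with K hK
    have hK' : (0 : ℝ) < K := by exact_mod_cast hK
    have h4 : √(2 * (κ ^ 2 * (T / K)) ^ 2 + 256 * (c ^ 2 * (T / K)) ^ 2) =
        √(2 * κ ^ 4 + 256 * c ^ 4) * (T / K) := by
      rw [show 2 * (κ ^ 2 * (T / K)) ^ 2 + 256 * (c ^ 2 * (T / K)) ^ 2 =
        (2 * κ ^ 4 + 256 * c ^ 4) * (T / K) ^ 2 by ring, Real.sqrt_mul (by positivity),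
        Real.sqrt_sq (by positivity)]
    simp only [hG, h4]
    field_simp
  have hmain (K : ℕ) (hK : 0 < K) : ∃ e : ℕ → ℝ, Tendsto e atTop (nhds (K * G (T / K))) ∧
      ∀ n, ‖χ n s t - (Real.exp (-(l ^ 2 * (κ ^ 2 * T) / 2)) : ℝ)‖ ≤ e n := by
    have hK' : (0 : ℝ) < K := by exact_mod_cast hK
    set v : ℕ → ℝ := fun k => s + k * (T / K) with hv
    have hvmono : Monotone v := fun i j hij => by simp only [hv]; gcongr
    have hv0 : v 0 = s := by simp [hv]
    have hvK : v K = t := by simp only [hv, hT]; field_simp; ring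
    have hvsub (k : ℕ) : v (k + 1) - v k = T / K := by simp only [hv]; push_cast; ring
    have hvlt (k : ℕ) : v k < v (k + 1) := sub_pos.1 (by rw [hvsub]; positivity)
    have hvnn (k : ℕ) : 0 ≤ v k := by simp only [hv]; positivity
    have h1 := hF.tendsto_integral_exp_sub_prod hh hc hhc (r := Fin.elim0) (fun i => i.elim0)
      Fin.elim0 hvmono (hv0 ▸ hs) (fun _ => l) K
    simp only [Finset.univ_eq_empty, Finset.sum_empty, zero_add, ← Finset.mul_sum,
      sum_blockSum F h _ hvmono, hv0, hvK, Complex.ofReal_zero, zero_mul, Complex.exp_zero,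
      integral_const, probReal_univ, one_smul, one_mul] at h1
    refine ⟨fun n => ‖χ n s t - ∏ k ∈ Finset.range K, χ n (v k) (v (k + 1))‖ +
      ∑ k ∈ Finset.range K, b n (v k) (v (k + 1)), ?_, fun n => ?_⟩
    · have h2 : Tendsto (fun n => ∑ k ∈ Finset.range K, b n (v k) (v (k + 1))) atTop
          (nhds (∑ k ∈ Finset.range K, G (T / K))) := by
        refine tendsto_finsetSum _ fun k _ => ?_
        rw [← hvsub k]
        exact hbG (hvnn k) (hvlt k)
      have h3 := h1.norm.add h2
      simpa only [norm_zero, zero_add, Finset.sum_const, Finset.card_range, nsmul_eq_mul] using h3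
    · refine (norm_sub_le_norm_sub_add_norm_sub _
        (∏ k ∈ Finset.range K, χ n (v k) (v (k + 1))) _).trans (add_le_add le_rfl ?_)
      have h2 : ((Real.exp (-(l ^ 2 * (κ ^ 2 * T) / 2)) : ℝ) : ℂ) =
          ∏ k ∈ Finset.range K, ((Real.exp (-(l ^ 2 * (κ ^ 2 * (T / K)) / 2)) : ℝ) : ℂ) := by
        rw [Finset.prod_const, Finset.card_range, ← Complex.ofReal_pow, ← Real.exp_nat_mul]
        congr 2
        field_simp
      rw [h2]
      refine (norm_prod_sub_prod_le_sum _ (fun k => norm_integral_exp_mul_I_le _) fun k => ?_).trans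
        (Finset.sum_le_sum fun k _ => ?_)
      · rw [Complex.norm_real, Real.norm_eq_abs, Real.abs_exp, Real.exp_le_one_iff, neg_nonpos]
        positivity
      · rw [← hvsub k]
        exact hχb n (hvlt k).le
  refine Metric.tendsto_nhds.2 fun ε hε => ?_
  obtain ⟨K, hKε, hK⟩ := ((hKG.eventually_lt_const hε).and (eventually_gt_atTop 0)).exists
  obtain ⟨e, he, hχe⟩ := hmain K hK
  filter_upwards [he.eventually_lt_const hKε] with n hn
  rw [dist_eq_norm]
  exact (hχe n).trans_lt hn

/-- Convergence of the joint characteristic functions in the invariance principle. -/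
lemma tendsto_integral_exp_joint (hF : IsHeatGaussian P F) (hh : ∀ j, SmoothPolyGrowth (h j))
    (h0 : ∀ j, ∫ x, h j x ∂(gaussianReal 0 1) = 0) (hc : 0 ≤ c)
    (hhc : ∀ j, ∫ x, deriv (h j) x ^ 4 ∂(gaussianReal 0 1) ≤ c ^ 4)
    (hvar : ∀ s t : ℝ, 0 ≤ s → s < t →
      Tendsto (fun n : ℕ => ∫ ω, blockSum F h n s t ω ^ 2 ∂P) atTop (nhds (κ ^ 2 * (t - s))))
    {ℓ d : ℕ} {r : Fin ℓ → ℝ} (hr : ∀ i, 0 ≤ r i) {u : Fin (d + 1) → ℝ} (hu : 0 ≤ u 0)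
    (humono : StrictMono u) (m : Fin ℓ → ℝ) (l : Fin d → ℝ) :
    Tendsto (fun n : ℕ => ∫ ω, Complex.exp ((∑ i, m i * F (r i) ω +
        ∑ k, l k * blockSum F h n (u k.castSucc) (u k.succ) ω : ℝ) * Complex.I) ∂P) atTop
      (nhds ((∫ ω, Complex.exp ((∑ i, m i * F (r i) ω : ℝ) * Complex.I) ∂P) *
        ∏ k, ((Real.exp (-(l k ^ 2 * (κ ^ 2 * (u k.succ - u k.castSucc)) / 2)) : ℝ) : ℂ))) := by
  set v : ℕ → ℝ := fun k => u ⟨min k d, by lia⟩ with hv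
  have hvmono : Monotone v := fun i j hij => humono.monotone (by simp only [Fin.mk_le_mk]; lia)
  have hv0 : v 0 = u 0 := by simp only [hv]; simp
  have hvc (k : Fin d) : v k = u k.castSucc := by
    simp only [hv]; congr 1; ext; simp
  have hvs (k : Fin d) : v (k + 1) = u k.succ := by
    simp only [hv]; congr 1; ext; simp
  set l' : ℕ → ℝ := fun k => if hk : k < d then l ⟨k, hk⟩ else 0 with hl'
  have hll (k : Fin d) : l' k = l k := by simp [hl']
  have h1 := hF.tendsto_integral_exp_sub_prod hh hc hhc hr m hvmono (hv0 ▸ hu) l' d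
  simp only [← Fin.sum_univ_eq_sum_range (fun k => l' k * blockSum F h _ (v k) (v (k + 1)) _) d,
    ← Fin.prod_univ_eq_prod_range (fun k => ∫ ω, Complex.exp ((l' k *
      blockSum F h _ (v k) (v (k + 1)) ω : ℝ) * Complex.I) ∂P) d, hvc, hvs, hll] at h1
  have h2 := (tendsto_finsetProd Finset.univ fun (k : Fin d) _ =>
    hF.tendsto_integral_exp_blockSum hh h0 hc hhc hvar (l k) (s := u k.castSucc) (t := u k.succ)
      (hu.trans (humono.monotone (Fin.zero_le _))) (humono k.castSucc_lt_succ)).const_mul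
    (∫ ω, Complex.exp ((∑ i, m i * F (r i) ω : ℝ) * Complex.I) ∂P)
  simpa using h1.add h2

end IsHeatGaussian

/-- Lévy's continuity theorem on a product of two spaces `ℝ^α × ℝ^β`. -/
lemma tendsto_integral_of_tendsto_integral_exp {α β : Type*} [Fintype α] [Fintype β]
    {μ : ℕ → Measure ((α → ℝ) × (β → ℝ))} [∀ n, IsProbabilityMeasure (μ n)]
    {μ₀ : Measure ((α → ℝ) × (β → ℝ))} [IsProbabilityMeasure μ₀]
    (H : ∀ (m : α → ℝ) (l : β → ℝ), Tendsto (fun n => ∫ x, Complex.exp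
      ((∑ i, m i * x.1 i + ∑ k, l k * x.2 k : ℝ) * Complex.I) ∂(μ n)) atTop
      (nhds (∫ x, Complex.exp ((∑ i, m i * x.1 i + ∑ k, l k * x.2 k : ℝ) * Complex.I) ∂μ₀)))
    (g : BoundedContinuousFunction ((α → ℝ) × (β → ℝ)) ℝ) :
    Tendsto (fun n => ∫ x, g x ∂(μ n)) atTop (nhds (∫ x, g x ∂μ₀)) := by
  let e : (α → ℝ) × (β → ℝ) → EuclideanSpace ℝ (α ⊕ β) := fun x => WithLp.toLp 2 (Sum.elim x.1 x.2)
  let e' : C(EuclideanSpace ℝ (α ⊕ β), (α → ℝ) × (β → ℝ)) :=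
    ⟨fun y => (fun i => y (Sum.inl i), fun k => y (Sum.inr k)), by fun_prop⟩
  have he : Continuous e := by
    refine (PiLp.continuous_toLp 2 _).comp (continuous_pi fun i => ?_)
    cases i <;> simp only [Sum.elim_inl, Sum.elim_inr] <;> fun_prop
  have hee (x) : e' (e x) = x := rfl
  have hchar (ρ : Measure ((α → ℝ) × (β → ℝ))) (t : EuclideanSpace ℝ (α ⊕ β)) :
      charFun (ρ.map e) t = ∫ x, Complex.exp ((∑ i, t (Sum.inl i) * x.1 i +
        ∑ k, t (Sum.inr k) * x.2 k : ℝ) * Complex.I) ∂ρ := by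
    rw [charFun_apply, integral_map he.aemeasurable (by fun_prop)]
    simp [e, PiLp.inner_apply]
  let ν (n : ℕ) : ProbabilityMeasure (EuclideanSpace ℝ (α ⊕ β)) :=
    ⟨(μ n).map e, Measure.isProbabilityMeasure_map he.aemeasurable⟩
  let ν₀ : ProbabilityMeasure (EuclideanSpace ℝ (α ⊕ β)) :=
    ⟨μ₀.map e, Measure.isProbabilityMeasure_map he.aemeasurable⟩
  have hν : Tendsto ν atTop (nhds ν₀) := by
    refine ProbabilityMeasure.tendsto_iff_tendsto_charFun.2 fun t => ?_
    simp only [ν, ν₀, ProbabilityMeasure.coe_mk, hchar]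
    exact H _ _
  have hg := (ProbabilityMeasure.tendsto_iff_forall_integral_tendsto.1 hν) (g.compContinuous e')
  have hint (ρ : Measure ((α → ℝ) × (β → ℝ))) :
      ∫ y, g.compContinuous e' y ∂(ρ.map e) = ∫ x, g x ∂ρ :=
    integral_map he.aemeasurable (g.compContinuous e').continuous.aestronglyMeasurable
  simpa only [ν, ν₀, ProbabilityMeasure.coe_mk, hint] using hg

/-- The characteristic function of the product of a law and centered Gaussian laws. -/
lemma integral_exp_prod_pi_gaussianReal {α β : Type*} [Fintype α] [Fintype β]
    (μ : Measure (α → ℝ)) [IsProbabilityMeasure μ] {v : β → ℝ} (hv : ∀ k, 0 ≤ v k)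
    (m : α → ℝ) (l : β → ℝ) :
    ∫ x, Complex.exp ((∑ i, m i * x.1 i + ∑ k, l k * x.2 k : ℝ) * Complex.I)
        ∂(μ.prod (Measure.pi fun k => gaussianReal 0 (v k).toNNReal)) =
      (∫ x, Complex.exp ((∑ i, m i * x i : ℝ) * Complex.I) ∂μ) *
        ∏ k, ((Real.exp (-(l k ^ 2 * v k / 2)) : ℝ) : ℂ) := by
  have h1 (k : β) : ∫ y, Complex.exp ((l k * y : ℝ) * Complex.I) ∂(gaussianReal 0 (v k).toNNReal) =
      ((Real.exp (-(l k ^ 2 * v k / 2)) : ℝ) : ℂ) := by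
    have := charFun_gaussianReal (μ := 0) (v := (v k).toNNReal) (l k)
    rw [charFun_apply_real] at this
    push_cast
    rw [this, show (((v k).toNNReal : ℝ) : ℂ) = v k by rw [Real.coe_toNNReal _ (hv k)]]
    congr 1
    push_cast
    ring
  simp only [← h1]
  rw [← integral_fintype_prod_eq_prod, ← integral_prod_mul]
  refine integral_congr_ae (ae_of_all _ fun x => ?_)
  simp only [← Complex.exp_sum, ← Complex.exp_add, Complex.ofReal_add, Complex.ofReal_sum,
    Finset.sum_mul, add_mul]

/-- Theorem 3.8 (finite-dimensional form): if the variances of the increments of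
`B_n` converge to `κ²(t−s)`, then the joint law of
`(F(r_1),…,F(r_ℓ), B_n(u_1)−B_n(u_0),…,B_n(u_d)−B_n(u_{d−1}))` converges weakly
to the product of the law of `(F(r_1),…,F(r_ℓ))` and the product of centered
Gaussian laws with variances `κ²(u_k − u_{k−1})`. -/
theorem Bproc_invariance_principle {Ω : Type*} [MeasurableSpace Ω]
    (P : Measure Ω) (F : ℝ → Ω → ℝ) (hF : IsHeatGaussian P F)
    (h : ℕ → ℝ → ℝ) (L : ℝ) (hL : 0 ≤ L) (hA : Assumption31 h L)
    (κ : ℝ) (hκ : 0 ≤ κ)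
    (hvar : ∀ s t : ℝ, 0 ≤ s → s < t →
      Tendsto (fun n : ℕ => ∫ ω, (Bproc P F h n t ω - Bproc P F h n s ω) ^ 2 ∂P)
        atTop (nhds (κ ^ 2 * (t - s))))
    (ℓ d : ℕ) (r : Fin ℓ → ℝ) (hr : ∀ i, 0 ≤ r i) (hrmono : StrictMono r)
    (u : Fin (d + 1) → ℝ) (hu : 0 ≤ u 0) (humono : StrictMono u) :
    ∀ g : BoundedContinuousFunction ((Fin ℓ → ℝ) × (Fin d → ℝ)) ℝ,
      Tendsto
        (fun n : ℕ => ∫ ω, g (fun i => F (r i) ω,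
            fun k => Bproc P F h n (u k.succ) ω - Bproc P F h n (u k.castSucc) ω) ∂P)
        atTop
        (nhds (∫ x, g x ∂((Measure.map (fun ω (i : Fin ℓ) => F (r i) ω) P).prod
          (Measure.pi fun k : Fin d =>
            gaussianReal 0 (Real.toNNReal (κ ^ 2 * (u k.succ - u k.castSucc))))))) := by
  have := hF.1
  obtain ⟨hh, c, hc, hhc⟩ := hA.exists_deriv_bound
  have hB (n : ℕ) (ω : Ω) (k : Fin d) :
      Bproc P F h n (u k.succ) ω - Bproc P F h n (u k.castSucc) ω =
        blockSum F h n (u k.castSucc) (u k.succ) ω :=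
    hF.Bproc_sub_eq_blockSum h n (humono.monotone k.castSucc_lt_succ.le) ω
  have hvar' (s t : ℝ) (hs : 0 ≤ s) (hst : s < t) :
      Tendsto (fun n : ℕ => ∫ ω, blockSum F h n s t ω ^ 2 ∂P) atTop
        (nhds (κ ^ 2 * (t - s))) := by
    simpa only [hF.Bproc_sub_eq_blockSum h _ hst.le] using hvar s t hs hst
  have hFm : Measurable fun ω (i : Fin ℓ) => F (r i) ω := measurable_pi_lambda _ fun i => hF.2.1 _
  have hXm (n : ℕ) : Measurable fun ω => ((fun i : Fin ℓ => F (r i) ω),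
      fun k : Fin d => blockSum F h n (u k.castSucc) (u k.succ) ω) :=
    hFm.prodMk (measurable_pi_lambda _ fun k => hF.measurable_blockSum hh n _ _)
  have := Measure.isProbabilityMeasure_map (μ := P) hFm.aemeasurable
  have (n : ℕ) := Measure.isProbabilityMeasure_map (μ := P) (hXm n).aemeasurable
  intro g
  simp only [hB]
  have h1 := tendsto_integral_of_tendsto_integral_exp (fun m l => ?_) g
    (μ := fun n => P.map fun ω => ((fun i : Fin ℓ => F (r i) ω),
      fun k : Fin d => blockSum F h n (u k.castSucc) (u k.succ) ω))
    (μ₀ := (Measure.map (fun ω (i : Fin ℓ) => F (r i) ω) P).prod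
      (Measure.pi fun k : Fin d =>
        gaussianReal 0 (Real.toNNReal (κ ^ 2 * (u k.succ - u k.castSucc)))))
  · refine h1.congr fun n => ?_
    exact integral_map (hXm n).aemeasurable g.continuous.aestronglyMeasurable
  · rw [integral_exp_prod_pi_gaussianReal _ (fun k => mul_nonneg (sq_nonneg κ)
      (sub_nonneg.2 (humono.monotone k.castSucc_lt_succ.le))),
      integral_map hFm.aemeasurable (Continuous.aestronglyMeasurable (by fun_prop))]
    refine (hF.tendsto_integral_exp_joint hh hA.2.2.2.2.1 hc hhc hvar' hr hu humono m l).congr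
      fun n => ?_
    rw [integral_map (hXm n).aemeasurable (Continuous.aestronglyMeasurable (by fun_prop))]
end

section
/- Let F be the centered Gaussian process with covariance E[F(s)F(t)] = (2π)^{-1/2}(√(t+s) − √|t−s|). For every L ≥ 0 there exists a finite constant C, depending only on L, such that whenever {h_j} and L satisfy the deterministic form of Assumption 3.1 and B_n(t) = ∑_{j=1}^{⌊nt⌋} σ_j² h_j(σ_j^{-1} ΔF_j), then E|B_n(t) − B_n(s)|⁴ ≤ C ((⌊nt⌋ − ⌊ns⌋)/n)² for all 0 ≤ s < t and all integers n ≥ 1. -/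
open MeasureTheory ProbabilityTheory Filter

/-- The fourth moment of the standard Gaussian distribution. -/
noncomputable def gaussianFourthMoment : ℝ := ∫ x, x ^ 4 ∂(gaussianReal 0 1)

lemma gaussianFourthMoment_nonneg : 0 ≤ gaussianFourthMoment :=
  integral_nonneg fun x => by positivity

lemma enorm_pow_four (x : ℝ) : ‖x‖ₑ ^ 4 = ENNReal.ofReal (x ^ 4) := by
  rw [Real.enorm_eq_ofReal_abs, ← ENNReal.ofReal_pow (abs_nonneg x), ← abs_pow,
    abs_of_nonneg (by positivity)]

lemma integrable_pow_gaussianReal (k : ℕ) (v : NNReal) :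
    Integrable (fun x : ℝ => x ^ k) (gaussianReal 0 v) := by
  have h := (memLp_id_gaussianReal (μ := 0) (v := v) k).integrable_norm_pow'
  refine (integrable_norm_iff (by fun_prop)).1 ?_
  simpa using h

lemma lintegral_pow_four_gaussianReal (v : NNReal) :
    ∫⁻ x, ‖x‖ₑ ^ 4 ∂(gaussianReal 0 v) =
      ENNReal.ofReal (gaussianFourthMoment * (v : ℝ) ^ 2) := by
  have hv : gaussianReal 0 v = (gaussianReal 0 1).map (fun x => Real.sqrt v * x) := by
    rw [gaussianReal_map_const_mul]
    congr 1
    · simp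
    · ext; simp
  simp_rw [enorm_pow_four]
  rw [← ofReal_integral_eq_lintegral_ofReal (integrable_pow_gaussianReal 4 v)
    (ae_of_all _ fun x => by positivity)]
  rw [hv, integral_map (by fun_prop) (by fun_prop), gaussianFourthMoment, ← integral_mul_const]
  congr 2
  ext x
  have : Real.sqrt v ^ 2 = v := Real.sq_sqrt v.2
  rw [mul_pow, show Real.sqrt v ^ 4 = (Real.sqrt v ^ 2) ^ 2 by ring, this]; ring

lemma enorm_integral_pow_four_le {α : Type*} [MeasurableSpace α] (ν : Measure α)
    [IsFiniteMeasure ν] (u : α → ℝ) (hu : AEStronglyMeasurable u ν) :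
    ‖∫ a, u a ∂ν‖ₑ ^ 4 ≤ ν Set.univ ^ 3 * ∫⁻ a, ‖u a‖ₑ ^ 4 ∂ν := by
  have h1 := ENNReal.lintegral_mul_le_Lp_mul_Lq ν
    (p := 4) (q := 4 / 3) (by constructor <;> norm_num) hu.enorm
    (aemeasurable_const (b := (1 : ENNReal)))
  have h2 : ∫⁻ a, ‖u a‖ₑ ∂ν ≤
      (∫⁻ a, ‖u a‖ₑ ^ (4 : ℝ) ∂ν) ^ (1 / 4 : ℝ) * ν Set.univ ^ (3 / 4 : ℝ) := by
    simpa using h1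
  calc ‖∫ a, u a ∂ν‖ₑ ^ 4
      ≤ ((∫⁻ a, ‖u a‖ₑ ^ (4 : ℝ) ∂ν) ^ (1 / 4 : ℝ) * ν Set.univ ^ (3 / 4 : ℝ)) ^ 4 := by
        gcongr
        exact (enorm_integral_le_lintegral_enorm u).trans h2
    _ = ν Set.univ ^ 3 * ∫⁻ a, ‖u a‖ₑ ^ 4 ∂ν := by
        rw [mul_pow, ← ENNReal.rpow_mul_natCast, ← ENNReal.rpow_mul_natCast, mul_comm]
        norm_num

/-- The fundamental theorem of calculus for `f` along the arc of a rotation from `p.1` to `p.2`. -/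
lemma sub_eq_integral_fderiv_rotation {E : Type*} [NormedAddCommGroup E] [NormedSpace ℝ E]
    {f : E → ℝ} (hf : ContDiff ℝ 1 f) (p : E × E) :
    f p.2 - f p.1 = ∫ θ in (0)..(Real.pi / 2),
      fderiv ℝ f (ContinuousLinearMap.rotation θ p).1 (ContinuousLinearMap.rotation θ p).2 := by
  have hd : ∀ θ : ℝ, HasDerivAt (fun θ => f (ContinuousLinearMap.rotation θ p).1)
      (fderiv ℝ f (ContinuousLinearMap.rotation θ p).1 (ContinuousLinearMap.rotation θ p).2) θ := by
    intro θ
    have h1 : HasDerivAt (fun θ : ℝ => (ContinuousLinearMap.rotation θ p).1)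
        (ContinuousLinearMap.rotation θ p).2 θ := by
      simp only [ContinuousLinearMap.rotation_apply]
      exact ((Real.hasDerivAt_cos θ).smul_const p.1).add ((Real.hasDerivAt_sin θ).smul_const p.2)
    exact ((hf.differentiable (by norm_num)) _).hasFDerivAt.comp_hasDerivAt θ h1
  rw [intervalIntegral.integral_eq_sub_of_hasDerivAt (fun θ _ => hd θ)]
  · simp [ContinuousLinearMap.rotation_apply]
  · apply Continuous.intervalIntegrable
    have := hf.continuous_fderiv (by norm_num)
    simp only [ContinuousLinearMap.rotation_apply]
    fun_prop

/-- The `L⁴` Poincaré inequality for a centered Gaussian measure, by the rotation argument of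
Maurey and Pisier. -/
theorem lintegral_pow_four_le_fderiv {E : Type*} [NormedAddCommGroup E] [NormedSpace ℝ E]
    [MeasurableSpace E] [BorelSpace E] [SecondCountableTopology E] [CompleteSpace E] (μ : Measure E) [IsGaussian μ]
    (hμ : ∀ l : StrongDual ℝ E, ∫ x, l x ∂μ = 0) {f : E → ℝ} (hf : ContDiff ℝ 1 f)
    (hfi : Integrable f μ) (hf0 : ∫ x, f x ∂μ = 0) :
    ∫⁻ x, ‖f x‖ₑ ^ 4 ∂μ ≤
      ENNReal.ofReal ((Real.pi / 2) ^ 4) * ∫⁻ x, ∫⁻ y, ‖fderiv ℝ f x y‖ₑ ^ 4 ∂μ ∂μ := by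
  have hfc := hf.continuous
  have hdc := hf.continuous_fderiv (by norm_num)
  have hπ : (0 : ℝ) ≤ Real.pi / 2 := by positivity
  have hG : Measurable fun p : E × E => ‖fderiv ℝ f p.1 p.2‖ₑ ^ 4 := by
    have : Continuous fun p : E × E => fderiv ℝ f p.1 p.2 := by fun_prop
    exact this.measurable.enorm.pow_const 4
  have hGrot : Measurable fun q : (E × E) × ℝ => ‖fderiv ℝ f
      (ContinuousLinearMap.rotation q.2 q.1).1 (ContinuousLinearMap.rotation q.2 q.1).2‖ₑ ^ 4 := by
    have : Continuous fun q : (E × E) × ℝ => fderiv ℝ f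
        (ContinuousLinearMap.rotation q.2 q.1).1 (ContinuousLinearMap.rotation q.2 q.1).2 := by
      simp only [ContinuousLinearMap.rotation_apply]
      fun_prop
    exact this.measurable.enorm.pow_const 4
  have hpt : ∀ p : E × E, ‖f p.2 - f p.1‖ₑ ^ 4 ≤ ENNReal.ofReal (Real.pi / 2) ^ 3 *
      ∫⁻ θ in Set.Ioc 0 (Real.pi / 2), ‖fderiv ℝ f (ContinuousLinearMap.rotation θ p).1
        (ContinuousLinearMap.rotation θ p).2‖ₑ ^ 4 := by
    intro p
    rw [sub_eq_integral_fderiv_rotation hf p, intervalIntegral.integral_of_le hπ]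
    refine (enorm_integral_pow_four_le _ _ ?_).trans (le_of_eq ?_)
    · apply Continuous.aestronglyMeasurable
      simp only [ContinuousLinearMap.rotation_apply]
      fun_prop
    · simp
  calc ∫⁻ x, ‖f x‖ₑ ^ 4 ∂μ
      ≤ ∫⁻ x, ∫⁻ y, ‖f y - f x‖ₑ ^ 4 ∂μ ∂μ := by
        refine lintegral_mono fun x => ?_
        have h : ∫ y, (f y - f x) ∂μ = - f x := by
          rw [integral_sub hfi (integrable_const _), hf0]; simp
        have h' := enorm_integral_pow_four_le μ (fun y => f y - f x) (by fun_prop)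
        rw [h] at h'
        simpa using h'
    _ = ∫⁻ p, ‖f p.2 - f p.1‖ₑ ^ 4 ∂(μ.prod μ) := by
        rw [lintegral_prod]
        have : Continuous fun p : E × E => f p.2 - f p.1 := by fun_prop
        exact (this.measurable.enorm.pow_const 4).aemeasurable
    _ ≤ ∫⁻ p, (ENNReal.ofReal (Real.pi / 2) ^ 3 * ∫⁻ θ in Set.Ioc 0 (Real.pi / 2),
          ‖fderiv ℝ f (ContinuousLinearMap.rotation θ p).1
            (ContinuousLinearMap.rotation θ p).2‖ₑ ^ 4) ∂(μ.prod μ) := lintegral_mono hpt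
    _ = ENNReal.ofReal (Real.pi / 2) ^ 3 * ∫⁻ θ in Set.Ioc 0 (Real.pi / 2), ∫⁻ p,
          ‖fderiv ℝ f (ContinuousLinearMap.rotation θ p).1
            (ContinuousLinearMap.rotation θ p).2‖ₑ ^ 4 ∂(μ.prod μ) := by
        rw [lintegral_const_mul' _ _ (by simp), lintegral_lintegral_swap hGrot.aemeasurable]
    _ = ENNReal.ofReal (Real.pi / 2) ^ 3 * ∫⁻ θ in Set.Ioc 0 (Real.pi / 2), ∫⁻ p,
          ‖fderiv ℝ f p.1 p.2‖ₑ ^ 4 ∂(μ.prod μ) := by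
        congr 1
        refine lintegral_congr fun θ => ?_
        conv_rhs =>
          rw [← IsGaussian.map_rotation_eq_self_of_forall_strongDual_eq_zero hμ θ]
        rw [lintegral_map hG (by fun_prop)]
    _ = ENNReal.ofReal ((Real.pi / 2) ^ 4) * ∫⁻ x, ∫⁻ y, ‖fderiv ℝ f x y‖ₑ ^ 4 ∂μ ∂μ := by
        rw [lintegral_prod _ hG.aemeasurable, lintegral_const, ENNReal.ofReal_pow hπ]
        simp only [Measure.restrict_apply_univ, Real.volume_Ioc, sub_zero]
        ring

lemma eq_sum_mul_single {ι : Type*} [Fintype ι] [DecidableEq ι] (l : StrongDual ℝ (ι → ℝ)) :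
    (l : (ι → ℝ) → ℝ) = fun x => ∑ i, l (Pi.single i 1) * x i := by
  ext x
  conv_lhs => rw [← Finset.univ_sum_single x]
  rw [map_sum]
  refine Finset.sum_congr rfl fun i _ => ?_
  have h : (Pi.single i (x i) : ι → ℝ) = x i • Pi.single i 1 := by rw [← Pi.single_smul]; simp
  rw [h, map_smul, smul_eq_mul, mul_comm]

/-- A fourth moment bound for a centered sum of functions of the coordinates of a Gaussian vector,
in terms of the row sums of its covariance matrix. -/
theorem lintegral_sum_pow_four_le {ι : Type*} [Fintype ι] (μ : Measure (ι → ℝ))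
    (c : ι → ι → ℝ) (hc : ∀ i j, c i j = c j i)
    (hμ : ∀ b : ι → ℝ, μ.map (fun x => ∑ i, b i * x i) =
      gaussianReal 0 (Real.toNNReal (∑ i, ∑ j, b i * b j * c i j)))
    {R : ℝ} (hR : 0 ≤ R) (hrow : ∀ i, ∑ j, |c i j| ≤ R)
    {g : ι → ℝ → ℝ} (hg : ∀ i, ContDiff ℝ 1 (g i)) {A : ℝ}
    (hg' : ∀ i x, deriv (g i) x ^ 2 ≤ A * (R + x ^ 2))
    (hgi : ∀ i, Integrable (fun x : ι → ℝ => g i (x i)) μ)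
    (hg0 : ∀ i, ∫ x, g i (x i) ∂μ = 0) :
    ∫⁻ x, ‖∑ i, g i (x i)‖ₑ ^ 4 ∂μ ≤ ENNReal.ofReal ((Real.pi / 2) ^ 4 *
      (2 * gaussianFourthMoment * (1 + gaussianFourthMoment) * A ^ 2 * R ^ 4 *
        (Fintype.card ι : ℝ) ^ 2)) := by
  classical
  have hM := gaussianFourthMoment_nonneg
  set M := gaussianFourthMoment with hMdef
  have hG : IsGaussian μ := isGaussian_of_map_eq_gaussianReal fun l => by
    rw [eq_sum_mul_single l]
    exact ⟨_, _, hμ _⟩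
  have hcent : ∀ l : StrongDual ℝ (ι → ℝ), ∫ x, l x ∂μ = 0 := by
    intro l
    have h : ∫ y, y ∂(μ.map l) = ∫ x, l x ∂μ := integral_map (by fun_prop) (by fun_prop)
    rw [← h, eq_sum_mul_single l, hμ, integral_id_gaussianReal]
  have hmom : ∀ b : ι → ℝ, ∫⁻ y, ‖∑ i, b i * y i‖ₑ ^ 4 ∂μ = ENNReal.ofReal
      (M * (Real.toNNReal (∑ i, ∑ j, b i * b j * c i j) : ℝ) ^ 2) := by
    intro b
    rw [← lintegral_pow_four_gaussianReal, ← hμ b, lintegral_map (by fun_prop) (by fun_prop)]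
  have hcii : ∀ i, (Real.toNNReal (c i i) : ℝ) ≤ R := fun i => by
    rw [Real.coe_toNNReal']
    refine max_le ?_ hR
    exact (le_abs_self _).trans ((Finset.single_le_sum (f := fun j => |c i j|)
      (fun j _ => abs_nonneg _) (Finset.mem_univ i)).trans (hrow i))
  have hcoord : ∀ i, ∫⁻ y : ι → ℝ, ‖y i‖ₑ ^ 4 ∂μ ≤ ENNReal.ofReal (M * R ^ 2) := by
    intro i
    have h := hmom (Pi.single i 1)
    simp only [Pi.single_apply, ite_mul, one_mul, zero_mul, Finset.sum_ite_eq',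
      Finset.mem_univ, if_true] at h
    rw [h]
    gcongr
    simpa [Finset.sum_ite_eq'] using hcii i
  have hfd : ∀ x y : ι → ℝ, fderiv ℝ (fun x : ι → ℝ => ∑ i, g i (x i)) x y =
      ∑ i, deriv (g i) (x i) * y i := by
    intro x y
    have h : HasFDerivAt (fun x : ι → ℝ => ∑ i, g i (x i)) (∑ i, (deriv (g i) (x i)) •
        (ContinuousLinearMap.proj i : (ι → ℝ) →L[ℝ] ℝ)) x := by
      refine HasFDerivAt.fun_sum fun i _ => ?_
      exact (((hg i).differentiable (by norm_num) (x i)).hasDerivAt).comp_hasFDerivAt x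
        (ContinuousLinearMap.proj i : (ι → ℝ) →L[ℝ] ℝ).hasFDerivAt
    rw [h.fderiv]
    simp
  have hquad : ∀ b : ι → ℝ, (Real.toNNReal (∑ i, ∑ j, b i * b j * c i j) : ℝ) ≤
      R * ∑ i, b i ^ 2 := by
    intro b
    rw [Real.coe_toNNReal']
    refine max_le ?_ (mul_nonneg hR (Finset.sum_nonneg fun i _ => sq_nonneg _))
    have h1 : ∀ i j, b i * b j * c i j ≤ b i ^ 2 / 2 * |c i j| + b j ^ 2 / 2 * |c j i| := by
      intro i j
      rw [hc j i, ← add_mul]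
      calc b i * b j * c i j ≤ |b i * b j| * |c i j| := by
            rw [← abs_mul]; exact le_abs_self _
        _ ≤ _ := by
          gcongr
          rw [abs_mul]
          nlinarith [sq_nonneg (|b i| - |b j|), sq_abs (b i), sq_abs (b j)]
    have h2 : ∑ i, ∑ j, b i ^ 2 / 2 * |c i j| ≤ R / 2 * ∑ i, b i ^ 2 := by
      rw [Finset.mul_sum]
      refine Finset.sum_le_sum fun i _ => ?_
      rw [← Finset.mul_sum]
      nlinarith [hrow i, sq_nonneg (b i)]
    calc ∑ i, ∑ j, b i * b j * c i j
        ≤ ∑ i, ∑ j, (b i ^ 2 / 2 * |c i j| + b j ^ 2 / 2 * |c j i|) :=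
          Finset.sum_le_sum fun i _ => Finset.sum_le_sum fun j _ => h1 i j
      _ = (∑ i, ∑ j, b i ^ 2 / 2 * |c i j|) + ∑ i, ∑ j, b i ^ 2 / 2 * |c i j| := by
          simp_rw [Finset.sum_add_distrib]
          congr 1
          rw [Finset.sum_comm]
      _ ≤ R * ∑ i, b i ^ 2 := by linarith
  have hinner : ∀ x : ι → ℝ, ∫⁻ y, ‖∑ i, deriv (g i) (x i) * y i‖ₑ ^ 4 ∂μ ≤
      ∑ i, ENNReal.ofReal (2 * M * A ^ 2 * R ^ 2 * Fintype.card ι) *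
        (ENNReal.ofReal (R ^ 2) + ‖x i‖ₑ ^ 4) := by
    intro x
    rw [hmom]
    simp_rw [enorm_pow_four]
    have h1 : ∀ i, (deriv (g i) (x i) ^ 2) ^ 2 ≤ 2 * A ^ 2 * (R ^ 2 + x i ^ 4) := fun i => by
      calc (deriv (g i) (x i) ^ 2) ^ 2 ≤ (A * (R + x i ^ 2)) ^ 2 := by gcongr; exact hg' i _
        _ ≤ _ := by nlinarith [mul_nonneg (sq_nonneg A) (sq_nonneg (R - x i ^ 2))]
    have h2 : (∑ i, deriv (g i) (x i) ^ 2) ^ 2 ≤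
        Fintype.card ι * ∑ i, 2 * A ^ 2 * (R ^ 2 + x i ^ 4) := by
      refine sq_sum_le_card_mul_sum_sq.trans ?_
      rw [Finset.card_univ]
      gcongr with i
      exact h1 i
    calc _ ≤ ENNReal.ofReal (∑ i, 2 * M * A ^ 2 * R ^ 2 * Fintype.card ι * (R ^ 2 + x i ^ 4)) := by
          apply ENNReal.ofReal_le_ofReal
          calc _ ≤ M * (R * ∑ i, deriv (g i) (x i) ^ 2) ^ 2 := by
                gcongr
                exact hquad _
            _ = M * R ^ 2 * (∑ i, deriv (g i) (x i) ^ 2) ^ 2 := by ring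
            _ ≤ M * R ^ 2 * (Fintype.card ι * ∑ i, 2 * A ^ 2 * (R ^ 2 + x i ^ 4)) := by gcongr
            _ = _ := by
              simp_rw [Finset.mul_sum]
              exact Finset.sum_congr rfl fun i _ => by ring
      _ = _ := by
          rw [ENNReal.ofReal_sum_of_nonneg fun i _ => by positivity]
          refine Finset.sum_congr rfl fun i _ => ?_
          rw [ENNReal.ofReal_mul (by positivity), ENNReal.ofReal_add (by positivity)
            (by positivity)]
  have hmp := lintegral_pow_four_le_fderiv μ hcent (f := fun x : ι → ℝ => ∑ i, g i (x i))
    (ContDiff.sum fun i _ => (hg i).comp (contDiff_apply ℝ ℝ i))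
    (integrable_finsetSum _ fun i _ => hgi i)
    (by rw [integral_finsetSum _ fun i _ => hgi i]; simp [hg0])
  simp_rw [hfd] at hmp
  refine hmp.trans ?_
  rw [ENNReal.ofReal_mul (by positivity)]
  gcongr
  calc ∫⁻ x, ∫⁻ y, ‖∑ i, deriv (g i) (x i) * y i‖ₑ ^ 4 ∂μ ∂μ
      ≤ ∫⁻ x, ∑ i, ENNReal.ofReal (2 * M * A ^ 2 * R ^ 2 * Fintype.card ι) *
        (ENNReal.ofReal (R ^ 2) + ‖x i‖ₑ ^ 4) ∂μ := lintegral_mono hinner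
    _ = ∑ i, ENNReal.ofReal (2 * M * A ^ 2 * R ^ 2 * Fintype.card ι) *
        (ENNReal.ofReal (R ^ 2) + ∫⁻ x, ‖x i‖ₑ ^ 4 ∂μ) := by
        rw [lintegral_finsetSum _ (by fun_prop)]
        refine Finset.sum_congr rfl fun i _ => ?_
        rw [lintegral_const_mul _ (by fun_prop), lintegral_add_left measurable_const]
        simp
    _ ≤ ∑ i : ι, ENNReal.ofReal (2 * M * A ^ 2 * R ^ 2 * Fintype.card ι) *
        (ENNReal.ofReal (R ^ 2) + ENNReal.ofReal (M * R ^ 2)) := by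
        gcongr with i
        exact hcoord i
    _ = ENNReal.ofReal (2 * M * (1 + M) * A ^ 2 * R ^ 4 * (Fintype.card ι : ℝ) ^ 2) := by
        rw [← ENNReal.ofReal_add (by positivity) (by positivity),
          ← ENNReal.ofReal_mul (by positivity), Finset.sum_const, Finset.card_univ,
          nsmul_eq_mul, ← ENNReal.ofReal_natCast, ← ENNReal.ofReal_mul (by positivity)]
        congr 1
        ring

/-- The covariance of the increments of the process over `[(i-1)/n, i/n]` and `[(j-1)/n, j/n]`. -/
noncomputable def incrCov (n i j : ℝ) : ℝ :=
  covK (i / n) (j / n) - covK (i / n) ((j - 1) / n) - covK ((i - 1) / n) (j / n) +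
    covK ((i - 1) / n) ((j - 1) / n)

lemma incrCov_comm (n i j : ℝ) : incrCov n i j = incrCov n j i := by
  simp only [incrCov, covK_comm (j / n), covK_comm ((j - 1) / n)]
  ring

lemma covK_div {n : ℝ} (hn : 0 < n) (i j : ℝ) :
    covK (i / n) (j / n) = (Real.sqrt (2 * Real.pi))⁻¹ * (Real.sqrt n)⁻¹ *
      (Real.sqrt (j + i) - Real.sqrt |j - i|) := by
  rw [covK, ← add_div, ← sub_div, abs_div, abs_of_pos hn, Real.sqrt_div' _ hn.le,
    Real.sqrt_div' _ hn.le]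
  ring

/-- The second difference of `(i, j) ↦ √(j + i) - √|j - i|`. -/
noncomputable def sqrtSecondDiff (i j : ℝ) : ℝ :=
  (Real.sqrt (j + i) - Real.sqrt |j - i|) - (Real.sqrt (j - 1 + i) - Real.sqrt |j - 1 - i|) -
    (Real.sqrt (j + (i - 1)) - Real.sqrt |j - (i - 1)|) +
    (Real.sqrt (j - 1 + (i - 1)) - Real.sqrt |j - 1 - (i - 1)|)

lemma incrCov_eq {n : ℝ} (hn : 0 < n) (i j : ℝ) :
    incrCov n i j = (Real.sqrt (2 * Real.pi))⁻¹ * (Real.sqrt n)⁻¹ * sqrtSecondDiff i j := by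
  simp only [incrCov, covK_div hn, sqrtSecondDiff]
  ring

/-- Midpoint concavity of the square root. -/
lemma sqrt_add_sqrt_le_s2 {x : ℝ} (hx : 1 ≤ x) :
    Real.sqrt (x + 1) + Real.sqrt (x - 1) ≤ 2 * Real.sqrt x := by
  have h1 := Real.sq_sqrt (show 0 ≤ x + 1 by linarith)
  have h2 := Real.sq_sqrt (show 0 ≤ x - 1 by linarith)
  refine abs_le_of_sq_le_sq' ?_ (by positivity) |>.2
  rw [mul_pow, Real.sq_sqrt (by linarith)]
  nlinarith [sq_nonneg (Real.sqrt (x + 1) - Real.sqrt (x - 1))]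

lemma sqrt_sub_sqrt_le_one {x y : ℝ} (h : x ≤ y + 1) (hy : 0 ≤ y) :
    Real.sqrt x - Real.sqrt y ≤ 1 := by
  have h1 : Real.sqrt x ≤ Real.sqrt y + 1 := by
    refine Real.sqrt_le_iff.2 ⟨by positivity, ?_⟩
    nlinarith [Real.sq_sqrt hy, Real.sqrt_nonneg y]
  linarith

lemma abs_sqrt_sub_sqrt_le_one {x y : ℝ} (hx : 0 ≤ x) (hy : 0 ≤ y) (h : |x - y| ≤ 1) :
    |Real.sqrt x - Real.sqrt y| ≤ 1 := by
  rw [abs_le] at *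
  have := sqrt_sub_sqrt_le_one (x := x) (y := y) (by linarith) hy
  have := sqrt_sub_sqrt_le_one (x := y) (y := x) (by linarith) hx
  constructor <;> linarith

lemma sqrtSecondDiff_nonpos {i j : ℕ} (hi : 1 ≤ i) (hj : 1 ≤ j) (hij : i ≠ j) :
    sqrtSecondDiff i j ≤ 0 := by
  have hi' : (1 : ℝ) ≤ i := by exact_mod_cast hi
  have hj' : (1 : ℝ) ≤ j := by exact_mod_cast hj
  have h1 := sqrt_add_sqrt_le_s2 (x := (j : ℝ) + i - 1) (by linarith)
  rw [sqrtSecondDiff]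
  rw [show (j : ℝ) - 1 - (i - 1) = j - i by ring, show (j : ℝ) - 1 + i = j + i - 1 by ring,
    show (j : ℝ) + (i - 1) = j + i - 1 by ring, show (j : ℝ) - 1 + (i - 1) = j + i - 1 - 1 by ring]
  rw [sub_add_cancel] at h1
  have h2 : Real.sqrt |(j : ℝ) - 1 - i| + Real.sqrt |(j : ℝ) - (i - 1)| ≤
      2 * Real.sqrt |(j : ℝ) - i| := by
    rcases lt_or_gt_of_ne hij with h | h
    · have h' : (i : ℝ) + 1 ≤ j := by exact_mod_cast h
      rw [abs_of_nonneg (by linarith), abs_of_nonneg (by linarith), abs_of_nonneg (by linarith)]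
      have := sqrt_add_sqrt_le_s2 (x := (j : ℝ) - i) (by linarith)
      rw [show (j : ℝ) - 1 - i = j - i - 1 by ring, show (j : ℝ) - (i - 1) = j - i + 1 by ring]
      linarith
    · have h' : (j : ℝ) + 1 ≤ i := by exact_mod_cast h
      rw [abs_of_nonpos (by linarith), abs_of_nonpos (by linarith), abs_of_nonpos (by linarith)]
      have := sqrt_add_sqrt_le_s2 (x := (i : ℝ) - j) (by linarith)
      rw [show -((j : ℝ) - 1 - i) = i - j + 1 by ring,
        show -((j : ℝ) - (i - 1)) = i - j - 1 by ring, show -((j : ℝ) - i) = i - j by ring]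
      linarith
  linarith

lemma sqrtSecondDiff_self_le (i : ℕ) (hi : 1 ≤ i) : |sqrtSecondDiff i i| ≤ 2 := by
  have hi' : (1 : ℝ) ≤ i := by exact_mod_cast hi
  have h1 := sqrt_add_sqrt_le_s2 (x := (i : ℝ) + i - 1) (by linarith)
  have h2 := sqrt_sub_sqrt_le_one (x := (i : ℝ) + i - 1) (y := i + i - 1 - 1) (by linarith)
    (by linarith)
  have h3 := Real.sqrt_le_sqrt (show (i : ℝ) + i - 1 ≤ i + i by linarith)
  rw [sub_add_cancel] at h1
  rw [sqrtSecondDiff]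
  rw [show (i : ℝ) - 1 - (i - 1) = 0 by ring, show (i : ℝ) - 1 + i = i + i - 1 by ring,
    show (i : ℝ) + (i - 1) = i + i - 1 by ring, show (i : ℝ) - 1 + (i - 1) = i + i - 1 - 1 by ring,
    show (i : ℝ) - 1 - i = -1 by ring, show (i : ℝ) - (i - 1) = 1 by ring, sub_self]
  simp only [abs_zero, Real.sqrt_zero, abs_neg, abs_one, Real.sqrt_one]
  rw [abs_le]
  constructor <;> linarith

lemma sum_Ioc_sub_pred (u : ℝ → ℝ) {p q : ℕ} (hpq : p ≤ q) :
    ∑ j ∈ Finset.Ioc p q, (u j - u (j - 1)) = u q - u p := by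
  induction q, hpq using Nat.le_induction with
  | base => simp
  | succ q hq ih =>
    rw [Finset.sum_Ioc_succ_top (by omega), ih]
    push_cast
    rw [add_sub_cancel_right]
    ring

lemma sum_abs_sqrtSecondDiff_le {p q i : ℕ} (hi : i ∈ Finset.Ioc p q) :
    ∑ j ∈ Finset.Ioc p q, |sqrtSecondDiff i j| ≤ 8 := by
  have hi1 : 1 ≤ i := by have := (Finset.mem_Ioc.1 hi).1; omega
  have hpq : p ≤ q := ((Finset.mem_Ioc.1 hi).1.le).trans (Finset.mem_Ioc.1 hi).2
  have hi' : (1 : ℝ) ≤ i := by exact_mod_cast hi1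
  let u : ℝ → ℝ := fun j => (Real.sqrt (j + i) - Real.sqrt (j + (i - 1))) -
    (Real.sqrt |j - i| - Real.sqrt |j - (i - 1)|)
  have hu : ∀ j : ℕ, |u j| ≤ 2 := by
    intro j
    have hj : (0 : ℝ) ≤ j := j.cast_nonneg
    have h1 : |Real.sqrt ((j : ℝ) + i) - Real.sqrt (j + (i - 1))| ≤ 1 := by
      refine abs_sqrt_sub_sqrt_le_one (by linarith) (by linarith) ?_
      rw [show (j : ℝ) + i - (j + (i - 1)) = 1 by ring, abs_one]
    have h2 : |(Real.sqrt |(j : ℝ) - i|) - (Real.sqrt |(j : ℝ) - (i - 1)|)| ≤ 1 := by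
      refine abs_sqrt_sub_sqrt_le_one (abs_nonneg _) (abs_nonneg _)
        ((abs_abs_sub_abs_le _ _).trans ?_)
      rw [show (j : ℝ) - i - (j - (i - 1)) = -1 by ring, abs_neg, abs_one]
    exact (abs_sub _ _).trans (by linarith)
  have hsum : ∑ j ∈ Finset.Ioc p q, sqrtSecondDiff i j = u q - u p := by
    rw [← sum_Ioc_sub_pred u hpq]
    refine Finset.sum_congr rfl fun j _ => ?_
    simp only [sqrtSecondDiff, u]
    ring
  have habs : ∀ j ∈ Finset.Ioc p q, |sqrtSecondDiff i j| ≤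
      -sqrtSecondDiff i j + if i = j then 4 else 0 := by
    intro j hj
    split_ifs with h
    · subst h
      have h2 := sqrtSecondDiff_self_le i hi1
      linarith [le_abs_self (sqrtSecondDiff i i)]
    · have hj1 : 1 ≤ j := by have := (Finset.mem_Ioc.1 hj).1; omega
      rw [abs_of_nonpos (sqrtSecondDiff_nonpos hi1 hj1 h), add_zero]
  refine (Finset.sum_le_sum habs).trans ?_
  rw [Finset.sum_add_distrib, Finset.sum_neg_distrib, hsum, Finset.sum_ite_eq, if_pos hi]
  have := abs_le.1 (hu p)
  have := abs_le.1 (hu q)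
  linarith

lemma sum_abs_incrCov_le {n p q i : ℕ} (hn : 1 ≤ n) (hi : i ∈ Finset.Ioc p q) :
    ∑ j ∈ Finset.Ioc p q, |incrCov n i j| ≤ 8 * (Real.sqrt n)⁻¹ := by
  have hn' : (0 : ℝ) < n := by exact_mod_cast hn
  have hk : (Real.sqrt (2 * Real.pi))⁻¹ ≤ 1 := by
    refine inv_le_one_of_one_le₀ (Real.one_le_sqrt.2 ?_)
    nlinarith [Real.pi_gt_three]
  simp_rw [incrCov_eq hn', abs_mul]
  rw [← Finset.mul_sum, abs_of_nonneg (by positivity), abs_of_nonneg (by positivity)]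
  calc _ ≤ 1 * (Real.sqrt n)⁻¹ * 8 := by
        gcongr
        exact sum_abs_sqrtSecondDiff_le hi
    _ = _ := by ring

/-- The law of a linear combination of increments of the process. -/
lemma IsHeatGaussian.map_sum_incr {Ω : Type*} [MeasurableSpace Ω] {P : Measure Ω}
    {F : ℝ → Ω → ℝ} (hF : IsHeatGaussian P F) {n : ℕ} {ι : Type*} [Fintype ι] (a : ι → ℕ)
    (ha : ∀ i, 1 ≤ a i) (b : ι → ℝ) :
    P.map (fun ω => ∑ i, b i * (F ((a i : ℝ) / n) ω - F (((a i : ℝ) - 1) / n) ω)) =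
      gaussianReal 0 (Real.toNNReal (∑ i, ∑ j, b i * b j * incrCov n (a i) (a j))) := by
  let e : Fin (Fintype.card (ι ⊕ ι)) ≃ ι ⊕ ι := (Fintype.equivFin _).symm
  let ts : ι ⊕ ι → ℝ := Sum.elim (fun i => (a i : ℝ) / n) (fun i => ((a i : ℝ) - 1) / n)
  let c : ι ⊕ ι → ℝ := Sum.elim b (fun i => -b i)
  have hts : ∀ k, 0 ≤ ts k := by
    rintro (i | i)
    · exact div_nonneg (Nat.cast_nonneg _) (Nat.cast_nonneg _)
    · exact div_nonneg (sub_nonneg.2 (by exact_mod_cast ha i)) (Nat.cast_nonneg _)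
  have h := hF.2.2 _ (ts ∘ e) (c ∘ e) fun k => hts (e k)
  have h1 : ∀ ω, ∑ k, (c ∘ e) k * F ((ts ∘ e) k) ω =
      ∑ i, b i * (F ((a i : ℝ) / n) ω - F (((a i : ℝ) - 1) / n) ω) := by
    intro ω
    rw [show ∑ k, (c ∘ e) k * F ((ts ∘ e) k) ω = ∑ k, c k * F (ts k) ω from
      Equiv.sum_comp e fun k => c k * F (ts k) ω, Fintype.sum_sum_type, ← Finset.sum_add_distrib]
    exact Finset.sum_congr rfl fun i _ => by simp only [c, ts, Sum.elim_inl, Sum.elim_inr]; ring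
  have h2 : ∑ k, ∑ l, (c ∘ e) k * (c ∘ e) l * covK ((ts ∘ e) k) ((ts ∘ e) l) =
      ∑ i, ∑ j, b i * b j * incrCov n (a i) (a j) := by
    calc _ = ∑ k, ∑ l, c k * c l * covK (ts k) (ts l) := by
          rw [← Equiv.sum_comp e fun k => ∑ l, c k * c l * covK (ts k) (ts l)]
          exact Finset.sum_congr rfl fun k _ =>
            Equiv.sum_comp e fun l => c (e k) * c l * covK (ts (e k)) (ts l)
      _ = _ := by
          simp only [Fintype.sum_sum_type, ← Finset.sum_add_distrib]
          refine Finset.sum_congr rfl fun i _ => Finset.sum_congr rfl fun j _ => ?_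
          simp only [c, ts, Sum.elim_inl, Sum.elim_inr, incrCov]
          ring
  simp_rw [h1, h2] at h
  exact h

lemma IsHeatGaussian.map_incr {Ω : Type*} [MeasurableSpace Ω] {P : Measure Ω}
    {F : ℝ → Ω → ℝ} (hF : IsHeatGaussian P F) (n : ℕ) {j : ℕ} (hj : 1 ≤ j) :
    P.map (fun ω => F ((j : ℝ) / n) ω - F (((j : ℝ) - 1) / n) ω) =
      gaussianReal 0 (Real.toNNReal (incrCov n j j)) := by
  simpa using hF.map_sum_incr (n := n) (ι := Unit) (fun _ => j) (fun _ => hj) (fun _ => 1)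

lemma IsHeatGaussian.integral_incr_sq {Ω : Type*} [MeasurableSpace Ω] {P : Measure Ω}
    {F : ℝ → Ω → ℝ} (hF : IsHeatGaussian P F) (n : ℕ) {j : ℕ} (hj : 1 ≤ j) :
    ∫ ω, (F ((j : ℝ) / n) ω - F (((j : ℝ) - 1) / n) ω) ^ 2 ∂P =
      Real.toNNReal (incrCov n j j) := by
  have hm := hF.2.1
  rw [← integral_map (f := fun x : ℝ => x ^ 2) (by fun_prop) (by fun_prop), hF.map_incr n hj,
    ← variance_id_gaussianReal (μ := 0), variance_of_integral_eq_zero (by fun_prop)]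
  · rfl
  · simp

/-- The growth bound on the derivative of a function with Lipschitz derivative. -/
lemma Assumption31.deriv_sq_le {ι : Type*} {h : ι → ℝ → ℝ} {L : ℝ} (hh : Assumption31 h L)
    (j : ι) (x : ℝ) : deriv (h j) x ^ 2 ≤ 2 * L * (1 + x ^ 2) := by
  obtain ⟨Lj, hLj, hlip⟩ := hh.2.2.2.1 j
  have h1 : (deriv (h j) x - deriv (h j) 0) ^ 2 ≤ Lj ^ 2 * x ^ 2 := by
    have := hlip x 0
    rw [sub_zero] at this
    rw [← sq_abs, ← sq_abs x, ← mul_pow]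
    gcongr
  have h2 := hh.2.2.1 j
  nlinarith [sq_nonneg (deriv (h j) x - 2 * deriv (h j) 0), sq_nonneg x]

lemma Assumption31.integrable {ι : Type*} {h : ι → ℝ → ℝ} {L : ℝ} (hh : Assumption31 h L)
    (hL : 0 ≤ L) (j : ι) : Integrable (h j) (gaussianReal 0 1) := by
  have hbound : ∀ x, |h j x| ≤ |h j 0| + (2 * L * (1 + x ^ 2) + x ^ 2) := by
    intro x
    have h1 : |h j x - h j 0| ≤ Real.sqrt (2 * L * (1 + x ^ 2)) * |x - 0| := by
      refine Convex.norm_image_sub_le_of_norm_deriv_le (𝕜 := ℝ) (s := Set.Icc (-|x|) |x|)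
        (fun y _ => (hh.1 j).differentiable (by norm_num) y) (fun y hy => ?_) (convex_Icc _ _)
        (by simp) (abs_le.1 le_rfl)
      refine Real.abs_le_sqrt ((hh.deriv_sq_le j y).trans ?_)
      have : y ^ 2 ≤ x ^ 2 := sq_le_sq.2 (abs_le.2 hy)
      gcongr
    have h2 := Real.sq_sqrt (show 0 ≤ 2 * L * (1 + x ^ 2) by positivity)
    have h3 := abs_sub_abs_le_abs_sub (h j x) (h j 0)
    rw [sub_zero] at h1
    nlinarith [sq_nonneg (Real.sqrt (2 * L * (1 + x ^ 2)) - |x|), sq_abs x,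
      Real.sqrt_nonneg (2 * L * (1 + x ^ 2)), abs_nonneg x]
  have hi := integrable_pow_gaussianReal 2 1
  refine Integrable.mono' (g := fun x => |h j 0| + (2 * L * (1 + x ^ 2) + x ^ 2)) ?_
    (hh.1 j).continuous.aestronglyMeasurable (ae_of_all _ hbound)
  exact (integrable_const _).add ((((integrable_const _).add hi).const_mul _).add hi)

/-- Rescaling turns a mean zero function of a standard Gaussian variable into one of a Gaussian
variable of variance `v`. -/
lemma integrable_integral_rescaled {f : ℝ → ℝ} (hfc : Continuous f)
    (hf : Integrable f (gaussianReal 0 1)) (hf0 : ∫ x, f x ∂(gaussianReal 0 1) = 0) (v : NNReal) :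
    Integrable (fun x => (v : ℝ) * f ((Real.sqrt v)⁻¹ * x)) (gaussianReal 0 v) ∧
      ∫ x, (v : ℝ) * f ((Real.sqrt v)⁻¹ * x) ∂(gaussianReal 0 v) = 0 := by
  rcases eq_or_ne v 0 with rfl | hv
  · simp
  have hmap : (gaussianReal 0 v).map (fun x => (Real.sqrt v)⁻¹ * x) = gaussianReal 0 1 := by
    rw [gaussianReal_map_const_mul]
    congr 1
    · simp
    · have : (v : ℝ) ≠ 0 := by exact_mod_cast hv
      ext
      simp [this]
  rw [← hmap] at hf hf0
  rw [integral_map (by fun_prop) (by fun_prop)] at hf0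
  refine ⟨(hf.comp_measurable (by fun_prop)).const_mul _, ?_⟩
  rw [integral_const_mul, hf0, mul_zero]

lemma Bproc_sub_eq_sum {Ω : Type*} [MeasurableSpace Ω] (P : Measure Ω) (F : ℝ → Ω → ℝ)
    (h : ℕ → ℝ → ℝ) {n : ℕ} {s t : ℝ} (hst : s ≤ t) (ω : Ω) :
    Bproc P F h n t ω - Bproc P F h n s ω =
      ∑ j ∈ Finset.Ioc ⌊(n : ℝ) * s⌋₊ ⌊(n : ℝ) * t⌋₊,
        (∫ ω', (F ((j : ℝ) / n) ω' - F (((j : ℝ) - 1) / n) ω') ^ 2 ∂P) *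
          h j ((Real.sqrt
              (∫ ω', (F ((j : ℝ) / n) ω' - F (((j : ℝ) - 1) / n) ω') ^ 2 ∂P))⁻¹ *
            (F ((j : ℝ) / n) ω - F (((j : ℝ) - 1) / n) ω)) := by
  have hpq : ⌊(n : ℝ) * s⌋₊ ≤ ⌊(n : ℝ) * t⌋₊ := by gcongr
  rw [sub_eq_iff_eq_add', Bproc, Bproc]
  exact (Finset.sum_Ioc_consecutive _ (Nat.zero_le _) hpq).symm

/-- Proposition 3.5: for every `L ≥ 0` there is a constant `C`, depending only on
`L`, such that `E|B_n(t) − B_n(s)|⁴ ≤ C((⌊nt⌋ − ⌊ns⌋)/n)²` whenever `{h_j}` and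
`L` satisfy Assumption 3.1. -/
theorem Bproc_fourth_moment_bound (L : ℝ) (hL : 0 ≤ L) :
    ∃ C : ℝ, ∀ (Ω : Type) [MeasurableSpace Ω] (P : Measure Ω)
      (F : ℝ → Ω → ℝ), IsHeatGaussian P F →
      ∀ h : ℕ → ℝ → ℝ, Assumption31 h L →
      ∀ n : ℕ, 1 ≤ n → ∀ s t : ℝ, 0 ≤ s → s < t →
        (∫ ω, (Bproc P F h n t ω - Bproc P F h n s ω) ^ 4 ∂P) ≤
          C * (((⌊(n : ℝ) * t⌋₊ : ℝ) - (⌊(n : ℝ) * s⌋₊ : ℝ)) / n) ^ 2 := by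
  refine ⟨(Real.pi / 2) ^ 4 * (2 * gaussianFourthMoment * (1 + gaussianFourthMoment) *
    (2 * L) ^ 2 * 8 ^ 4), fun Ω _ P F hF h hh n hn s t _ hst => ?_⟩
  have hM := gaussianFourthMoment_nonneg
  have := hF.1
  have hm := hF.2.1
  set p := ⌊(n : ℝ) * s⌋₊
  set q := ⌊(n : ℝ) * t⌋₊
  have hpq : p ≤ q := by
    simp only [p, q]
    gcongr
  let ι := {j // j ∈ Finset.Ioc p q}
  have hι : ∀ i : ι, 1 ≤ (i : ℕ) := fun i => by have := (Finset.mem_Ioc.1 i.2).1; omega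
  let v : ℕ → NNReal := fun j => Real.toNNReal (incrCov n j j)
  let g : ι → ℝ → ℝ := fun i x => (v i : ℝ) * h i ((Real.sqrt (v i))⁻¹ * x)
  let ξ : Ω → ι → ℝ := fun ω i => F ((i : ℕ) / n) ω - F (((i : ℕ) - 1 : ℝ) / n) ω
  have hξ : Measurable ξ := measurable_pi_lambda _ fun i => by
    simp only [ξ]
    fun_prop
  have hhc : ∀ j, Continuous (h j) := fun j => (hh.1 j).continuous
  have hgc : ∀ i, Continuous (g i) := fun i => by
    simp only [g]
    have := hhc i
    fun_prop
  have hcoord : ∀ i : ι, (P.map ξ).map (fun x => x i) = gaussianReal 0 (v i) := fun i => by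
    rw [Measure.map_map (by fun_prop) hξ]
    exact hF.map_incr n (hι i)
  have hresc := fun i : ι => integrable_integral_rescaled (hhc i) (hh.integrable hL i)
    (hh.2.2.2.2.1 i) (v i)
  have hR : ∀ i : ι, ∑ j : ι, |incrCov n (i : ℕ) (j : ℕ)| ≤ 8 * (Real.sqrt n)⁻¹ := fun i => by
    rw [Finset.sum_coe_sort (Finset.Ioc p q) fun j : ℕ => |incrCov n (i : ℕ) j|]
    exact sum_abs_incrCov_le hn i.2
  have hv : ∀ i : ι, (v i : ℝ) ≤ 8 * (Real.sqrt n)⁻¹ := fun i => by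
    simp only [v, Real.coe_toNNReal']
    refine max_le ?_ (by positivity)
    exact (le_abs_self _).trans ((Finset.single_le_sum
      (f := fun j : ι => |incrCov n (i : ℕ) (j : ℕ)|) (fun j _ => abs_nonneg _)
      (Finset.mem_univ i)).trans (hR i))
  have hderiv : ∀ (i : ι) (x : ℝ),
      deriv (g i) x ^ 2 ≤ 2 * L * (8 * (Real.sqrt n)⁻¹ + x ^ 2) := by
    intro i x
    have hd : deriv (g i) x =
        (v i : ℝ) * ((Real.sqrt (v i))⁻¹ * deriv (h i) ((Real.sqrt (v i))⁻¹ * x)) := by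
      simp only [g]
      rw [deriv_const_mul_field, deriv_comp_mul_left, smul_eq_mul]
    have hsq : (Real.sqrt (v i))⁻¹ ^ 2 = (v i : ℝ)⁻¹ := by
      rw [inv_pow, Real.sq_sqrt (NNReal.coe_nonneg _)]
    have hd2 := hh.deriv_sq_le i ((Real.sqrt (v i))⁻¹ * x)
    rw [mul_pow, hsq] at hd2
    rw [hd, mul_pow, mul_pow, hsq]
    rcases eq_or_ne (v i : ℝ) 0 with h0 | h0
    · rw [h0]
      simp only [ne_eq, OfNat.ofNat_ne_zero, not_false_eq_true, zero_pow, zero_mul]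
      positivity
    calc (v i : ℝ) ^ 2 * ((v i : ℝ)⁻¹ * deriv (h i) ((Real.sqrt (v i))⁻¹ * x) ^ 2)
        ≤ (v i : ℝ) ^ 2 * ((v i : ℝ)⁻¹ * (2 * L * (1 + (v i : ℝ)⁻¹ * x ^ 2))) := by gcongr
      _ = 2 * L * (v i + x ^ 2) := by field_simp
      _ ≤ _ := by
        gcongr
        exact hv i
  have key := lintegral_sum_pow_four_le (P.map ξ) (fun i j : ι => incrCov n (i : ℕ) (j : ℕ))
    (fun i j => incrCov_comm _ _ _)
    (fun b => by
      rw [Measure.map_map (by fun_prop) hξ]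
      exact hF.map_sum_incr (fun i : ι => (i : ℕ)) hι b)
    (R := 8 * (Real.sqrt n)⁻¹) (by positivity) hR (g := g)
    (fun i => contDiff_const.mul ((hh.1 i).comp (contDiff_const.mul contDiff_id)))
    (A := 2 * L) hderiv
    (fun i => by
      have := (hresc i).1
      rw [← hcoord i] at this
      exact this.comp_measurable (by fun_prop))
    (fun i => by
      have := (hresc i).2
      rw [← hcoord i, integral_map (measurable_pi_apply i).aemeasurable (hgc i).aestronglyMeasurable] at this
      exact this)
  have hgm : ∀ i, Measurable (g i) := fun i => (hgc i).measurable
  rw [lintegral_map (by fun_prop) hξ] at key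
  have hB : ∀ ω, Bproc P F h n t ω - Bproc P F h n s ω = ∑ i, g i (ξ ω i) := by
    intro ω
    rw [Bproc_sub_eq_sum P F h hst.le, ← Finset.sum_coe_sort]
    refine Finset.sum_congr rfl fun i _ => ?_
    rw [hF.integral_incr_sq n (hι i)]
  simp_rw [hB]
  rw [integral_eq_lintegral_of_nonneg_ae (ae_of_all _ fun ω => by positivity)
    (Measurable.aestronglyMeasurable (by fun_prop))]
  simp_rw [← enorm_pow_four]
  refine ENNReal.toReal_le_of_le_ofReal (by positivity) (key.trans (le_of_eq ?_))
  congr 1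
  have hs4 : (Real.sqrt n)⁻¹ ^ 4 = ((n : ℝ) ^ 2)⁻¹ := by
    rw [inv_pow, show Real.sqrt n ^ 4 = (Real.sqrt n ^ 2) ^ 2 by ring,
      Real.sq_sqrt (Nat.cast_nonneg n)]
  have hcard : (Fintype.card ι : ℝ) = (q : ℝ) - p := by
    rw [Fintype.card_coe, Nat.card_Ioc, Nat.cast_sub hpq]
  rw [hcard, mul_pow 8, hs4, div_pow]
  ring
end
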